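/- Interior Lipschitz stability (Theorem 1.2). Let B ⊂ ℝ^n and Ω be bounded domains with C^4 boundaries such that closure(Ω) ⊂ B; set S = ∂B and Γ = ∂Ω. For every r > 0 there exists a constant C > 0 (depending only on g, p, B, Ω and r) with the following property: for all α, β > 0 with β/α ≤ r, for every function 𝔞 on S that is the restriction to S of a C^1 function and satisfies |𝔞| ≥ α and |∇_τ 𝔞| ≤ β everywhere on S, and for every function v that is C^2 on closure(B), solves −Δ_g v + p v = 0 almost everywhere in B, and equals 𝔞 on S, one has (∫_S (|𝔞|^2 + |∇_τ 𝔞|^2) dH^{n−1})^{1/2} ≤ C [ (∫_Γ (|v|^2 + |∇_τ v|^2) dH^{n−1})^{1/2} + (∫_Γ |∂_ν v|^2 dH^{n−1})^{1/2} ], where ν is the outward unit normal to Γ. -/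

import Mathlib

open MeasureTheory Set
open scoped Topology RealInnerProductSpace

noncomputable section

/-- Euclidean space `ℝ^n`. -/
abbrev Eucl (n : ℕ) : Type := EuclideanSpace ℝ (Fin n)

variable {n : ℕ}

/-- `i`-th partial derivative `∂_i u`. -/
def pd (u : Eucl n → ℝ) (i : Fin n) (x : Eucl n) : ℝ :=
  fderiv ℝ u x (EuclideanSpace.single i 1)

/-- Laplace–Beltrami operator
`Δ_g u = |g|^{-1/2} ∂_i (|g|^{1/2} g^{ij} ∂_j u)` (with `(g^{ij}) = (g_{ij})⁻¹`). -/
def LapBel (g : Eucl n → Matrix (Fin n) (Fin n) ℝ) (u : Eucl n → ℝ) (x : Eucl n) : ℝ :=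
  (Real.sqrt (g x).det)⁻¹ *
    ∑ i, pd (fun y => Real.sqrt (g y).det * ∑ j, (g y)⁻¹ i j * pd u j y) i x

/-- `⟨∇_g w, ∇_g z⟩_g = g^{ij} ∂_i w ∂_j z`. -/
def gInnerGrad (g : Eucl n → Matrix (Fin n) (Fin n) ℝ) (w z : Eucl n → ℝ) (x : Eucl n) : ℝ :=
  ∑ i, ∑ j, (g x)⁻¹ i j * pd w i x * pd z j x

/-- Uniform ellipticity: `g_{ij}(x) ξ^i ξ^j ≥ θ |ξ|²` for all `x, ξ`. -/
def UniformlyElliptic (g : Eucl n → Matrix (Fin n) (Fin n) ℝ) (θ : ℝ) : Prop :=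
  ∀ (x : Eucl n) (ξ : Fin n → ℝ), θ * ∑ i, (ξ i) ^ 2 ≤ ∑ i, ∑ j, g x i j * ξ i * ξ j

/-- Symmetric matrix-valued metric with `C³` entries having bounded derivatives up to order 3. -/
def MetricC3Bounded (g : Eucl n → Matrix (Fin n) (Fin n) ℝ) : Prop :=
  (∀ x, (g x).IsSymm) ∧ (∀ i j, ContDiff ℝ 3 fun x => g x i j) ∧
    ∃ M : ℝ, ∀ (i j : Fin n) (k : ℕ), k ≤ 3 → ∀ x,
      ‖iteratedFDeriv ℝ k (fun y => g y i j) x‖ ≤ M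

/-- Symmetric matrix-valued metric with `C¹` entries. -/
def MetricC1 (g : Eucl n → Matrix (Fin n) (Fin n) ℝ) : Prop :=
  (∀ x, (g x).IsSymm) ∧ ∀ i j, ContDiff ℝ 1 fun x => g x i j

/-- A bounded open set has `C⁴` boundary: near each boundary point there is a `C⁴` defining
function `ρ` with nonvanishing gradient, `D = {ρ < 0}` and `∂D = {ρ = 0}` locally. -/
def HasC4Boundary (D : Set (Eucl n)) : Prop :=
  ∀ x ∈ frontier D, ∃ (V : Set (Eucl n)) (ρ : Eucl n → ℝ),
    IsOpen V ∧ x ∈ V ∧ ContDiffOn ℝ 4 ρ V ∧ (∀ y ∈ V, gradient ρ y ≠ 0) ∧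
    D ∩ V = {y | y ∈ V ∧ ρ y < 0} ∧ frontier D ∩ V = {y | y ∈ V ∧ ρ y = 0}

/-- `ν` is the outward unit normal field of `D` on `∂D`: `ν = ∇ρ/|∇ρ|` for local `C⁴`
defining functions `ρ`. -/
def IsOutwardNormalField (D : Set (Eucl n)) (ν : Eucl n → Eucl n) : Prop :=
  ∀ x ∈ frontier D, ∃ (V : Set (Eucl n)) (ρ : Eucl n → ℝ),
    IsOpen V ∧ x ∈ V ∧ ContDiffOn ℝ 4 ρ V ∧ (∀ y ∈ V, gradient ρ y ≠ 0) ∧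
    D ∩ V = {y | y ∈ V ∧ ρ y < 0} ∧ frontier D ∩ V = {y | y ∈ V ∧ ρ y = 0} ∧
    ν x = ‖gradient ρ x‖⁻¹ • gradient ρ x

/-- Normal derivative `∂_ν w = ∇w · ν`. -/
def normalDeriv (ν : Eucl n → Eucl n) (w : Eucl n → ℝ) (x : Eucl n) : ℝ :=
  ⟪gradient w x, ν x⟫

/-- Tangential gradient `∇_τ w = ∇w − (∂_ν w) ν`. -/
def tangGrad (ν : Eucl n → Eucl n) (w : Eucl n → ℝ) (x : Eucl n) : Eucl n :=
  gradient w x - (normalDeriv ν w x) • ν x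

/-- `g`-normal derivative `∂_{ν_g} w = g^{ij} ν_i ∂_j w / √(g^{kℓ} ν_k ν_ℓ)`. -/
def gNormalDeriv (g : Eucl n → Matrix (Fin n) (Fin n) ℝ) (ν : Eucl n → Eucl n)
    (w : Eucl n → ℝ) (x : Eucl n) : ℝ :=
  (∑ i, ∑ j, (g x)⁻¹ i j * ν x i * pd w j x) /
    Real.sqrt (∑ k, ∑ l, (g x)⁻¹ k l * ν x k * ν x l)

section Part1
open MeasureTheory Set
open scoped Topology RealInnerProductSpace
variable {n : ℕ}

lemma pd_contDiff {u : Eucl n → ℝ} {k m : WithTop ℕ∞} (hu : ContDiff ℝ m u) (hkm : k + 1 ≤ m)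
    (i : Fin n) : ContDiff ℝ k (pd u i) := by
  unfold pd
  exact (hu.fderiv_right hkm).clm_apply contDiff_const

lemma pd_continuous {u : Eucl n → ℝ} (hu : ContDiff ℝ 1 u) (i : Fin n) : Continuous (pd u i) :=
  (pd_contDiff (k := 0) hu (by norm_num) i).continuous

lemma pd_mul {f g : Eucl n → ℝ} {x : Eucl n} (hf : DifferentiableAt ℝ f x)
    (hg : DifferentiableAt ℝ g x) (i : Fin n) :
    pd (fun y => f y * g y) i x = pd f i x * g x + f x * pd g i x := by
  unfold pd
  rw [fderiv_fun_mul hf hg]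
  simp
  ring

lemma pd_add {f g : Eucl n → ℝ} {x : Eucl n} (hf : DifferentiableAt ℝ f x)
    (hg : DifferentiableAt ℝ g x) (i : Fin n) :
    pd (fun y => f y + g y) i x = pd f i x + pd g i x := by
  unfold pd
  rw [fderiv_fun_add hf hg]
  simp

lemma pd_sub {f g : Eucl n → ℝ} {x : Eucl n} (hf : DifferentiableAt ℝ f x)
    (hg : DifferentiableAt ℝ g x) (i : Fin n) :
    pd (fun y => f y - g y) i x = pd f i x - pd g i x := by
  unfold pd
  rw [fderiv_fun_sub hf hg]
  simp

lemma pd_neg {f : Eucl n → ℝ} {x : Eucl n} (i : Fin n) :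
    pd (fun y => - f y) i x = - pd f i x := by
  unfold pd
  rw [fderiv_fun_neg]
  simp

lemma pd_const_mul {f : Eucl n → ℝ} {x : Eucl n} (c : ℝ) (hf : DifferentiableAt ℝ f x)
    (i : Fin n) :
    pd (fun y => c * f y) i x = c * pd f i x := by
  unfold pd
  rw [fderiv_const_mul hf]
  simp

lemma pd_const (c : ℝ) (i : Fin n) (x : Eucl n) : pd (fun _ => c) i x = 0 := by
  unfold pd
  simp

lemma pd_sum {ι : Type*} (s : Finset ι) {f : ι → Eucl n → ℝ} {x : Eucl n}
    (hf : ∀ j, DifferentiableAt ℝ (f j) x) (i : Fin n) :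
    pd (fun y => ∑ j ∈ s, f j y) i x = ∑ j ∈ s, pd (f j) i x := by
  unfold pd
  rw [fderiv_fun_sum (fun j _ => hf j)]
  simp

lemma pd_comp {f : ℝ → ℝ} {u : Eucl n → ℝ} {x : Eucl n} (hf : DifferentiableAt ℝ f (u x))
    (hu : DifferentiableAt ℝ u x) (i : Fin n) :
    pd (fun y => f (u y)) i x = deriv f (u x) * pd u i x := by
  unfold pd
  have := (hf.hasDerivAt.comp_hasFDerivAt x hu.hasFDerivAt).fderiv
  change fderiv ℝ (f ∘ u) x _ = _
  rw [this]
  simp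

lemma pd_comm {u : Eucl n → ℝ} {x : Eucl n} (hu : ContDiffAt ℝ 2 u x) (i j : Fin n) :
    pd (pd u i) j x = pd (pd u j) i x := by
  have hs : IsSymmSndFDerivAt ℝ u x := hu.isSymmSndFDerivAt (by simp)
  have hd : DifferentiableAt ℝ (fderiv ℝ u) x :=
    (hu.fderiv_right (m := 1) (by norm_num)).differentiableAt (by norm_num)
  have key : ∀ a b : Eucl n, fderiv ℝ (fun y => fderiv ℝ u y a) x b = fderiv ℝ (fderiv ℝ u) x b a := by
    intro a b
    rw [fderiv_clm_apply hd (by fun_prop)]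
    simp
  unfold pd
  rw [key, key]
  exact hs _ _

lemma pd_congr {u v : Eucl n → ℝ} {x : Eucl n} (h : u =ᶠ[𝓝 x] v) (i : Fin n) :
    pd u i x = pd v i x := by
  unfold pd
  rw [h.fderiv_eq]

lemma pd_eventuallyEq {u v : Eucl n → ℝ} {x : Eucl n} (h : u =ᶠ[𝓝 x] v) (i : Fin n) :
    pd u i =ᶠ[𝓝 x] pd v i := by
  filter_upwards [h.eventuallyEq_nhds] with y hy
  exact pd_congr hy i

lemma tsupport_pd_subset (u : Eucl n → ℝ) (i : Fin n) : tsupport (pd u i) ⊆ tsupport u :=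
  (tsupport_fderiv_apply_subset ℝ _)

/-- integration by parts -/
lemma ibp {F θ : Eucl n → ℝ} (hF : ContDiff ℝ 1 F) (hθ : ContDiff ℝ 1 θ)
    (hc : HasCompactSupport θ) (i : Fin n) :
    ∫ x, pd F i x * θ x = - ∫ x, F x * pd θ i x := by
  have h := integral_mul_fderiv_eq_neg_fderiv_mul_of_integrable (μ := (volume : Measure (Eucl n)))
    (f := θ) (g := F) (v := EuclideanSpace.single i 1) ?_ ?_ ?_ ?_ ?_
  · calc ∫ x, pd F i x * θ x = ∫ x, θ x * pd F i x := by simp_rw [mul_comm]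
      _ = - ∫ x, pd θ i x * F x := h
      _ = _ := by simp_rw [mul_comm]
  · refine Continuous.integrable_of_hasCompactSupport ((pd_continuous hθ i).mul hF.continuous) ?_
    refine HasCompactSupport.mul_right (f := pd θ i) ?_
    exact hc.mono' (subset_tsupport _ |>.trans (tsupport_pd_subset θ i))
  · exact Continuous.integrable_of_hasCompactSupport (hθ.continuous.mul (pd_continuous hF i))
      hc.mul_right
  · exact Continuous.integrable_of_hasCompactSupport (hθ.continuous.mul hF.continuous)
      hc.mul_right
  · exact fun x _ => (hF.differentiable (by norm_num) x : DifferentiableAt ℝ F x) |> fun _ =>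
      hθ.differentiable (by norm_num) x
  · exact fun x _ => hF.differentiable (by norm_num) x

def flux (a : Fin n → Fin n → Eucl n → ℝ) (u : Eucl n → ℝ) (i : Fin n) (x : Eucl n) : ℝ :=
  ∑ j, a i j x * pd u j x

def Lop (a : Fin n → Fin n → Eucl n → ℝ) (u : Eucl n → ℝ) (x : Eucl n) : ℝ :=
  ∑ i, pd (flux a u i) i x

def gq (a : Fin n → Fin n → Eucl n → ℝ) (u v : Eucl n → ℝ) (x : Eucl n) : ℝ :=
  ∑ i, flux a u i x * pd v i x

structure IsCoef (a b : Fin n → Fin n → Eucl n → ℝ) : Prop where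
  smooth : ∀ i j, ContDiff ℝ 3 (a i j)
  symm : ∀ i j x, a i j x = a j i x
  pos : ∀ x (ξ : Fin n → ℝ), ξ ≠ 0 → 0 < ∑ i, ∑ j, a i j x * ξ i * ξ j
  bcont : ∀ i j, Continuous (b i j)
  bsymm : ∀ i j x, b i j x = b j i x
  inv : ∀ i k x, ∑ j, a i j x * b j k x = if i = k then 1 else 0

variable {a b : Fin n → Fin n → Eucl n → ℝ}

lemma flux_contDiff {k m : WithTop ℕ∞} (hC : IsCoef a b) {u : Eucl n → ℝ} (hu : ContDiff ℝ m u)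
    (hk : k + 1 ≤ m) (hk3 : k ≤ 3) (i : Fin n) : ContDiff ℝ k (flux a u i) := by
  unfold flux
  exact ContDiff.sum fun j _ => ((hC.smooth i j).of_le hk3).mul (pd_contDiff hu hk j)

lemma gq_contDiff {k m : WithTop ℕ∞} (hC : IsCoef a b) {u v : Eucl n → ℝ} (hu : ContDiff ℝ m u)
    (hv : ContDiff ℝ m v)
    (hk : k + 1 ≤ m) (hk3 : k ≤ 3) : ContDiff ℝ k (gq a u v) := by
  unfold gq
  exact ContDiff.sum fun j _ => (flux_contDiff hC hu hk hk3 j).mul (pd_contDiff hv hk j)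

lemma Lop_continuous (hC : IsCoef a b) {u : Eucl n → ℝ} (hu : ContDiff ℝ 2 u) :
    Continuous (Lop a u) := by
  unfold Lop
  exact continuous_finsetSum _ fun i _ =>
    pd_continuous (flux_contDiff hC hu (by norm_num) (by norm_num) i) i

lemma gq_symm (hC : IsCoef a b) (u v : Eucl n → ℝ) (x : Eucl n) : gq a u v x = gq a v u x := by
  unfold gq flux
  simp_rw [Finset.sum_mul]
  rw [Finset.sum_comm]
  refine Finset.sum_congr rfl fun i _ => Finset.sum_congr rfl fun j _ => ?_
  rw [hC.symm j i]
  ring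

/-- `∑ ∂_i (G_i s) = (∑ ∂_i G_i) s + ∑ G_i ∂_i s`. -/
lemma divg_mul {G : Fin n → Eucl n → ℝ} {s : Eucl n → ℝ} {x : Eucl n}
    (hG : ∀ i, DifferentiableAt ℝ (G i) x) (hs : DifferentiableAt ℝ s x) :
    ∑ i, pd (fun y => G i y * s y) i x = (∑ i, pd (G i) i x) * s x + ∑ i, G i x * pd s i x := by
  rw [Finset.sum_mul, ← Finset.sum_add_distrib]
  exact Finset.sum_congr rfl fun i _ => pd_mul (hG i) hs i
end Part1

section Part2
open MeasureTheory Set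
open scoped Topology RealInnerProductSpace
variable {n : ℕ} {a b : Fin n → Fin n → Eucl n → ℝ}

/-- first-order form `E1(ξ) = ∑ (Aξ)_i ∂_i X_k ξ_k`, with `X = A∇φ`. -/
def E1 (a : Fin n → Fin n → Eucl n → ℝ) (φ : Eucl n → ℝ) (x : Eucl n) (ξ : Fin n → ℝ) : ℝ :=
  ∑ i, ∑ k, (∑ j, a i j x * ξ j) * pd (flux a φ k) i x * ξ k

def E2 (a : Fin n → Fin n → Eucl n → ℝ) (φ : Eucl n → ℝ) (x : Eucl n) (ξ : Fin n → ℝ) : ℝ :=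
  ∑ i, flux a φ i x * ∑ j, ∑ k, pd (a j k) i x * ξ j * ξ k

def qf (a : Fin n → Fin n → Eucl n → ℝ) (x : Eucl n) (ξ : Fin n → ℝ) : ℝ :=
  ∑ i, ∑ j, a i j x * ξ i * ξ j

def XN (a : Fin n → Fin n → Eucl n → ℝ) (φ : Eucl n → ℝ) (x : Eucl n) : ℝ :=
  ∑ i, flux a φ i x * pd (gq a φ φ) i x

/-- pointwise zero order coefficient -/
def Zc (a : Fin n → Fin n → Eucl n → ℝ) (φ h : Eucl n → ℝ) (x : Eucl n) : ℝ :=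
  XN a φ x + gq a φ φ x * (Lop a φ x + h x)

def Vf (a : Fin n → Fin n → Eucl n → ℝ) (φ h w : Eucl n → ℝ) (τ : ℝ) (i : Fin n) (x : Eucl n) : ℝ :=
  (-2 * τ) * (flux a w i x * gq a φ w x) + τ * (flux a φ i x * gq a w w x)
    + τ * (flux a w i x * (h x * w x)) + (-(τ / 2)) * (flux a h i x * (w x * w x))
    + (-τ ^ 3) * (flux a φ i x * (gq a φ φ x * (w x * w x)))

lemma gq_self_eq (x : Eucl n) (w : Eucl n → ℝ) : gq a w w x = qf a x (fun i => pd w i x) := by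
  unfold gq qf flux
  refine Finset.sum_congr rfl fun i _ => ?_
  rw [Finset.sum_mul]
  exact Finset.sum_congr rfl fun j _ => by ring

lemma flux_diff (hC : IsCoef a b) {u : Eucl n → ℝ} (hu : ContDiff ℝ 2 u) (i : Fin n) (x : Eucl n) :
    DifferentiableAt ℝ (flux a u i) x :=
  (flux_contDiff (k := 1) hC hu (by norm_num) (by norm_num) i).differentiable (by norm_num) x

lemma gq_diff (hC : IsCoef a b) {u v : Eucl n → ℝ} (hu : ContDiff ℝ 2 u) (hv : ContDiff ℝ 2 v)
    (x : Eucl n) :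
    DifferentiableAt ℝ (gq a u v) x :=
  (gq_contDiff (k := 1) hC hu hv (by norm_num) (by norm_num)).differentiable (by norm_num) x

lemma pd_diff {u : Eucl n → ℝ} (hu : ContDiff ℝ 2 u) (i : Fin n) (x : Eucl n) :
    DifferentiableAt ℝ (pd u i) x :=
  (pd_contDiff (k := 1) hu (by norm_num) i).differentiable (by norm_num) x

lemma rell_vi (hC : IsCoef a b) {φ w : Eucl n → ℝ} (hφ : ContDiff ℝ 2 φ) (hw : ContDiff ℝ 2 w)
    (x : Eucl n) :
    ∑ i, flux a w i x * pd (gq a φ w) i x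
      = E1 a φ x (fun i => pd w i x) + ∑ i, ∑ k, flux a w i x * flux a φ k x * pd (pd w k) i x := by
  unfold E1
  rw [← Finset.sum_add_distrib]
  refine Finset.sum_congr rfl fun i _ => ?_
  have : pd (gq a φ w) i x = ∑ k, (pd (flux a φ k) i x * pd w k x + flux a φ k x * pd (pd w k) i x) := by
    unfold gq
    rw [pd_sum]
    · exact Finset.sum_congr rfl fun k _ => pd_mul (flux_diff hC hφ k x) (pd_diff hw k x) i
    · exact fun k => (flux_diff hC hφ k x).mul (pd_diff hw k x)
  rw [this, Finset.mul_sum, ← Finset.sum_add_distrib]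
  refine Finset.sum_congr rfl fun k _ => ?_
  change _ = flux a w i x * _ * _ + _
  ring

lemma rell_vii (hC : IsCoef a b) {φ w : Eucl n → ℝ} (hw : ContDiff ℝ 2 w)
    (x : Eucl n) :
    ∑ i, flux a φ i x * pd (gq a w w) i x
      = E2 a φ x (fun i => pd w i x)
        + 2 * ∑ i, ∑ k, flux a w i x * flux a φ k x * pd (pd w k) i x := by
  have hA : ∀ j k, DifferentiableAt ℝ (a j k) x := fun j k =>
    (hC.smooth j k).differentiable (by norm_num) x
  have h1 : ∀ i, pd (gq a w w) i x = (∑ j, ∑ k, pd (a j k) i x * pd w j x * pd w k x)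
      + 2 * ∑ j, flux a w j x * pd (pd w j) i x := by
    intro i
    have e : gq a w w = fun y => ∑ j, ∑ k, a j k y * (pd w k y * pd w j y) := by
      funext y
      unfold gq flux
      simp_rw [Finset.sum_mul, mul_assoc]
    have hd : ∀ j k, DifferentiableAt ℝ (fun y => a j k y * (pd w k y * pd w j y)) x := fun j k =>
      (hA j k).mul ((pd_diff hw k x).mul (pd_diff hw j x))
    rw [e, pd_sum _ (fun j => DifferentiableAt.fun_sum fun k _ => hd j k)]
    have : ∀ j, pd (fun y => ∑ k, a j k y * (pd w k y * pd w j y)) i x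
        = ∑ k, (pd (a j k) i x * (pd w k x * pd w j x)
          + a j k x * (pd (pd w k) i x * pd w j x + pd w k x * pd (pd w j) i x)) := by
      intro j
      rw [pd_sum _ (fun k => hd j k)]
      refine Finset.sum_congr rfl fun k _ => ?_
      rw [pd_mul (hA j k) ((pd_diff hw k x).fun_mul (pd_diff hw j x)), pd_mul (pd_diff hw k x) (pd_diff hw j x)]
    simp_rw [this, Finset.sum_add_distrib, mul_add, Finset.sum_add_distrib]
    have e1 : ∑ j, ∑ k, a j k x * (pd w k x * pd (pd w j) i x) = ∑ j, flux a w j x * pd (pd w j) i x := by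
      unfold flux
      refine Finset.sum_congr rfl fun j _ => ?_
      rw [Finset.sum_mul]
      exact Finset.sum_congr rfl fun k _ => by ring
    have e2 : ∑ j, ∑ k, a j k x * (pd (pd w k) i x * pd w j x) = ∑ j, flux a w j x * pd (pd w j) i x := by
      rw [← e1, Finset.sum_comm]
      refine Finset.sum_congr rfl fun j _ => Finset.sum_congr rfl fun k _ => ?_
      rw [hC.symm k j]; ring
    rw [e1, e2]
    have e3 : ∑ j, ∑ k, pd (a j k) i x * (pd w k x * pd w j x)
        = ∑ j, ∑ k, pd (a j k) i x * pd w j x * pd w k x :=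
      Finset.sum_congr rfl fun j _ => Finset.sum_congr rfl fun k _ => by ring
    rw [e3]; ring
  simp_rw [h1, mul_add, Finset.sum_add_distrib]
  unfold E2
  congr 1
  rw [Finset.sum_comm, Finset.mul_sum]
  refine Finset.sum_congr rfl fun i _ => ?_
  rw [Finset.mul_sum, Finset.mul_sum, Finset.mul_sum]
  refine Finset.sum_congr rfl fun k _ => ?_
  rw [pd_comm hw.contDiffAt k i]; ring

lemma Vf_contDiff (hC : IsCoef a b) {φ h w : Eucl n → ℝ} (hφ : ContDiff ℝ 2 φ)
    (hh : ContDiff ℝ 2 h) (hw : ContDiff ℝ 2 w) (τ : ℝ) (i : Fin n) :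
    ContDiff ℝ 1 (Vf a φ h w τ i) := by
  have f1 := flux_contDiff (k := 1) hC hw (by norm_num) (by norm_num) i
  have f2 := flux_contDiff (k := 1) hC hφ (by norm_num) (by norm_num) i
  have f3 := flux_contDiff (k := 1) hC hh (by norm_num) (by norm_num) i
  have g1 := gq_contDiff (k := 1) hC hφ hw (by norm_num) (by norm_num)
  have g2 := gq_contDiff (k := 1) hC hw hw (by norm_num) (by norm_num)
  have g3 := gq_contDiff (k := 1) hC hφ hφ (by norm_num) (by norm_num)
  have h1 : ContDiff ℝ 1 h := hh.of_le (by norm_num)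
  have w1 : ContDiff ℝ 1 w := hw.of_le (by norm_num)
  unfold Vf
  fun_prop

lemma carl_identity (hC : IsCoef a b) {φ h w : Eucl n → ℝ} (hφ : ContDiff ℝ 2 φ)
    (hh : ContDiff ℝ 2 h) (hw : ContDiff ℝ 2 w) (τ : ℝ) (x : Eucl n) :
    (Lop a w x + τ ^ 2 * gq a φ φ x * w x) * (-2 * τ * gq a φ w x + τ * h x * w x)
      = ∑ i, pd (Vf a φ h w τ i) i x
        + τ * (2 * E1 a φ x (fun i => pd w i x) - E2 a φ x (fun i => pd w i x)
            - (Lop a φ x + h x) * gq a w w x)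
        + (τ ^ 3 * Zc a φ h x + τ / 2 * Lop a h x) * (w x * w x) := by
  have dw : DifferentiableAt ℝ w x := hw.differentiable (by norm_num) x
  have dh : DifferentiableAt ℝ h x := hh.differentiable (by norm_num) x
  have i1 := divg_mul (G := flux a w) (s := gq a φ w) (x := x) (fun i => flux_diff hC hw i x)
    (gq_diff hC hφ hw x)
  have i2 := divg_mul (G := flux a φ) (s := gq a w w) (x := x) (fun i => flux_diff hC hφ i x)
    (gq_diff hC hw hw x)
  have i3 := divg_mul (G := flux a w) (s := fun y => h y * w y) (x := x)
    (fun i => flux_diff hC hw i x) (dh.mul dw)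
  have i4 := divg_mul (G := flux a h) (s := fun y => w y * w y) (x := x)
    (fun i => flux_diff hC hh i x) (dw.mul dw)
  have i5 := divg_mul (G := flux a φ) (s := fun y => gq a φ φ y * (w y * w y)) (x := x)
    (fun i => flux_diff hC hφ i x) ((gq_diff hC hφ hφ x).mul (dw.mul dw))
  rw [rell_vi hC hφ hw] at i1
  rw [rell_vii hC hw] at i2
  have j3 : ∑ i, flux a w i x * pd (fun y => h y * w y) i x
      = w x * gq a w h x + h x * gq a w w x := by
    unfold gq
    rw [Finset.mul_sum, Finset.mul_sum, ← Finset.sum_add_distrib]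
    refine Finset.sum_congr rfl fun i _ => ?_
    rw [pd_mul dh dw]; ring
  have j4 : ∑ i, flux a h i x * pd (fun y => w y * w y) i x = 2 * w x * gq a w h x := by
    rw [gq_symm hC w h]
    unfold gq
    rw [Finset.mul_sum]
    refine Finset.sum_congr rfl fun i _ => ?_
    rw [pd_mul dw dw]; ring
  have j5 : ∑ i, flux a φ i x * pd (fun y => gq a φ φ y * (w y * w y)) i x
      = XN a φ x * (w x * w x) + 2 * gq a φ φ x * w x * gq a φ w x := by
    unfold XN
    conv_rhs => rw [gq.eq_def a φ w]
    rw [Finset.sum_mul, Finset.mul_sum, ← Finset.sum_add_distrib]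
    refine Finset.sum_congr rfl fun i _ => ?_
    rw [pd_mul (gq_diff hC hφ hφ x) (dw.fun_mul dw), pd_mul dw dw]; ring
  rw [j3] at i3
  rw [j4] at i4
  rw [j5] at i5
  have hV : ∑ i, pd (Vf a φ h w τ i) i x
      = (-2 * τ) * (∑ i, pd (fun y => flux a w i y * gq a φ w y) i x)
        + τ * (∑ i, pd (fun y => flux a φ i y * gq a w w y) i x)
        + τ * (∑ i, pd (fun y => flux a w i y * (h y * w y)) i x)
        + (-(τ / 2)) * (∑ i, pd (fun y => flux a h i y * (w y * w y)) i x)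
        + (-τ ^ 3) * (∑ i, pd (fun y => flux a φ i y * (gq a φ φ y * (w y * w y))) i x) := by
    simp_rw [Finset.mul_sum, ← Finset.sum_add_distrib]
    refine Finset.sum_congr rfl fun i _ => ?_
    have d1 := (flux_diff hC hw i x).fun_mul (gq_diff hC hφ hw x)
    have d2 := (flux_diff hC hφ i x).fun_mul (gq_diff hC hw hw x)
    have d3 := (flux_diff hC hw i x).fun_mul (dh.fun_mul dw)
    have d4 := (flux_diff hC hh i x).fun_mul (dw.fun_mul dw)
    have d5 := (flux_diff hC hφ i x).fun_mul ((gq_diff hC hφ hφ x).fun_mul (dw.fun_mul dw))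
    rw [← pd_const_mul _ d1, ← pd_const_mul _ d2, ← pd_const_mul _ d3, ← pd_const_mul _ d4,
      ← pd_const_mul _ d5]
    have c1 := d1.const_mul (-2 * τ)
    have c2 := d2.const_mul τ
    have c3 := d3.const_mul τ
    have c4 := d4.const_mul (-(τ / 2))
    have c5 := d5.const_mul (-τ ^ 3)
    rw [← pd_add c1 c2, ← pd_add (c1.fun_add c2) c3, ← pd_add ((c1.fun_add c2).fun_add c3) c4,
      ← pd_add (((c1.fun_add c2).fun_add c3).fun_add c4) c5]
    rfl
  rw [hV, i1, i2, i3, i4, i5]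
  unfold Zc
  simp only [← Lop.eq_def]
  ring
end Part2

section Part3
open MeasureTheory Set
open scoped Topology RealInnerProductSpace
variable {n : ℕ} {a b : Fin n → Fin n → Eucl n → ℝ}

def En (v : Eucl n → ℝ) (x : Eucl n) : ℝ := v x ^ 2 + ∑ i, (pd v i x) ^ 2

lemma En_nonneg (v : Eucl n → ℝ) (x : Eucl n) : 0 ≤ En v x := by
  unfold En; positivity

lemma En_continuous {v : Eucl n → ℝ} (hv : ContDiff ℝ 1 v) : Continuous (En v) := by
  unfold En
  exact (hv.continuous.pow 2).add (continuous_finsetSum _ fun i _ => (pd_continuous hv i).pow 2)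

lemma exists_bound {ι : Type*} [Fintype ι] {K : Set (Eucl n)} (hK : IsCompact K)
    (F : ι → Eucl n → ℝ) (hF : ∀ i, Continuous (F i)) :
    ∃ C : ℝ, 1 ≤ C ∧ ∀ i, ∀ x ∈ K, |F i x| ≤ C := by
  have : ∀ i, ∃ C : ℝ, ∀ x ∈ K, |F i x| ≤ C := fun i =>
    hK.exists_bound_of_continuousOn (hF i).continuousOn
  choose C hC using this
  refine ⟨1 + ∑ i, |C i|, by have : 0 ≤ ∑ i, |C i| := by positivity
                             linarith, fun i x hx => ?_⟩
  have h1 := hC i x hx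
  have h2 : |C i| ≤ ∑ i, |C i| := Finset.single_le_sum (f := fun i => |C i|)
    (fun _ _ => abs_nonneg _) (Finset.mem_univ i)
  have := le_abs_self (C i)
  linarith

lemma exists_bound1 {K : Set (Eucl n)} (hK : IsCompact K)
    {F : Eucl n → ℝ} (hF : Continuous F) :
    ∃ C : ℝ, 1 ≤ C ∧ ∀ x ∈ K, |F x| ≤ C := by
  obtain ⟨C, h1, h2⟩ := exists_bound hK (fun _ : Unit => F) (fun _ => hF)
  exact ⟨C, h1, h2 ()⟩

lemma pd_expw {φ v : Eucl n → ℝ} {x : Eucl n} (hφ : DifferentiableAt ℝ φ x)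
    (hv : DifferentiableAt ℝ v x) (τ : ℝ) (i : Fin n) :
    pd (fun y => Real.exp (τ * φ y) * v y) i x
      = Real.exp (τ * φ x) * (pd v i x + τ * v x * pd φ i x) := by
  have hd : DifferentiableAt ℝ (fun y => τ * φ y) x := hφ.const_mul τ
  have h1 : DifferentiableAt ℝ (fun y => Real.exp (τ * φ y)) x := hd.exp
  rw [pd_mul h1 hv, pd_comp (f := Real.exp) Real.differentiableAt_exp hd, pd_const_mul _ hφ,
    Real.deriv_exp]
  ring

lemma flux_expw {φ v : Eucl n → ℝ} {x : Eucl n} (hφ : DifferentiableAt ℝ φ x)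
    (hv : DifferentiableAt ℝ v x) (τ : ℝ) (i : Fin n) :
    flux a (fun y => Real.exp (τ * φ y) * v y) i x
      = Real.exp (τ * φ x) * (flux a v i x + τ * v x * flux a φ i x) := by
  unfold flux
  simp_rw [pd_expw hφ hv, Finset.mul_sum, ← Finset.sum_add_distrib, Finset.mul_sum]
  exact Finset.sum_congr rfl fun j _ => by ring

lemma Lop_expw (hC : IsCoef a b) {φ v : Eucl n → ℝ} (hφ : ContDiff ℝ 2 φ) (hv : ContDiff ℝ 2 v)
    (τ : ℝ) (x : Eucl n) :
    Lop a (fun y => Real.exp (τ * φ y) * v y) x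
      = Real.exp (τ * φ x) * (Lop a v x + 2 * τ * gq a φ v x + τ ^ 2 * gq a φ φ x * v x
        + τ * v x * Lop a φ x) := by
  have dφ : Differentiable ℝ φ := hφ.differentiable (by norm_num)
  have dv : Differentiable ℝ v := hv.differentiable (by norm_num)
  have e : ∀ i, flux a (fun y => Real.exp (τ * φ y) * v y) i
      = fun y => Real.exp (τ * φ y) * (flux a v i y + τ * v y * flux a φ i y) := fun i => by
    funext y; exact flux_expw (dφ y) (dv y) τ i
  unfold Lop
  have h1 : ∀ i, pd (flux a (fun y => Real.exp (τ * φ y) * v y) i) i x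
      = Real.exp (τ * φ x) * ((pd (flux a v i) i x + (τ * pd v i x) * flux a φ i x
          + τ * v x * pd (flux a φ i) i x) + τ * (flux a v i x + τ * v x * flux a φ i x) * pd φ i x) := by
    intro i
    have d1 := flux_diff hC hv i x
    have d2 := flux_diff hC hφ i x
    have d3 : DifferentiableAt ℝ (fun y => τ * v y) x := (dv x).const_mul τ
    rw [e i, pd_expw (dφ x) (d1.fun_add (d3.fun_mul d2)), pd_add d1 (d3.fun_mul d2), pd_mul d3 d2,
      pd_const_mul _ (dv x)]
    ring
  simp_rw [h1]
  have g1 : gq a φ v x = ∑ i, flux a v i x * pd φ i x := by rw [gq_symm hC]; rfl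
  have g2 : gq a φ v x = ∑ i, flux a φ i x * pd v i x := rfl
  have g3 : gq a φ φ x = ∑ i, flux a φ i x * pd φ i x := rfl
  rw [← Finset.mul_sum]
  congr 1
  have : 2 * τ * gq a φ v x = τ * gq a φ v x + τ * gq a φ v x := by ring
  rw [this]
  conv_rhs => rw [g1]
  conv_rhs => enter [1,1,2,1]; rw [← g1, g2]
  rw [g3]
  simp_rw [Finset.mul_sum, Finset.sum_mul, ← Finset.sum_add_distrib]
  exact Finset.sum_congr rfl fun j _ => by ring

lemma gq_expw {φ v : Eucl n → ℝ} {x : Eucl n} (hφ : DifferentiableAt ℝ φ x)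
    (hv : DifferentiableAt ℝ v x) (τ : ℝ)  :
    gq a φ (fun y => Real.exp (τ * φ y) * v y) x
      = Real.exp (τ * φ x) * (gq a φ v x + τ * v x * gq a φ φ x) := by
  unfold gq
  simp_rw [pd_expw hφ hv, Finset.mul_sum, ← Finset.sum_add_distrib, Finset.mul_sum]
  exact Finset.sum_congr rfl fun j _ => by ring

lemma conj_identity (hC : IsCoef a b) {φ h v : Eucl n → ℝ} (hφ : ContDiff ℝ 2 φ)
    (hv : ContDiff ℝ 2 v) (τ : ℝ) (x : Eucl n) :
    (Lop a (fun y => Real.exp (τ * φ y) * v y) x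
      + τ ^ 2 * gq a φ φ x * (Real.exp (τ * φ x) * v x))
      + (-2 * τ * gq a φ (fun y => Real.exp (τ * φ y) * v y) x
        + τ * h x * (Real.exp (τ * φ x) * v x))
    = Real.exp (τ * φ x) * (Lop a v x + τ * (Lop a φ x + h x) * v x) := by
  rw [Lop_expw hC hφ hv, gq_expw (hφ.differentiable (by norm_num) x) (hv.differentiable (by norm_num) x)]
  ring

lemma Vf_bound {φ h w : Eucl n → ℝ} {x : Eucl n} {C0 τ : ℝ} (hC0 : 1 ≤ C0) (hτ : 1 ≤ τ)
    (h1 : ∀ i j, |a i j x| ≤ C0) (h2 : ∀ i, |flux a φ i x| ≤ C0) (h3 : |h x| ≤ C0)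
    (h4 : ∀ i, |flux a h i x| ≤ C0) (h5 : |gq a φ φ x| ≤ C0) (i : Fin n) :
    |Vf a φ h w τ i x| ≤ 6 * C0 ^ 2 * (n + 1) * τ ^ 3 * En w x := by
  set S := ∑ j, |pd w j x| with hS
  have hS0 : 0 ≤ S := by positivity
  have hfw : ∀ i, |flux a w i x| ≤ C0 * S := by
    intro i
    unfold flux
    refine (Finset.abs_sum_le_sum_abs _ _).trans ?_
    rw [hS, Finset.mul_sum]
    refine Finset.sum_le_sum fun j _ => ?_
    rw [abs_mul]
    exact mul_le_mul_of_nonneg_right (h1 i j) (abs_nonneg _)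
  have hg1 : |gq a φ w x| ≤ C0 * S := by
    unfold gq
    refine (Finset.abs_sum_le_sum_abs _ _).trans ?_
    rw [hS, Finset.mul_sum]
    refine Finset.sum_le_sum fun j _ => ?_
    rw [abs_mul]
    exact mul_le_mul_of_nonneg_right (h2 j) (abs_nonneg _)
  have hg2 : |gq a w w x| ≤ C0 * S * S := by
    unfold gq
    refine (Finset.abs_sum_le_sum_abs _ _).trans ?_
    conv_rhs => rw [hS, Finset.mul_sum, ← hS]
    refine Finset.sum_le_sum fun j _ => ?_
    rw [abs_mul]
    exact mul_le_mul_of_nonneg_right (hfw j) (abs_nonneg _)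
  have hSS : S ^ 2 ≤ n * ∑ j, (pd w j x) ^ 2 := by
    have := sq_sum_le_card_mul_sum_sq (s := (Finset.univ : Finset (Fin n))) (f := fun j => |pd w j x|)
    simpa using this
  have hC1 : C0 ≤ C0 ^ 2 := by nlinarith
  have hτ1 : τ ≤ τ ^ 3 := by nlinarith [sq_nonneg τ, mul_self_nonneg (τ-1)]
  set y := |w x| with hy
  have hy0 : 0 ≤ y := abs_nonneg _
  have hyy : w x ^ 2 = y ^ 2 := by rw [hy, sq_abs]
  have hτ0 : 0 ≤ τ := by linarith
  have hC00 : 0 ≤ C0 := by linarith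
  have t1 : |(-2 * τ) * (flux a w i x * gq a φ w x)| ≤ 2 * τ ^ 3 * (C0 ^ 2 * S ^ 2) := by
    rw [abs_mul, abs_mul (-2 : ℝ) τ, abs_mul, abs_of_nonneg hτ0]
    have : |(-2:ℝ)| = 2 := by norm_num
    rw [this]
    have : |flux a w i x| * |gq a φ w x| ≤ (C0 * S) * (C0 * S) :=
      mul_le_mul (hfw i) hg1 (abs_nonneg _) (by positivity)
    calc _ ≤ 2 * τ * ((C0 * S) * (C0 * S)) := by gcongr
      _ ≤ 2 * τ ^ 3 * ((C0 * S) * (C0 * S)) := by gcongr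
      _ = _ := by ring
  have t2 : |τ * (flux a φ i x * gq a w w x)| ≤ τ ^ 3 * (C0 ^ 2 * S ^ 2) := by
    rw [abs_mul, abs_mul, abs_of_nonneg hτ0]
    have : |flux a φ i x| * |gq a w w x| ≤ C0 * (C0 * S * S) :=
      mul_le_mul (h2 i) hg2 (abs_nonneg _) (by positivity)
    calc _ ≤ τ * (C0 * (C0 * S * S)) := by gcongr
      _ ≤ τ ^ 3 * (C0 * (C0 * S * S)) := by gcongr
      _ = _ := by ring
  have t3 : |τ * (flux a w i x * (h x * w x))| ≤ τ ^ 3 * (C0 ^ 2 * (S ^ 2 + y ^ 2)) := by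
    rw [abs_mul, abs_mul, abs_mul (h x), abs_of_nonneg hτ0, ← hy]
    have : |flux a w i x| * (|h x| * y) ≤ (C0 * S) * (C0 * y) :=
      mul_le_mul (hfw i) (by gcongr) (by positivity) (by positivity)
    calc _ ≤ τ * ((C0 * S) * (C0 * y)) := by gcongr
      _ ≤ τ ^ 3 * ((C0 * S) * (C0 * y)) := by gcongr
      _ = τ ^ 3 * (C0 ^ 2 * (S * y)) := by ring
      _ ≤ _ := by gcongr; nlinarith [sq_nonneg (S - y), mul_nonneg hS0 hy0]
  have t4 : |(-(τ / 2)) * (flux a h i x * (w x * w x))| ≤ τ ^ 3 * (C0 ^ 2 * y ^ 2) := by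
    rw [abs_mul, abs_mul, abs_mul (w x), abs_neg, abs_of_nonneg (by positivity : 0 ≤ τ / 2), ← hy]
    calc _ ≤ τ ^ 3 * (C0 ^ 2 * (y * y)) := by
          gcongr
          · linarith
          · exact (h4 i).trans hC1
      _ = _ := by ring
  have t5 : |(-τ ^ 3) * (flux a φ i x * (gq a φ φ x * (w x * w x)))| ≤ τ ^ 3 * (C0 ^ 2 * y ^ 2) := by
    rw [abs_mul, abs_mul, abs_mul (gq a φ φ x), abs_mul (w x), abs_neg,
      abs_of_nonneg (by positivity : 0 ≤ τ ^ 3), ← hy]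
    calc _ ≤ τ ^ 3 * (C0 * (C0 * (y * y))) := by
          gcongr
          exact h2 i
      _ = _ := by ring
  have hsum : |Vf a φ h w τ i x| ≤ 2 * τ ^ 3 * (C0 ^ 2 * S ^ 2) + τ ^ 3 * (C0 ^ 2 * S ^ 2)
      + τ ^ 3 * (C0 ^ 2 * (S ^ 2 + y ^ 2)) + τ ^ 3 * (C0 ^ 2 * y ^ 2) + τ ^ 3 * (C0 ^ 2 * y ^ 2) := by
    unfold Vf
    refine (abs_add_le _ _).trans (add_le_add ((abs_add_le _ _).trans (add_le_add ((abs_add_le _ _).trans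
      (add_le_add ((abs_add_le _ _).trans (add_le_add t1 t2)) t3)) t4)) t5)
  refine hsum.trans ?_
  unfold En
  rw [hyy]
  set G := ∑ j, (pd w j x) ^ 2 with hG
  have hG0 : 0 ≤ G := by positivity
  have hn0 : (0:ℝ) ≤ n := by positivity
  have : 4 * S ^ 2 + 3 * y ^ 2 ≤ 6 * (n + 1) * (y ^ 2 + G) := by
    nlinarith [mul_nonneg hn0 (sq_nonneg y), mul_nonneg hn0 hG0, sq_nonneg y]
  calc _ = τ ^ 3 * C0 ^ 2 * (4 * S ^ 2 + 3 * y ^ 2) := by ring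
    _ ≤ τ ^ 3 * C0 ^ 2 * (6 * (n + 1) * (y ^ 2 + G)) := by gcongr
    _ = _ := by ring
end Part3

section Part4
open MeasureTheory Set
open scoped Topology RealInnerProductSpace
variable {n : ℕ} {a b : Fin n → Fin n → Eucl n → ℝ}

lemma carl_aux1 {A5 τ W G : ℝ} (hA : 0 ≤ A5) (hτ : 1 ≤ τ) (hW : 0 ≤ W) (hG : 0 ≤ G) {T : ℝ}
    (h : T ≤ 2 * G + 2 * τ ^ 2 * W * A5) :
    W + T ≤ (3 + 2 * A5) * (G + τ ^ 2 * W) := by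
  have h2 : 1 ≤ τ ^ 2 := one_le_pow₀ hτ
  have h3 := le_mul_of_one_le_left hW h2
  have h4 : 0 ≤ A5 * G := by positivity
  linarith

lemma carl_aux2 {A5 τ W G : ℝ} (hA : 0 ≤ A5) (hτ : 1 ≤ τ) (hW : 0 ≤ W) (hG : 0 ≤ G) :
    W + (2 * G + 2 * τ ^ 2 * W * A5) ≤ (3 + 2 * A5) * τ ^ 2 * (W + G) := by
  have h2 : 1 ≤ τ ^ 2 := one_le_pow₀ hτ
  have h3 := le_mul_of_one_le_left hW h2
  have h4 := le_mul_of_one_le_left hG h2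
  have h5 : 0 ≤ A5 * (τ ^ 2 * G) := by positivity
  have h6 : 0 ≤ τ ^ 2 * W := by positivity
  nlinarith

lemma carl_aux3 {A1 τ c Q : ℝ} (hA : 0 ≤ A1) (hτ : 1 ≤ τ) (hc : 0 < c)
    (hτc : A1 / 2 + Q / 4 ≤ c / 2 * τ) :
    c / 2 * τ ^ 2 ≤ τ ^ 3 * c - τ / 2 * A1 - τ ^ 2 * Q / 4 := by
  have h0 : 0 ≤ τ := by linarith
  have q1 : τ ^ 2 * (A1 / 2 + Q / 4) ≤ τ ^ 2 * (c / 2 * τ) := by gcongr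
  have q2 : τ * A1 ≤ τ ^ 2 * A1 := by
    have : τ ≤ τ ^ 2 := by nlinarith
    gcongr
  have q3 : c / 2 * τ ^ 2 ≤ c / 2 * τ ^ 3 := by
    have : τ ^ 2 ≤ τ ^ 3 := by
      have := le_mul_of_one_le_right (sq_nonneg τ) hτ
      linarith [pow_succ τ 2]
    gcongr
  have e1 : τ ^ 2 * (c / 2 * τ) = c / 2 * τ ^ 3 := by ring
  have e2 : τ ^ 2 * (A1 / 2 + Q / 4) = τ ^ 2 * A1 / 2 + τ ^ 2 * Q / 4 := by ring
  linarith

lemma carl_aux4 {τ c G : ℝ} (hτ : 1 ≤ τ) (hc : 0 < c) (hG : 0 ≤ G) :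
    c / 2 * G ≤ τ * (c * G) := by
  have h := le_mul_of_one_le_left (mul_nonneg hc.le hG) hτ
  have := mul_nonneg hc.le hG
  linarith

set_option maxHeartbeats 1000000 in
lemma carl_pointwise (hC : IsCoef a b) {φ h : Eucl n → ℝ} (hφ : ContDiff ℝ 2 φ)
    (hh : ContDiff ℝ 2 h) {K : Set (Eucl n)} (hK : IsCompact K) {c : ℝ} (hc : 0 < c)
    (hG : ∀ x ∈ K, ∀ ξ : Fin n → ℝ, c * ∑ i, ξ i ^ 2 ≤
      2 * E1 a φ x ξ - E2 a φ x ξ - (Lop a φ x + h x) * qf a x ξ)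
    (hZ : ∀ x ∈ K, c ≤ Zc a φ h x) (P : ℝ) (hP : 0 ≤ P) :
    ∃ C1 C2 τ0 : ℝ, 0 < C1 ∧ 0 < C2 ∧ 1 ≤ τ0 ∧ ∀ τ, τ0 ≤ τ → ∀ v : Eucl n → ℝ, ContDiff ℝ 2 v →
      ∀ x ∈ K, |Lop a v x| ≤ P * |v x| →
      Real.exp (2 * τ * φ x) * En v x
        ≤ - C1 * ∑ i, pd (Vf a φ h (fun y => Real.exp (τ * φ y) * v y) τ i) i x ∧
      ∀ i, |Vf a φ h (fun y => Real.exp (τ * φ y) * v y) τ i x|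
        ≤ C2 * τ ^ 5 * (Real.exp (2 * τ * φ x) * En v x) := by
  obtain ⟨D1, hD1, b1⟩ := exists_bound hK (fun q : Fin n × Fin n => a q.1 q.2)
    (fun q => (hC.smooth q.1 q.2).continuous)
  obtain ⟨D2, hD2, b2⟩ := exists_bound hK (fun i : Fin n => flux a φ i)
    (fun i => (flux_contDiff (k := 1) hC hφ (by norm_num) (by norm_num) i).continuous)
  obtain ⟨D3, hD3, b3⟩ := exists_bound1 hK hh.continuous
  obtain ⟨D4, hD4, b4⟩ := exists_bound hK (fun i : Fin n => flux a h i)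
    (fun i => (flux_contDiff (k := 1) hC hh (by norm_num) (by norm_num) i).continuous)
  obtain ⟨D5, hD5, b5⟩ := exists_bound1 hK
    (gq_contDiff (k := 1) hC hφ hφ (by norm_num) (by norm_num)).continuous
  obtain ⟨A1, hA1, b6⟩ := exists_bound1 hK (Lop_continuous hC hh)
  obtain ⟨A2, hA2, b7⟩ := exists_bound1 hK ((Lop_continuous hC hφ).add hh.continuous)
  obtain ⟨A5, hA5, b8⟩ := exists_bound1 hK (F := fun x => ∑ i, pd φ i x ^ 2)
    (continuous_finsetSum _ fun i _ => (pd_continuous (hφ.of_le (by norm_num)) i).pow 2)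
  set C0 := D1 + D2 + D3 + D4 + D5 with hC0
  have hC01 : 1 ≤ C0 := by rw [hC0]; linarith
  refine ⟨(3 + 2 * A5) * (2 / c), 6 * C0 ^ 2 * (n + 1) * (3 + 2 * A5),
    1 + (2 / c) * (A1 / 2 + (P + A2) ^ 2 / 4), by positivity, by positivity, ?_, ?_⟩
  · have : 0 ≤ (2 / c) * (A1 / 2 + (P + A2) ^ 2 / 4) := by positivity
    linarith
  intro τ hτ v hv x hx hL
  have hτ1 : 1 ≤ τ := by
    have : 0 ≤ (2 / c) * (A1 / 2 + (P + A2) ^ 2 / 4) := by positivity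
    linarith
  have hτc : A1 / 2 + (P + A2) ^ 2 / 4 ≤ c / 2 * τ := by
    have h1 : (2 / c) * (A1 / 2 + (P + A2) ^ 2 / 4) ≤ τ := by linarith
    have h2 := mul_le_mul_of_nonneg_left h1 (by positivity : 0 ≤ c / 2)
    have h3 : c / 2 * (2 / c * (A1 / 2 + (P + A2) ^ 2 / 4)) = A1 / 2 + (P + A2) ^ 2 / 4 := by
      field_simp
    linarith
  set w : Eucl n → ℝ := fun y => Real.exp (τ * φ y) * v y with hw
  have hwC : ContDiff ℝ 2 w := by rw [hw]; fun_prop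
  have dφ := hφ.differentiable (by norm_num) x
  have dv := hv.differentiable (by norm_num) x
  set G := ∑ i, pd w i x ^ 2 with hGdef
  have hG0 : 0 ≤ G := by positivity
  have hwi : ∀ i, pd w i x = Real.exp (τ * φ x) * (pd v i x + τ * v x * pd φ i x) :=
    fun i => pd_expw dφ dv τ i
  set e := Real.exp (τ * φ x) with he
  have he0 : 0 < e := Real.exp_pos _
  have hee : Real.exp (2 * τ * φ x) = e ^ 2 := by
    rw [he, ← Real.exp_nat_mul]; congr 1; push_cast; ring
  have hwx : w x = e * v x := rfl
  have hA5' : ∑ i, pd φ i x ^ 2 ≤ A5 := (le_abs_self _).trans (b8 x hx)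
  -- En v in terms of w
  have hEn1 : e ^ 2 * En v x ≤ (3 + 2 * A5) * (G + τ ^ 2 * (w x) ^ 2) := by
    have h1 : ∀ i, e ^ 2 * (pd v i x) ^ 2 ≤ 2 * pd w i x ^ 2 + 2 * τ ^ 2 * w x ^ 2 * pd φ i x ^ 2 := by
      intro i
      have : e * pd v i x = pd w i x - τ * w x * pd φ i x := by rw [hwi, hwx]; ring
      have h2 : e ^ 2 * (pd v i x) ^ 2 = (pd w i x - τ * w x * pd φ i x) ^ 2 := by rw [← this]; ring
      rw [h2]
      nlinarith [sq_nonneg (pd w i x + τ * w x * pd φ i x)]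
    have h2 : e ^ 2 * ∑ i, (pd v i x) ^ 2 ≤ 2 * G + 2 * τ ^ 2 * w x ^ 2 * ∑ i, pd φ i x ^ 2 := by
      rw [hGdef, Finset.mul_sum, Finset.mul_sum, Finset.mul_sum, ← Finset.sum_add_distrib]
      exact Finset.sum_le_sum fun i _ => h1 i
    have h3 : 2 * τ ^ 2 * w x ^ 2 * ∑ i, pd φ i x ^ 2 ≤ 2 * τ ^ 2 * w x ^ 2 * A5 := by gcongr
    unfold En
    rw [mul_add, show e ^ 2 * v x ^ 2 = w x ^ 2 by rw [hwx]; ring]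
    exact carl_aux1 (by linarith) hτ1 (sq_nonneg _) hG0 (by linarith)
  have hEn2 : En w x ≤ (3 + 2 * A5) * τ ^ 2 * (e ^ 2 * En v x) := by
    have h1 : ∀ i, pd w i x ^ 2 ≤ e ^ 2 * (2 * pd v i x ^ 2 + 2 * τ ^ 2 * v x ^ 2 * pd φ i x ^ 2) := by
      intro i
      rw [hwi, mul_pow]
      gcongr
      nlinarith [sq_nonneg (pd v i x - τ * v x * pd φ i x)]
    have h2 : G ≤ e ^ 2 * (2 * ∑ i, pd v i x ^ 2 + 2 * τ ^ 2 * v x ^ 2 * ∑ i, pd φ i x ^ 2) := by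
      rw [hGdef, Finset.mul_sum, Finset.mul_sum, ← Finset.sum_add_distrib, Finset.mul_sum]
      exact Finset.sum_le_sum fun i _ => h1 i
    have h3 : 2 * τ ^ 2 * v x ^ 2 * ∑ i, pd φ i x ^ 2 ≤ 2 * τ ^ 2 * v x ^ 2 * A5 := by gcongr
    set Gv := ∑ i, pd v i x ^ 2 with hGv
    have hGv0 : 0 ≤ Gv := by positivity
    have h4 : v x ^ 2 + (2 * Gv + 2 * τ ^ 2 * v x ^ 2 * A5) ≤ (3 + 2 * A5) * τ ^ 2 * (v x ^ 2 + Gv) :=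
      carl_aux2 (by linarith) hτ1 (sq_nonneg _) hGv0
    calc En w x = e ^ 2 * v x ^ 2 + G := by unfold En; rw [hwx]; ring
      _ ≤ e ^ 2 * v x ^ 2 + e ^ 2 * (2 * Gv + 2 * τ ^ 2 * v x ^ 2 * A5) := by
          have := mul_le_mul_of_nonneg_left (add_le_add_right h3 (2 * Gv)) (sq_nonneg e)
          linarith
      _ = e ^ 2 * (v x ^ 2 + (2 * Gv + 2 * τ ^ 2 * v x ^ 2 * A5)) := by ring
      _ ≤ e ^ 2 * ((3 + 2 * A5) * τ ^ 2 * (v x ^ 2 + Gv)) := by gcongr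
      _ = _ := by unfold En; ring
  constructor
  · have id1 := carl_identity hC hφ hh hwC τ x
    have id2 := conj_identity (h := h) hC hφ hv τ x
    rw [← hw] at id2
    set dV := ∑ i, pd (Vf a φ h w τ i) i x with hdV
    set S := Lop a w x + τ ^ 2 * gq a φ φ x * w x with hS
    set M := -2 * τ * gq a φ w x + τ * h x * w x with hM
    have hSM : S * M ≤ (S + M) ^ 2 / 4 := by nlinarith [sq_nonneg (S - M)]
    have hsq : (S + M) ^ 2 ≤ τ ^ 2 * (P + A2) ^ 2 * w x ^ 2 := by
      have : S + M = e * (Lop a v x + τ * (Lop a φ x + h x) * v x) := id2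
      have h1 : |S + M| ≤ τ * (P + A2) * |w x| := by
        rw [this, hwx, abs_mul, abs_mul, abs_of_pos he0]
        have h2 : |Lop a v x + τ * (Lop a φ x + h x) * v x| ≤ P * |v x| + τ * A2 * |v x| := by
          refine (abs_add_le _ _).trans (add_le_add hL ?_)
          rw [abs_mul, abs_mul, abs_of_nonneg (by linarith : 0 ≤ τ)]
          gcongr
          exact b7 x hx
        have h3 : P * |v x| ≤ τ * (P * |v x|) := by nlinarith [mul_nonneg hP (abs_nonneg (v x))]
        calc _ ≤ e * (P * |v x| + τ * A2 * |v x|) := by gcongr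
          _ ≤ e * (τ * (P * |v x|) + τ * A2 * |v x|) := by gcongr
          _ = _ := by ring
      calc (S + M) ^ 2 = |S + M| ^ 2 := (sq_abs _).symm
        _ ≤ (τ * (P + A2) * |w x|) ^ 2 := by gcongr
        _ = τ ^ 2 * (P + A2) ^ 2 * |w x| ^ 2 := by ring
        _ = _ := by rw [sq_abs]
    have hGx := hG x hx (fun i => pd w i x)
    rw [← gq_self_eq] at hGx
    have hZx := hZ x hx
    have hLh : -A1 ≤ Lop a h x := (abs_le.1 (b6 x hx)).1
    have hww : 0 ≤ w x ^ 2 := sq_nonneg _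
    have k1 : τ * (c * G) ≤ τ * (2 * E1 a φ x (fun i => pd w i x) - E2 a φ x (fun i => pd w i x)
            - (Lop a φ x + h x) * gq a w w x) := by gcongr
    have k2 : (τ ^ 3 * c - τ / 2 * A1) * w x ^ 2
        ≤ (τ ^ 3 * Zc a φ h x + τ / 2 * Lop a h x) * (w x * w x) := by
      rw [← sq]
      refine mul_le_mul_of_nonneg_right ?_ hww
      have q1 : τ ^ 3 * c ≤ τ ^ 3 * Zc a φ h x := by gcongr
      have q2 : τ / 2 * (-A1) ≤ τ / 2 * Lop a h x := by gcongr
      linarith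
    have k3 : c / 2 * τ ^ 2 ≤ τ ^ 3 * c - τ / 2 * A1 - τ ^ 2 * (P + A2) ^ 2 / 4 :=
      carl_aux3 (by linarith) hτ1 hc hτc
    have k4 : c / 2 * (G + τ ^ 2 * w x ^ 2) ≤ - dV := by
      have q1 := mul_le_mul_of_nonneg_right k3 hww
      have q2 : c / 2 * G ≤ τ * (c * G) := carl_aux4 hτ1 hc hG0
      have q3 : S * M ≤ τ ^ 2 * (P + A2) ^ 2 / 4 * w x ^ 2 := by linarith
      linarith
    rw [hee]
    calc e ^ 2 * En v x ≤ (3 + 2 * A5) * (G + τ ^ 2 * w x ^ 2) := hEn1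
      _ = (3 + 2 * A5) * (2 / c) * (c / 2 * (G + τ ^ 2 * w x ^ 2)) := by field_simp
      _ ≤ (3 + 2 * A5) * (2 / c) * (- dV) := by gcongr
      _ = _ := by ring
  · intro i
    have hb := Vf_bound (w := w) (φ := φ) (h := h) (x := x) hC01 hτ1 (a := a)
      (fun i j => (b1 (i, j) x hx).trans (by rw [hC0]; linarith))
      (fun i => (b2 i x hx).trans (by rw [hC0]; linarith))
      ((b3 x hx).trans (by rw [hC0]; linarith))
      (fun i => (b4 i x hx).trans (by rw [hC0]; linarith))
      ((b5 x hx).trans (by rw [hC0]; linarith)) i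
    rw [hee]
    calc _ ≤ 6 * C0 ^ 2 * (n + 1) * τ ^ 3 * En w x := hb
      _ ≤ 6 * C0 ^ 2 * (n + 1) * τ ^ 3 * ((3 + 2 * A5) * τ ^ 2 * (e ^ 2 * En v x)) := by gcongr
      _ = _ := by ring

/-- The Carleman estimate. -/
lemma carleman (hC : IsCoef a b) {φ h : Eucl n → ℝ} (hφ : ContDiff ℝ 2 φ)
    (hh : ContDiff ℝ 2 h) {K : Set (Eucl n)} (hK : IsCompact K) {c : ℝ} (hc : 0 < c)
    (hG : ∀ x ∈ K, ∀ ξ : Fin n → ℝ, c * ∑ i, ξ i ^ 2 ≤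
      2 * E1 a φ x ξ - E2 a φ x ξ - (Lop a φ x + h x) * qf a x ξ)
    (hZ : ∀ x ∈ K, c ≤ Zc a φ h x) (P : ℝ) (hP : 0 ≤ P) :
    ∃ C τ0 : ℝ, 0 < C ∧ 1 ≤ τ0 ∧ ∀ τ, τ0 ≤ τ → ∀ v : Eucl n → ℝ, ContDiff ℝ 2 v →
      (∀ x ∈ K, |Lop a v x| ≤ P * |v x|) →
      ∀ θ : Eucl n → ℝ, ContDiff ℝ 1 θ → (∀ x, 0 ≤ θ x) → tsupport θ ⊆ K →
      ∫ x, θ x * (Real.exp (2 * τ * φ x) * En v x)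
        ≤ C * τ ^ 5 * ∫ x, (∑ i, |pd θ i x|) * (Real.exp (2 * τ * φ x) * En v x) := by
  obtain ⟨C1, C2, τ0, hC1, hC2, hτ0, H⟩ := carl_pointwise hC hφ hh hK hc hG hZ P hP
  refine ⟨C1 * C2, τ0, by positivity, hτ0, ?_⟩
  intro τ hτ v hv hL θ hθ hθ0 hsupp
  have hcs : HasCompactSupport θ := hK.of_isClosed_subset (isClosed_tsupport _) hsupp
  set w : Eucl n → ℝ := fun y => Real.exp (τ * φ y) * v y with hw
  have hwC : ContDiff ℝ 2 w := by rw [hw]; fun_prop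
  have hV := fun i => Vf_contDiff hC hφ hh hwC τ i
  have hEc : Continuous (fun x => Real.exp (2 * τ * φ x) * En v x) := by
    have h1 := En_continuous (hv.of_le (by norm_num))
    have h2 := hφ.continuous
    fun_prop
  have hpt : ∀ i, HasCompactSupport (pd θ i) := fun i =>
    hcs.mono' (subset_tsupport _ |>.trans (tsupport_pd_subset θ i))
  have int1 : ∀ i, Integrable (fun x => pd (Vf a φ h w τ i) i x * θ x) := fun i =>
    Continuous.integrable_of_hasCompactSupport ((pd_continuous (hV i) i).mul hθ.continuous)
      hcs.mul_left
  have int2 : ∀ i, Integrable (fun x => Vf a φ h w τ i x * pd θ i x) := fun i =>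
    Continuous.integrable_of_hasCompactSupport ((hV i).continuous.mul (pd_continuous hθ i))
      (hpt i).mul_left
  have int3 : ∀ i, Integrable (fun x => |pd θ i x| * (Real.exp (2 * τ * φ x) * En v x)) := fun i =>
    Continuous.integrable_of_hasCompactSupport ((pd_continuous hθ i).abs.mul hEc)
      (HasCompactSupport.mul_right (by simpa using (hpt i).norm))
  have step1 : ∫ x, θ x * (Real.exp (2 * τ * φ x) * En v x)
      ≤ ∫ x, (-C1) * ∑ i, pd (Vf a φ h w τ i) i x * θ x := by
    refine integral_mono ?_ ?_ ?_
    · exact Continuous.integrable_of_hasCompactSupport (hθ.continuous.mul hEc) hcs.mul_right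
    · exact (integrable_finsetSum _ fun i _ => int1 i).const_mul _
    · intro x
      by_cases hx : x ∈ K
      · have h1 := (H τ hτ v hv x hx (hL x hx)).1
        have h2 := mul_le_mul_of_nonneg_left h1 (hθ0 x)
        refine h2.trans (le_of_eq ?_)
        simp only []
        rw [← Finset.sum_mul]
        ring
      · have : θ x = 0 := image_eq_zero_of_notMem_tsupport fun h' => hx (hsupp h')
        simp [this]
  have step2 : ∫ x, (-C1) * ∑ i, pd (Vf a φ h w τ i) i x * θ x
      = C1 * ∑ i, ∫ x, Vf a φ h w τ i x * pd θ i x := by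
    rw [integral_const_mul, integral_finsetSum _ fun i _ => int1 i]
    simp_rw [fun i => ibp (hV i) hθ hcs i]
    rw [Finset.sum_neg_distrib]; ring
  have step3 : ∑ i, ∫ x, Vf a φ h w τ i x * pd θ i x
      ≤ C2 * τ ^ 5 * ∫ x, (∑ i, |pd θ i x|) * (Real.exp (2 * τ * φ x) * En v x) := by
    simp_rw [Finset.sum_mul]
    rw [integral_finsetSum _ fun i _ => int3 i, Finset.mul_sum]
    refine Finset.sum_le_sum fun i _ => ?_
    rw [← integral_const_mul]
    refine integral_mono (int2 i) ((int3 i).const_mul _) fun x => ?_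
    by_cases hx : x ∈ K
    · have h1 := (H τ hτ v hv x hx (hL x hx)).2 i
      calc Vf a φ h w τ i x * pd θ i x ≤ |Vf a φ h w τ i x * pd θ i x| := le_abs_self _
        _ = |Vf a φ h w τ i x| * |pd θ i x| := abs_mul _ _
        _ ≤ (C2 * τ ^ 5 * (Real.exp (2 * τ * φ x) * En v x)) * |pd θ i x| := by gcongr
        _ = _ := by ring
    · have : pd θ i x = 0 := image_eq_zero_of_notMem_tsupport fun h' =>
        hx (hsupp (tsupport_pd_subset θ i h'))
      simp [this]
  calc _ ≤ _ := step1
    _ = _ := step2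
    _ ≤ C1 * (C2 * τ ^ 5 * ∫ x, (∑ i, |pd θ i x|) * (Real.exp (2 * τ * φ x) * En v x)) := by gcongr
    _ = _ := by ring
end Part4

section Part5
open MeasureTheory Set
open scoped Topology RealInnerProductSpace
variable {n : ℕ} {a b : Fin n → Fin n → Eucl n → ℝ}

lemma isCompact_usphere : IsCompact {ξ : Fin n → ℝ | ∑ i, ξ i ^ 2 = 1} := by
  rw [Metric.isCompact_iff_isClosed_bounded]
  constructor
  · exact isClosed_eq (by fun_prop) continuous_const
  · refine (Metric.isBounded_closedBall (x := (0 : Fin n → ℝ)) (r := 1)).subset ?_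
    intro ξ hξ
    rw [mem_closedBall_zero_iff, pi_norm_le_iff_of_nonneg zero_le_one]
    intro i
    have h1 : ξ i ^ 2 ≤ 1 := by
      rw [← (hξ : ∑ i, ξ i ^ 2 = 1)]
      exact Finset.single_le_sum (f := fun i => ξ i ^ 2) (fun i _ => sq_nonneg _) (Finset.mem_univ i)
    rw [Real.norm_eq_abs]
    exact (sq_le_one_iff_abs_le_one _).1 h1

lemma sum_sq_pos {ξ : Fin n → ℝ} (h : ξ ≠ 0) : 0 < ∑ i, ξ i ^ 2 := by
  obtain ⟨i, hi⟩ := Function.ne_iff.1 h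
  exact lt_of_lt_of_le (pow_pos (abs_pos.2 hi) 2 |>.trans_eq (sq_abs _))
    (Finset.single_le_sum (f := fun i => ξ i ^ 2) (fun i _ => sq_nonneg _) (Finset.mem_univ i))

lemma usphere_scale {ξ : Fin n → ℝ} (h : ξ ≠ 0) :
    ∃ s : ℝ, ∃ η : Fin n → ℝ, ∑ i, η i ^ 2 = 1 ∧ ξ = s • η ∧ s ^ 2 = ∑ i, ξ i ^ 2 := by
  have hp := sum_sq_pos h
  refine ⟨Real.sqrt (∑ i, ξ i ^ 2), (Real.sqrt (∑ i, ξ i ^ 2))⁻¹ • ξ, ?_, ?_, Real.sq_sqrt hp.le⟩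
  · simp only [Pi.smul_apply, smul_eq_mul, mul_pow, ← Finset.mul_sum, inv_pow, Real.sq_sqrt hp.le]
    field_simp
  · rw [smul_smul, mul_inv_cancel₀ (Real.sqrt_pos.2 hp).ne', one_smul]

lemma qform_upper {K : Set (Eucl n)} (hK : IsCompact K) {F : Eucl n → (Fin n → ℝ) → ℝ}
    (hF : Continuous (fun q : Eucl n × (Fin n → ℝ) => F q.1 q.2))
    (hh : ∀ x s ξ, F x (s • ξ) = s ^ 2 * F x ξ) :
    ∃ C : ℝ, 1 ≤ C ∧ ∀ x ∈ K, ∀ ξ, |F x ξ| ≤ C * ∑ i, ξ i ^ 2 := by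
  obtain ⟨C, hC⟩ := (hK.prod (isCompact_usphere (n := n))).exists_bound_of_continuousOn hF.continuousOn
  refine ⟨max C 1, le_max_right _ _, fun x hx ξ => ?_⟩
  by_cases h : ξ = 0
  · have h0 := hh x 0 0
    rw [h]
    simp at h0
    simp [h0]
  · obtain ⟨s, η, h1, h2, h3⟩ := usphere_scale h
    rw [← h3, h2, hh, abs_mul, abs_of_nonneg (sq_nonneg s), mul_comm]
    have := hC (x, η) ⟨hx, h1⟩
    simp only [Real.norm_eq_abs] at this
    gcongr
    exact this.trans (le_max_left _ _)

lemma qform_lower {K : Set (Eucl n)} (hK : IsCompact K) {F : Eucl n → (Fin n → ℝ) → ℝ}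
    (hF : Continuous (fun q : Eucl n × (Fin n → ℝ) => F q.1 q.2))
    (hh : ∀ x s ξ, F x (s • ξ) = s ^ 2 * F x ξ) (hpos : ∀ x ξ, ξ ≠ 0 → 0 < F x ξ) :
    ∃ c : ℝ, 0 < c ∧ ∀ x ∈ K, ∀ ξ, c * ∑ i, ξ i ^ 2 ≤ F x ξ := by
  have key : ∃ c : ℝ, 0 < c ∧ ∀ q ∈ K ×ˢ {ξ : Fin n → ℝ | ∑ i, ξ i ^ 2 = 1}, c ≤ F q.1 q.2 := by
    have hcomp := hK.prod (isCompact_usphere (n := n))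
    rcases (K ×ˢ {ξ : Fin n → ℝ | ∑ i, ξ i ^ 2 = 1}).eq_empty_or_nonempty with he | hne
    · exact ⟨1, one_pos, by rw [he]; simp⟩
    · obtain ⟨q, hq, hmin⟩ := hcomp.exists_isMinOn hne hF.continuousOn
      refine ⟨F q.1 q.2, hpos _ _ ?_, fun q' hq' => hmin hq'⟩
      intro h0
      have := hq.2
      simp [h0] at this
  obtain ⟨c, hc, H⟩ := key
  refine ⟨c, hc, fun x hx ξ => ?_⟩
  by_cases h : ξ = 0
  · have h0 := hh x 0 0
    rw [h]
    simp at h0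
    simp [h0]
  · obtain ⟨s, η, h1, h2, h3⟩ := usphere_scale h
    rw [← h3, h2, hh, mul_comm]
    have := H (x, η) ⟨hx, h1⟩
    gcongr

lemma qf_lower (hC : IsCoef a b) {K : Set (Eucl n)} (hK : IsCompact K) :
    ∃ c : ℝ, 0 < c ∧ ∀ x ∈ K, ∀ ξ : Fin n → ℝ, c * ∑ i, ξ i ^ 2 ≤ qf a x ξ := by
  refine qform_lower hK ?_ ?_ (fun x ξ h => hC.pos x ξ h)
  · have := fun i j => (hC.smooth i j).continuous
    unfold qf
    fun_prop
  · intro x s ξ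
    unfold qf
    simp_rw [Finset.mul_sum, Pi.smul_apply, smul_eq_mul]
    exact Finset.sum_congr rfl fun i _ => Finset.sum_congr rfl fun j _ => by ring

lemma gform_upper (hC : IsCoef a b) {K : Set (Eucl n)} (hK : IsCompact K) {ψ : Eucl n → ℝ}
    (hψ : ContDiff ℝ 2 ψ) :
    ∃ C : ℝ, 1 ≤ C ∧ ∀ x ∈ K, ∀ ξ : Fin n → ℝ,
      |2 * E1 a ψ x ξ - E2 a ψ x ξ - Lop a ψ x * qf a x ξ| ≤ C * ∑ i, ξ i ^ 2 := by
  refine qform_upper (F := fun x ξ => 2 * E1 a ψ x ξ - E2 a ψ x ξ - Lop a ψ x * qf a x ξ) hK ?_ ?_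
  · have h1 := fun i j => (hC.smooth i j).continuous
    have h2 := fun i j k => pd_continuous ((hC.smooth i j).of_le (by norm_num)) k
    have h3 := fun i => (flux_contDiff (k := 1) hC hψ (by norm_num) (by norm_num) i).continuous
    have h4 := fun i k => pd_continuous (flux_contDiff (k := 1) hC hψ (by norm_num) (by norm_num) i) k
    have h5 := Lop_continuous hC hψ
    unfold E1 E2 qf
    fun_prop
  · intro x s ξ
    have e1 : E1 a ψ x (s • ξ) = s ^ 2 * E1 a ψ x ξ := by
      unfold E1
      simp_rw [Finset.mul_sum, Finset.sum_mul, Finset.mul_sum, Pi.smul_apply, smul_eq_mul]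
      exact Finset.sum_congr rfl fun i _ => Finset.sum_congr rfl fun j _ =>
        Finset.sum_congr rfl fun k _ => by ring
    have e2 : E2 a ψ x (s • ξ) = s ^ 2 * E2 a ψ x ξ := by
      unfold E2
      simp_rw [Finset.mul_sum, Pi.smul_apply, smul_eq_mul]
      exact Finset.sum_congr rfl fun i _ => Finset.sum_congr rfl fun j _ =>
        Finset.sum_congr rfl fun k _ => by ring
    have e3 : qf a x (s • ξ) = s ^ 2 * qf a x ξ := by
      unfold qf
      simp_rw [Finset.mul_sum, Pi.smul_apply, smul_eq_mul]
      exact Finset.sum_congr rfl fun i _ => Finset.sum_congr rfl fun j _ => by ring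
    simp only [e1, e2, e3]; ring

section weight
variable {ψ : Eucl n → ℝ} {lam : ℝ}

lemma pd_wt (hψ : ContDiff ℝ 3 ψ) (x : Eucl n) (i : Fin n) :
    pd (fun y => Real.exp (lam * ψ y)) i x = lam * Real.exp (lam * ψ x) * pd ψ i x := by
  have hd := hψ.differentiable (by norm_num) x
  rw [pd_comp (f := Real.exp) (u := fun y => lam * ψ y) Real.differentiableAt_exp (hd.const_mul _),
    pd_const_mul _ hd, Real.deriv_exp]
  ring

lemma flux_wt (hψ : ContDiff ℝ 3 ψ) (x : Eucl n) (i : Fin n) :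
    flux a (fun y => Real.exp (lam * ψ y)) i x = lam * Real.exp (lam * ψ x) * flux a ψ i x := by
  unfold flux
  rw [Finset.mul_sum]
  exact Finset.sum_congr rfl fun j _ => by rw [pd_wt hψ]; ring

lemma pd_flux_wt (hC : IsCoef a b) (hψ : ContDiff ℝ 3 ψ) (x : Eucl n) (k i : Fin n) :
    pd (flux a (fun y => Real.exp (lam * ψ y)) k) i x
      = lam * Real.exp (lam * ψ x) * (lam * pd ψ i x * flux a ψ k x + pd (flux a ψ k) i x) := by
  have e : flux a (fun y => Real.exp (lam * ψ y)) k
      = fun y => Real.exp (lam * ψ y) * (lam * flux a ψ k y) := by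
    funext y; rw [flux_wt hψ]; ring
  have d1 := flux_diff hC (hψ.of_le (by norm_num)) k x
  rw [e, pd_expw (hψ.differentiable (by norm_num) x) (d1.const_mul _), pd_const_mul _ d1]
  ring

lemma Lop_wt (hC : IsCoef a b) (hψ : ContDiff ℝ 3 ψ) (x : Eucl n) :
    Lop a (fun y => Real.exp (lam * ψ y)) x
      = lam * Real.exp (lam * ψ x) * (Lop a ψ x + lam * gq a ψ ψ x) := by
  unfold Lop gq
  simp_rw [pd_flux_wt hC hψ, Finset.mul_sum, ← Finset.sum_add_distrib, Finset.mul_sum]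
  exact Finset.sum_congr rfl fun j _ => by ring

lemma gq_wt (hψ : ContDiff ℝ 3 ψ) (x : Eucl n) :
    gq a (fun y => Real.exp (lam * ψ y)) (fun y => Real.exp (lam * ψ y)) x
      = (lam * Real.exp (lam * ψ x)) ^ 2 * gq a ψ ψ x := by
  unfold gq
  simp_rw [pd_wt hψ, flux_wt hψ, Finset.mul_sum]
  exact Finset.sum_congr rfl fun j _ => by ring

lemma E1_wt (hC : IsCoef a b) (hψ : ContDiff ℝ 3 ψ) (x : Eucl n) (ξ : Fin n → ℝ) :
    E1 a (fun y => Real.exp (lam * ψ y)) x ξ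
      = lam * Real.exp (lam * ψ x) * (E1 a ψ x ξ + lam * (∑ k, flux a ψ k x * ξ k) ^ 2) := by
  have h1 : ∑ k, flux a ψ k x * ξ k = ∑ i, (∑ j, a i j x * ξ j) * pd ψ i x := by
    unfold flux
    simp_rw [Finset.sum_mul]
    rw [Finset.sum_comm]
    exact Finset.sum_congr rfl fun i _ => Finset.sum_congr rfl fun j _ => by
      rw [hC.symm j i x]; ring
  have h2 : (∑ k, flux a ψ k x * ξ k) ^ 2
      = ∑ i, ∑ k, ((∑ j, a i j x * ξ j) * pd ψ i x) * (flux a ψ k x * ξ k) := by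
    rw [sq]; nth_rewrite 1 [h1]; rw [Finset.sum_mul_sum]
  rw [h2]
  unfold E1
  simp_rw [pd_flux_wt hC hψ]
  rw [Finset.mul_sum, ← Finset.sum_add_distrib, Finset.mul_sum]
  refine Finset.sum_congr rfl fun i _ => ?_
  rw [Finset.mul_sum, ← Finset.sum_add_distrib, Finset.mul_sum]
  exact Finset.sum_congr rfl fun k _ => by ring

lemma E2_wt (hψ : ContDiff ℝ 3 ψ) (x : Eucl n) (ξ : Fin n → ℝ) :
    E2 a (fun y => Real.exp (lam * ψ y)) x ξ = lam * Real.exp (lam * ψ x) * E2 a ψ x ξ := by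
  unfold E2
  simp_rw [flux_wt hψ]
  rw [Finset.mul_sum]
  exact Finset.sum_congr rfl fun k _ => by ring

lemma XN_wt (hC : IsCoef a b) (hψ : ContDiff ℝ 3 ψ) (x : Eucl n) :
    XN a (fun y => Real.exp (lam * ψ y)) x
      = (lam * Real.exp (lam * ψ x)) ^ 3 * (XN a ψ x + 2 * lam * gq a ψ ψ x ^ 2) := by
  have hψ2 : ContDiff ℝ 2 ψ := hψ.of_le (by norm_num)
  have e : gq a (fun y => Real.exp (lam * ψ y)) (fun y => Real.exp (lam * ψ y))
      = fun y => Real.exp ((2 * lam) * ψ y) * (lam ^ 2 * gq a ψ ψ y) := by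
    funext y; rw [gq_wt hψ, show (2 * lam) * ψ y = lam * ψ y + lam * ψ y by ring, Real.exp_add]; ring
  have d1 := gq_diff hC hψ2 hψ2 x
  have e2 : Real.exp ((2 * lam) * ψ x) = Real.exp (lam * ψ x) ^ 2 := by
    rw [show (2 * lam) * ψ x = lam * ψ x + lam * ψ x by ring, Real.exp_add]; ring
  have h : ∀ i, pd (gq a (fun y => Real.exp (lam * ψ y)) (fun y => Real.exp (lam * ψ y))) i x
      = (lam * Real.exp (lam * ψ x)) ^ 2 * (pd (gq a ψ ψ) i x + 2 * lam * gq a ψ ψ x * pd ψ i x) := by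
    intro i
    rw [e, pd_expw (hψ.differentiable (by norm_num) x) (d1.const_mul _), pd_const_mul _ d1, e2]
    ring
  unfold XN
  simp_rw [h, flux_wt hψ]
  rw [show 2 * lam * gq a ψ ψ x ^ 2 = 2 * lam * gq a ψ ψ x * gq a ψ ψ x by ring]
  nth_rewrite 3 [gq]
  rw [Finset.mul_sum, ← Finset.sum_add_distrib, Finset.mul_sum]
  exact Finset.sum_congr rfl fun k _ => by ring

end weight

/-- existence of good weights -/
lemma weight_exists (hC : IsCoef a b) {ψ : Eucl n → ℝ} (hψ : ContDiff ℝ 3 ψ) {K : Set (Eucl n)}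
    (hK : IsCompact K) (hN : ∀ x ∈ K, ∃ i, pd ψ i x ≠ 0) :
    ∃ lam : ℝ, 1 ≤ lam ∧ ∃ h : Eucl n → ℝ, ContDiff ℝ 2 h ∧ ∃ c : ℝ, 0 < c ∧
      (∀ x ∈ K, ∀ ξ : Fin n → ℝ, c * ∑ i, ξ i ^ 2 ≤
        2 * E1 a (fun y => Real.exp (lam * ψ y)) x ξ - E2 a (fun y => Real.exp (lam * ψ y)) x ξ
          - (Lop a (fun y => Real.exp (lam * ψ y)) x + h x) * qf a x ξ) ∧
      (∀ x ∈ K, c ≤ Zc a (fun y => Real.exp (lam * ψ y)) h x) := by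
  rcases K.eq_empty_or_nonempty with hKe | hKne
  · exact ⟨1, le_rfl, 0, contDiff_const, 1, one_pos, by simp [hKe], by simp [hKe]⟩
  have hψ2 : ContDiff ℝ 2 ψ := hψ.of_le (by norm_num)
  obtain ⟨c0, hc0, H0⟩ := qf_lower hC hK
  obtain ⟨C1, hC1, H1⟩ := gform_upper hC hK hψ2
  have gc := (gq_contDiff (k := 2) hC hψ hψ (by norm_num) (by norm_num))
  obtain ⟨C2, hC2, H2⟩ := exists_bound1 hK (F := fun x => XN a ψ x + gq a ψ ψ x * Lop a ψ x) (by
    have h3 := fun i => (flux_contDiff (k := 1) hC hψ2 (by norm_num) (by norm_num) i).continuous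
    have h4 := fun i => pd_continuous (gc.of_le (by norm_num)) i
    have h5 := gc.continuous
    have h6 := Lop_continuous hC hψ2
    unfold XN
    fun_prop)
  obtain ⟨x1, hx1, hmin⟩ := hK.exists_isMinOn hKne gc.continuous.continuousOn
  set N0 := gq a ψ ψ x1 with hN0def
  have hNpos : 0 < N0 := by
    rw [hN0def, gq_self_eq]
    obtain ⟨i, hi⟩ := hN x1 hx1
    exact hC.pos _ _ (fun h => hi (congrFun h i))
  have hNle : ∀ x ∈ K, N0 ≤ gq a ψ ψ x := fun x hx => hmin hx
  obtain ⟨x2, hx2, hmin2⟩ := hK.exists_isMinOn hKne hψ.continuous.continuousOn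
  set lam := 1 + (C1 + 1) / (N0 * c0) + (C2 + 1) / N0 ^ 2 with hlam
  have hl1 : 1 ≤ lam := by
    have : 0 ≤ (C1 + 1) / (N0 * c0) + (C2 + 1) / N0 ^ 2 := by positivity
    linarith
  have hlA : C1 + 1 ≤ lam * (N0 * c0) := by
    have : (C1 + 1) / (N0 * c0) ≤ lam := by
      have : 0 ≤ (C2 + 1) / N0 ^ 2 := by positivity
      linarith
    rwa [div_le_iff₀ (by positivity)] at this
  have hlB : C2 + 1 ≤ lam * N0 ^ 2 := by
    have : (C2 + 1) / N0 ^ 2 ≤ lam := by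
      have : 0 ≤ (C1 + 1) / (N0 * c0) := by positivity
      linarith
    rwa [div_le_iff₀ (by positivity)] at this
  have hl0 : 0 < lam := by linarith
  set m := lam * Real.exp (lam * ψ x2) with hm
  have hm0 : 0 < m := by positivity
  have hmle : ∀ x ∈ K, m ≤ lam * Real.exp (lam * ψ x) := fun x hx => by
    rw [hm]; gcongr; exact hmin2 hx
  refine ⟨lam, hl1, fun x => -2 * lam ^ 2 * Real.exp (lam * ψ x) * gq a ψ ψ x, ?_,
    min m (m ^ 3), by positivity, ?_, ?_⟩
  · fun_prop
  · intro x hx ξ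
    rw [E1_wt hC hψ, E2_wt hψ, Lop_wt hC hψ]
    set S := ∑ i, ξ i ^ 2 with hS
    have hS0 : 0 ≤ S := by positivity
    have h1 := (abs_le.1 (H1 x hx ξ)).1
    have h0 := H0 x hx ξ
    rw [← hS] at h1 h0
    have hn := hNle x hx
    set e := lam * Real.exp (lam * ψ x) with he
    have hem := hmle x hx
    rw [← he] at hem
    have h2 : (N0 * c0) * S ≤ gq a ψ ψ x * qf a x ξ := by
      calc (N0 * c0) * S = N0 * (c0 * S) := by ring
        _ ≤ _ := by gcongr; linarith
    have h3 : S ≤ 2 * E1 a ψ x ξ - E2 a ψ x ξ - Lop a ψ x * qf a x ξ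
        + lam * (gq a ψ ψ x * qf a x ξ) := by
      have : lam * ((N0 * c0) * S) ≤ lam * (gq a ψ ψ x * qf a x ξ) := by gcongr
      have h4 : (C1 + 1) * S ≤ lam * (N0 * c0) * S := by gcongr
      linarith
    have h5 : 0 ≤ lam * (∑ k, flux a ψ k x * ξ k) ^ 2 := by positivity
    calc min m (m ^ 3) * S ≤ m * S := by gcongr; exact min_le_left _ _
      _ ≤ e * S := by gcongr
      _ ≤ e * (2 * E1 a ψ x ξ - E2 a ψ x ξ - Lop a ψ x * qf a x ξ
        + lam * (gq a ψ ψ x * qf a x ξ) + 2 * (lam * (∑ k, flux a ψ k x * ξ k) ^ 2)) := by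
          gcongr; linarith
      _ = _ := by rw [he]; ring
  · intro x hx
    unfold Zc
    rw [XN_wt hC hψ, gq_wt hψ, Lop_wt hC hψ]
    have h2 := (abs_le.1 (H2 x hx)).1
    have hn := hNle x hx
    set e := lam * Real.exp (lam * ψ x) with he
    have hem := hmle x hx
    rw [← he] at hem
    have h3 : 1 ≤ XN a ψ x + gq a ψ ψ x * Lop a ψ x + lam * gq a ψ ψ x ^ 2 := by
      have : lam * N0 ^ 2 ≤ lam * gq a ψ ψ x ^ 2 := by gcongr
      linarith
    have hm3 : m ^ 3 ≤ e ^ 3 := by gcongr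
    calc min m (m ^ 3) ≤ m ^ 3 * 1 := by rw [mul_one]; exact min_le_right _ _
      _ ≤ e ^ 3 * (XN a ψ x + gq a ψ ψ x * Lop a ψ x + lam * gq a ψ ψ x ^ 2) := by gcongr
      _ = _ := by rw [he]; ring
end Part5

section Part6
open MeasureTheory Set
open scoped Topology RealInnerProductSpace
variable {n : ℕ} {a b : Fin n → Fin n → Eucl n → ℝ}

def psiR (z : Eucl n) (x : Eucl n) : ℝ := -‖x - z‖ ^ 2

lemma psiR_contDiff (z : Eucl n) {k : WithTop ℕ∞} : ContDiff ℝ k (psiR z) := by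
  unfold psiR
  exact ((contDiff_id.sub contDiff_const).norm_sq ℝ).neg

lemma pd_psiR (z x : Eucl n) (i : Fin n) : pd (psiR z) i x = -2 * (x i - z i) := by
  have h : HasFDerivAt (psiR z) (-(2 • (innerSL ℝ (x - z)).comp (ContinuousLinearMap.id ℝ (Eucl n)))) x := by
    exact (((hasFDerivAt_id x).sub_const z).norm_sq).neg
  unfold pd
  rw [h.fderiv]
  simp [EuclideanSpace.inner_single_right]

lemma exists_tau {C c κ : ℝ} (hκ : 0 < κ) (τ0 : ℝ) (hc : 0 < c) :
    ∃ τ, τ0 ≤ τ ∧ C * τ ^ 5 * Real.exp (-(κ * τ)) ≤ c := by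
  have h1 : Filter.Tendsto (fun τ : ℝ => (κ * τ) ^ 5 * Real.exp (-(κ * τ))) Filter.atTop (𝓝 0) :=
    (Real.tendsto_pow_mul_exp_neg_atTop_nhds_zero 5).comp
      (Filter.tendsto_id.const_mul_atTop hκ)
  have h2 := h1.const_mul (C / κ ^ 5)
  rw [mul_zero] at h2
  obtain ⟨τ, h3, h4⟩ := ((h2.eventually (ge_mem_nhds hc)).and (Filter.eventually_ge_atTop τ0)).exists
  refine ⟨τ, h4, le_trans (le_of_eq ?_) h3⟩
  field_simp

/-- The generic propagation step. -/
lemma step4 (hC : IsCoef a b) (z : Eucl n) {s R0 R1 R2 : ℝ} (hs : 0 < s) (h01 : s < R0) (h12 : R0 < R1)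
    (h23 : R1 < R2) {P : ℝ} (hP : 0 ≤ P) {ε : ℝ} (hε : 0 < ε) :
    ∃ C : ℝ, 0 < C ∧ ∀ v : Eucl n → ℝ, ContDiff ℝ 2 v →
      (∀ x ∈ Metric.closedBall z R2, |Lop a v x| ≤ P * |v x|) →
      ∀ θ : Eucl n → ℝ, ContDiff ℝ 1 θ → (∀ x, 0 ≤ θ x) → (∀ x, θ x ≤ 1) →
      (∀ x ∈ Metric.ball z s, θ x = 0) →
      ∫ x in Metric.ball z R0, θ x * En v x ≤
        C * (∫ x in Metric.closedBall z R2, (∑ i, |pd θ i x|) * En v x)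
        + ε * ∫ x in Metric.closedBall z R2, En v x := by
  set K : Set (Eucl n) := Metric.closedBall z R2 \ Metric.ball z s with hKdef
  have hK : IsCompact K := (isCompact_closedBall z R2).diff Metric.isOpen_ball
  obtain ⟨lam, hlam, h, hh, c, hc, hG, hZ⟩ := weight_exists hC (psiR_contDiff z) hK (by
    intro x hx
    by_contra hcon
    push Not at hcon
    apply hx.2
    have : x = z := by
      ext i
      have := hcon i
      rw [pd_psiR] at this
      linarith
    rw [this]; exact Metric.mem_ball_self hs)
  set φ : Eucl n → ℝ := fun y => Real.exp (lam * psiR z y) with hφdef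
  have hφ : ContDiff ℝ 2 φ := (contDiff_const.mul (psiR_contDiff z)).exp
  obtain ⟨C1, τ0, hC1, hτ0, H⟩ := carleman hC hφ hh hK hc hG hZ P hP
  let T : ContDiffBump z := ⟨R1, R2, by linarith, h23⟩
  have hT : ContDiff ℝ 1 (T : Eucl n → ℝ) := T.contDiff
  obtain ⟨A, hA, HA⟩ := exists_bound (isCompact_closedBall z R2) (fun i : Fin n => pd T i)
    (fun i => pd_continuous hT i)
  set φ0 := Real.exp (lam * (-R0 ^ 2)) with hφ0
  set φ1 := Real.exp (lam * (-R1 ^ 2)) with hφ1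
  have hl0 : 0 < lam := by linarith
  have hφ01 : φ1 < φ0 := by
    rw [hφ0, hφ1]
    apply Real.exp_lt_exp.2
    have : R0 ^ 2 < R1 ^ 2 := by gcongr; linarith
    nlinarith
  obtain ⟨τ, hτ, hτε⟩ := exists_tau (C := C1 * (n * A)) (c := ε) (κ := 2 * (φ0 - φ1)) (by linarith) τ0 hε
  have hτ0' : 0 < τ := by linarith
  refine ⟨C1 * τ ^ 5 * Real.exp (2 * τ * (1 - φ0)), by positivity, ?_⟩
  intro v hv hL θ hθ hθ0 hθ1 hθs
  have hEc := En_continuous (hv.of_le (by norm_num) : ContDiff ℝ 1 v)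
  have hE0 := En_nonneg v
  have hT0 : ∀ x, 0 ≤ T x := fun x => T.nonneg
  have hT1 : ∀ x, T x ≤ 1 := fun x => T.le_one
  have hTθ : ContDiff ℝ 1 (fun x => θ x * T x) := hθ.mul hT
  have hsupp : tsupport (fun x => θ x * T x) ⊆ K := by
    refine closure_minimal ?_ hK.isClosed
    intro x hx
    have hx' : θ x * T x ≠ 0 := hx
    refine ⟨?_, fun hb => hx' (by rw [hθs x hb, zero_mul])⟩
    have : x ∈ Function.support (T : Eucl n → ℝ) := right_ne_zero_of_mul hx'
    rw [T.support_eq] at this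
    exact Metric.ball_subset_closedBall this
  have HH := H τ hτ v hv (fun x hx => hL x hx.1) _ hTθ (fun x => mul_nonneg (hθ0 x) (hT0 x)) hsupp
  have hcs : HasCompactSupport (fun x => θ x * T x) :=
    hK.of_isClosed_subset (isClosed_tsupport _) hsupp
  have hφc : Continuous φ := hφ.continuous
  have hφle1 : ∀ x, φ x ≤ 1 := fun x => by
    rw [hφdef]
    simp only [Real.exp_le_one_iff, psiR]
    have := sq_nonneg ‖x - z‖
    nlinarith
  -- lower bound
  have low : Real.exp (2 * τ * φ0) * ∫ x in Metric.ball z R0, θ x * En v x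
      ≤ ∫ x, (θ x * T x) * (Real.exp (2 * τ * φ x) * En v x) := by
    rw [← integral_const_mul]
    have hi : Integrable (fun x => (θ x * T x) * (Real.exp (2 * τ * φ x) * En v x)) :=
      Continuous.integrable_of_hasCompactSupport (hTθ.continuous.mul (by fun_prop)) hcs.mul_right
    calc _ ≤ ∫ x in Metric.ball z R0, (θ x * T x) * (Real.exp (2 * τ * φ x) * En v x) := by
          refine setIntegral_mono_on ?_ hi.integrableOn measurableSet_ball ?_
          · refine (ContinuousOn.integrableOn_compact (isCompact_closedBall z R0) ?_).mono_set
              Metric.ball_subset_closedBall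
            exact (continuous_const.mul (hθ.continuous.mul hEc)).continuousOn
          · intro x hx
            have hT1x : T x = 1 := T.one_of_mem_closedBall (by
              have : dist x z < R0 := hx
              exact Metric.mem_closedBall.2 (by show dist x z ≤ R1; linarith))
            have : φ0 ≤ φ x := by
              rw [hφ0, hφdef]
              apply Real.exp_le_exp.2
              unfold psiR
              have h5 : ‖x - z‖ < R0 := by rw [← dist_eq_norm]; exact hx
              have : ‖x - z‖ ^ 2 ≤ R0 ^ 2 := by gcongr
              gcongr
            rw [hT1x, mul_one]
            have h6 : Real.exp (2 * τ * φ0) ≤ Real.exp (2 * τ * φ x) := by gcongr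
            calc _ ≤ Real.exp (2 * τ * φ x) * (θ x * En v x) :=
                  mul_le_mul_of_nonneg_right h6 (mul_nonneg (hθ0 x) (hE0 x))
              _ = _ := by ring
      _ ≤ _ := setIntegral_le_integral hi (Filter.Eventually.of_forall fun x =>
            mul_nonneg (mul_nonneg (hθ0 x) (hT0 x)) (mul_nonneg (Real.exp_pos _).le (hE0 x)))
  -- upper bound
  have hpt : ∀ i x, pd (fun x => θ x * T x) i x = pd θ i x * T x + θ x * pd T i x := fun i x =>
    pd_mul (hθ.differentiable (by norm_num) x) (hT.differentiable (by norm_num) x) i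
  have hpc : Continuous (fun x => ∑ i, |pd θ i x|) :=
    continuous_finsetSum _ fun i _ => (pd_continuous hθ i).abs
  have up : ∫ x, (∑ i, |pd (fun x => θ x * T x) i x|) * (Real.exp (2 * τ * φ x) * En v x)
      ≤ Real.exp (2 * τ) * (∫ x in Metric.closedBall z R2, (∑ i, |pd θ i x|) * En v x)
        + Real.exp (2 * τ * φ1) * (n * A) * ∫ x in Metric.closedBall z R2, En v x := by
    have e1 : ∫ x, (∑ i, |pd (fun x => θ x * T x) i x|) * (Real.exp (2 * τ * φ x) * En v x)
        = ∫ x in Metric.closedBall z R2,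
          (∑ i, |pd (fun x => θ x * T x) i x|) * (Real.exp (2 * τ * φ x) * En v x) := by
      symm
      apply setIntegral_eq_integral_of_forall_compl_eq_zero
      intro x hx
      have : ∀ i, pd (fun x => θ x * T x) i x = 0 := fun i =>
        image_eq_zero_of_notMem_tsupport fun h' =>
          hx (hsupp (tsupport_pd_subset _ i h')).1
      simp [this]
    have ic : ∀ {f : Eucl n → ℝ}, Continuous f → IntegrableOn f (Metric.closedBall z R2) :=
      fun hf => hf.continuousOn.integrableOn_compact (isCompact_closedBall z R2)
    rw [e1, ← integral_const_mul, ← integral_const_mul, ← integral_add]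
    · refine setIntegral_mono_on ?_ ?_ measurableSet_closedBall ?_
      · apply ic
        exact (continuous_finsetSum _ fun i _ => (pd_continuous hTθ i).abs).mul (by fun_prop)
      · apply ic
        fun_prop
      · intro x hx
        have hE := hE0 x
        have b1 : ∑ i, |pd (fun x => θ x * T x) i x| ≤ ∑ i, |pd θ i x| + ∑ i, |pd T i x| := by
          rw [← Finset.sum_add_distrib]
          refine Finset.sum_le_sum fun i _ => ?_
          rw [hpt]
          refine (abs_add_le _ _).trans ?_
          rw [abs_mul, abs_mul, abs_of_nonneg (hT0 x), abs_of_nonneg (hθ0 x)]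
          exact add_le_add (mul_le_of_le_one_right (abs_nonneg _) (hT1 x))
            (mul_le_of_le_one_left (abs_nonneg _) (hθ1 x))
        have b2 : (∑ i, |pd T i x|) * Real.exp (2 * τ * φ x) ≤ Real.exp (2 * τ * φ1) * (n * A) := by
          by_cases hx1 : x ∈ Metric.ball z R1
          · have : ∀ i, pd T i x = 0 := by
              intro i
              have : (T : Eucl n → ℝ) =ᶠ[𝓝 x] fun _ => 1 := by
                filter_upwards [Metric.isOpen_ball.mem_nhds hx1] with y hy
                exact T.one_of_mem_closedBall (Metric.ball_subset_closedBall hy)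
              rw [pd_congr this, pd_const]
            simp only [this, abs_zero, Finset.sum_const_zero, zero_mul]
            positivity
          · have h5 : R1 ≤ ‖x - z‖ := by rw [← dist_eq_norm]; simpa using hx1
            have h6 : φ x ≤ φ1 := by
              rw [hφ1, hφdef]
              apply Real.exp_le_exp.2
              unfold psiR
              have : R1 ^ 2 ≤ ‖x - z‖ ^ 2 := by gcongr; linarith
              gcongr
            have h7 : ∑ i, |pd T i x| ≤ n * A := by
              calc ∑ i, |pd T i x| ≤ ∑ _i : Fin n, A := Finset.sum_le_sum fun i _ => HA i x hx
                _ = _ := by simp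
            rw [mul_comm]
            gcongr
        have b3 : Real.exp (2 * τ * φ x) ≤ Real.exp (2 * τ) := by
          apply Real.exp_le_exp.2
          have := hφle1 x
          nlinarith
        have b4 : 0 ≤ ∑ i, |pd θ i x| := by positivity
        calc _ ≤ (∑ i, |pd θ i x| + ∑ i, |pd T i x|) * (Real.exp (2 * τ * φ x) * En v x) := by gcongr
          _ = (∑ i, |pd θ i x|) * Real.exp (2 * τ * φ x) * En v x
              + ((∑ i, |pd T i x|) * Real.exp (2 * τ * φ x)) * En v x := by ring
          _ ≤ (∑ i, |pd θ i x|) * Real.exp (2 * τ) * En v x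
              + (Real.exp (2 * τ * φ1) * (n * A)) * En v x := by gcongr
          _ = _ := by ring
    · exact ic (by fun_prop)
    · exact ic (by fun_prop)
  set I0 := ∫ x in Metric.ball z R0, θ x * En v x
  set I1 := ∫ x in Metric.closedBall z R2, (∑ i, |pd θ i x|) * En v x
  set I2 := ∫ x in Metric.closedBall z R2, En v x with hI2
  have hI20 : 0 ≤ I2 := integral_nonneg fun x => hE0 x
  have main : Real.exp (2 * τ * φ0) * I0 ≤ C1 * τ ^ 5 * (Real.exp (2 * τ) * I1
      + Real.exp (2 * τ * φ1) * (n * A) * I2) :=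
    low.trans (HH.trans (by gcongr))
  have e0 := Real.exp_pos (2 * τ * φ0)
  have x1 : Real.exp (2 * τ) = Real.exp (2 * τ * φ0) * Real.exp (2 * τ * (1 - φ0)) := by
    rw [← Real.exp_add]; congr 1; ring
  have x2 : Real.exp (2 * τ * φ1) = Real.exp (2 * τ * φ0) * Real.exp (-(2 * (φ0 - φ1) * τ)) := by
    rw [← Real.exp_add]; congr 1; ring
  rw [x1, x2] at main
  have m2 : Real.exp (2 * τ * φ0) * I0 ≤ Real.exp (2 * τ * φ0) *
      (C1 * τ ^ 5 * Real.exp (2 * τ * (1 - φ0)) * I1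
        + (C1 * (n * A) * τ ^ 5 * Real.exp (-(2 * (φ0 - φ1) * τ))) * I2) := by
    refine main.trans (le_of_eq ?_); ring
  have m3 := le_of_mul_le_mul_left m2 e0
  have := mul_le_mul_of_nonneg_right hτε hI20
  linarith
end Part6

section Part7
open MeasureTheory Set
open scoped Topology RealInnerProductSpace Manifold ContDiff
variable {n : ℕ} {a b : Fin n → Fin n → Eucl n → ℝ}

lemma extend_smooth {k : ℕ∞} {v : Eucl n → ℝ} {B K : Set (Eucl n)} (hB : IsOpen B) (hK : IsClosed K)
    (hKB : K ⊆ B) (hv : ContDiffOn ℝ k v B) :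
    ∃ w : Eucl n → ℝ, ContDiff ℝ k w ∧ ∃ U, IsOpen U ∧ K ⊆ U ∧ U ⊆ B ∧ ∀ x ∈ U, w x = v x := by
  obtain ⟨f, h0, h1, h01⟩ := exists_contMDiffMap_zero_one_nhds_of_isClosed (n := k) 𝓘(ℝ, Eucl n)
    hB.isClosed_compl hK (by rw [← subset_compl_iff_disjoint_left, compl_compl]; exact hKB)
  have hf : ContDiff ℝ k (f : Eucl n → ℝ) := f.contMDiff.contDiff
  obtain ⟨W, hWo, hKW, hW⟩ := eventually_nhdsSet_iff_exists.1 h1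
  refine ⟨fun x => f x * v x, ?_, W ∩ B, hWo.inter hB, subset_inter hKW hKB, inter_subset_right,
    fun x hx => by simp [hW x hx.1]⟩
  rw [contDiff_iff_contDiffAt]
  intro x
  by_cases hx : x ∈ B
  · exact hf.contDiffAt.mul (hv.contDiffAt (hB.mem_nhds hx))
  · have h2 : ∀ᶠ y in 𝓝 x, f y = 0 := (eventually_nhdsSet_iff_forall.1 h0) x hx
    have h3 : (fun x => f x * v x) =ᶠ[𝓝 x] fun _ => 0 := by
      filter_upwards [h2] with y hy
      simp [hy]
    exact contDiffAt_const.congr_of_eventuallyEq h3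

lemma flux_eventuallyEq {u v : Eucl n → ℝ} {x : Eucl n} (h : u =ᶠ[𝓝 x] v) (i : Fin n) :
    flux a u i =ᶠ[𝓝 x] flux a v i := by
  have := fun j => pd_eventuallyEq h j
  filter_upwards [Filter.eventually_all.2 this] with y hy
  unfold flux
  exact Finset.sum_congr rfl fun j _ => by rw [hy j]

lemma Lop_congr {u v : Eucl n → ℝ} {x : Eucl n} (h : u =ᶠ[𝓝 x] v) : Lop a u x = Lop a v x := by
  unfold Lop
  exact Finset.sum_congr rfl fun i _ => pd_congr (flux_eventuallyEq h i) i

lemma En_congr {u v : Eucl n → ℝ} {x : Eucl n} (h : u =ᶠ[𝓝 x] v) : En u x = En v x := by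
  unfold En
  rw [h.self_of_nhds]
  congr 1
  exact Finset.sum_congr rfl fun i _ => by rw [pd_congr h i]

lemma gq_young (hC : IsCoef a b) {v χ : Eucl n → ℝ} (x : Eucl n) :
    -(2 * χ x * v x * gq a v χ x) ≤ (1 / 2) * (χ x ^ 2 * gq a v v x) + 2 * (v x ^ 2 * gq a χ χ x) := by
  have h0 : 0 ≤ ∑ i, ∑ j, a i j x * (χ x * pd v i x + 2 * v x * pd χ i x)
      * (χ x * pd v j x + 2 * v x * pd χ j x) := by
    by_cases h : (fun i => χ x * pd v i x + 2 * v x * pd χ i x) = 0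
    · have := fun i => congrFun h i
      simp only [Pi.zero_apply] at this
      simp [this]
    · exact (hC.pos x _ h).le
  have h1 : ∑ i, ∑ j, a i j x * (χ x * pd v i x + 2 * v x * pd χ i x)
      * (χ x * pd v j x + 2 * v x * pd χ j x)
      = χ x ^ 2 * gq a v v x + 2 * v x * χ x * gq a v χ x + 2 * v x * χ x * gq a χ v x
        + 4 * v x ^ 2 * gq a χ χ x := by
    unfold gq flux
    simp_rw [Finset.sum_mul, Finset.mul_sum, ← Finset.sum_add_distrib]
    exact Finset.sum_congr rfl fun i _ => Finset.sum_congr rfl fun j _ => by ring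
  rw [h1, gq_symm hC χ v] at h0
  linarith

lemma caccioppoli (hC : IsCoef a b) (z : Eucl n) {R2 R3 : ℝ} (h0 : 0 < R2) (h23 : R2 < R3)
    {P : ℝ} (hP : 0 ≤ P) :
    ∃ C : ℝ, 0 < C ∧ ∀ v : Eucl n → ℝ, ContDiff ℝ 2 v →
      (∀ x ∈ Metric.closedBall z R3, |Lop a v x| ≤ P * |v x|) →
      ∀ M : ℝ, (∀ x ∈ Metric.closedBall z R3, |v x| ≤ M) →
      ∫ x in Metric.closedBall z R2, En v x ≤ C * M ^ 2 := by
  let T : ContDiffBump z := ⟨R2, R3, h0, h23⟩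
  have hT : ContDiff ℝ 2 (T : Eucl n → ℝ) := T.contDiff
  have hT' : ContDiff ℝ 1 (T : Eucl n → ℝ) := T.contDiff
  set χ : Eucl n → ℝ := (fun x => T x) with hχ
  have hcs : HasCompactSupport χ := T.hasCompactSupport
  have hsub : tsupport χ ⊆ Metric.closedBall z R3 := T.tsupport_eq.subset
  obtain ⟨c0, hc0, H0⟩ := qf_lower hC (isCompact_closedBall z R2)
  obtain ⟨A, hA, HA⟩ := exists_bound1 (isCompact_closedBall z R3)
    (gq_contDiff (k := 1) hC hT hT (by norm_num) (by norm_num)).continuous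
  set V := (volume (Metric.closedBall z R3)).toReal with hV
  have hVfin : volume (Metric.closedBall z R3) < ⊤ := measure_closedBall_lt_top
  refine ⟨(1 + 2 * (P + 2 * A) / c0) * (V + 1), by positivity, ?_⟩
  intro v hv hL M hM
  have hv1 : ContDiff ℝ 1 v := hv.of_le (by norm_num)
  have hM0 : 0 ≤ M := (abs_nonneg _).trans (hM z (by simp; linarith))
  have dT := hT'.differentiable (by norm_num)
  have dv := hv1.differentiable (by norm_num)
  have gc : Continuous (gq a v v) := (gq_contDiff (k := 1) hC hv hv (by norm_num) (by norm_num)).continuous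
  have gc2 : Continuous (gq a v χ) := (gq_contDiff (k := 1) hC hv hT (by norm_num) (by norm_num)).continuous
  have Lc := Lop_continuous hC hv
  have hfc := fun i => (flux_contDiff (k := 1) hC hv (by norm_num) (by norm_num) i)
  set η : Eucl n → ℝ := fun x => (χ x * χ x) * v x with hη
  have hηC : ContDiff ℝ 1 η := (hT'.mul hT').mul hv1
  have hηcs : HasCompactSupport η := by
    rw [hη]; exact (hcs.mul_right).mul_right
  have hηpt : ∀ i, HasCompactSupport (pd η i) := fun i =>
    hηcs.mono' (subset_tsupport _ |>.trans (tsupport_pd_subset η i))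
  have pη : ∀ x i, pd η i x = 2 * χ x * v x * pd χ i x + χ x ^ 2 * pd v i x := by
    intro x i
    rw [hη, pd_mul ((dT x).fun_mul (dT x)) (dv x), pd_mul (dT x) (dT x)]
    ring
  have id : ∫ x, Lop a v x * η x = - ∫ x, (2 * χ x * v x * gq a v χ x + χ x ^ 2 * gq a v v x) := by
    have e1 : ∀ x, Lop a v x * η x = ∑ i, pd (flux a v i) i x * η x := fun x => by
      unfold Lop; rw [Finset.sum_mul]
    have e2 : ∀ x, (2 * χ x * v x * gq a v χ x + χ x ^ 2 * gq a v v x)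
        = ∑ i, flux a v i x * pd η i x := fun x => by
      unfold gq
      rw [Finset.mul_sum, Finset.mul_sum, ← Finset.sum_add_distrib]
      exact Finset.sum_congr rfl fun i _ => by rw [pη]; ring
    simp_rw [e1, e2]
    rw [integral_finsetSum, integral_finsetSum, ← Finset.sum_neg_distrib]
    · exact Finset.sum_congr rfl fun i _ => ibp (hfc i) hηC hηcs i
    · exact fun i _ => Continuous.integrable_of_hasCompactSupport
        ((hfc i).continuous.mul (pd_continuous hηC i)) (hηpt i).mul_left
    · exact fun i _ => Continuous.integrable_of_hasCompactSupport
        ((pd_continuous (hfc i) i).mul hηC.continuous) hηcs.mul_left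
  have hχc : Continuous χ := hT.continuous
  have vc := hv.continuous
  have hcsq : HasCompactSupport (fun x => χ x ^ 2 * gq a v v x) := by
    have : (fun x => χ x ^ 2 * gq a v v x) = fun x => χ x * (χ x * gq a v v x) := by
      funext x; ring
    rw [this]; exact hcs.mul_right
  have i1 : Integrable (fun x => χ x ^ 2 * gq a v v x) :=
    Continuous.integrable_of_hasCompactSupport (by fun_prop) hcsq
  have i2 : Integrable (fun x => 2 * χ x * v x * gq a v χ x) :=
    Continuous.integrable_of_hasCompactSupport (by fun_prop) (by
      have : (fun x => 2 * χ x * v x * gq a v χ x) = fun x => χ x * (2 * v x * gq a v χ x) := by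
        funext x; ring
      rw [this]; exact hcs.mul_right)
  have i3 : Integrable (fun x => Lop a v x * η x) :=
    Continuous.integrable_of_hasCompactSupport (Lc.mul hηC.continuous) hηcs.mul_left
  have i4 : IntegrableOn (fun _ : Eucl n => (P + 2 * A) * M ^ 2) (Metric.closedBall z R3) :=
    integrableOn_const hVfin.ne
  have i5 : Integrable ((Metric.closedBall z R3).indicator fun _ : Eucl n => (P + 2 * A) * M ^ 2) :=
    (integrable_indicator_iff measurableSet_closedBall).2 i4
  have key : ∫ x, χ x ^ 2 * gq a v v x ≤ 2 * ((P + 2 * A) * M ^ 2 * V) := by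
    rw [integral_add i2 i1] at id
    have h1 : ∫ x, (1 / 2) * (χ x ^ 2 * gq a v v x)
        = (∫ x, χ x ^ 2 * gq a v v x) - (1 / 2) * ∫ x, χ x ^ 2 * gq a v v x := by
      rw [integral_const_mul]; ring
    have h2 : ∫ x, (-(Lop a v x * η x) - 2 * χ x * v x * gq a v χ x - (1 / 2) * (χ x ^ 2 * gq a v v x))
        ≤ ∫ x, (Metric.closedBall z R3).indicator (fun _ : Eucl n => (P + 2 * A) * M ^ 2) x := by
      refine integral_mono ((i3.neg.sub i2).sub (i1.const_mul _)) i5 fun x => ?_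
      by_cases hx : x ∈ Metric.closedBall z R3
      · rw [indicator_of_mem hx]
        have y1 := gq_young hC (v := v) (χ := χ) x
        have hvM := hM x hx
        have hχ1 : χ x ≤ 1 := T.le_one
        have hχ0 : 0 ≤ χ x := T.nonneg
        have y2 : -(Lop a v x * η x) ≤ P * M ^ 2 := by
          refine (neg_le_abs _).trans ?_
          have q1 : |η x| ≤ M := by
            simp only [hη]
            rw [abs_mul, abs_of_nonneg (mul_nonneg hχ0 hχ0)]
            calc _ ≤ 1 * |v x| := by gcongr; nlinarith
              _ ≤ M := by linarith
          rw [abs_mul]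
          calc _ ≤ (P * M) * M := by
                gcongr
                exact (hL x hx).trans (by gcongr)
            _ = _ := by ring
        have y3 : v x ^ 2 * gq a χ χ x ≤ M ^ 2 * A := by
          have q1 : v x ^ 2 ≤ M ^ 2 := by rw [← sq_abs]; gcongr
          have q2 : gq a χ χ x ≤ A := (le_abs_self _).trans (HA x hx)
          calc v x ^ 2 * gq a χ χ x ≤ v x ^ 2 * A := by gcongr
            _ ≤ _ := by gcongr
        simp only []
        linarith
      · rw [indicator_of_notMem hx]
        have : χ x = 0 := image_eq_zero_of_notMem_tsupport fun h => hx (hsub h)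
        simp [this, hη]
    rw [integral_indicator measurableSet_closedBall, setIntegral_const] at h2
    have h3 : ∫ x, (-(Lop a v x * η x) - 2 * χ x * v x * gq a v χ x - (1 / 2) * (χ x ^ 2 * gq a v v x))
      = -(∫ x, Lop a v x * η x) - (∫ x, 2 * χ x * v x * gq a v χ x)
        - ∫ x, (1 / 2) * (χ x ^ 2 * gq a v v x) := by
      have k1 : Integrable (fun x => -(Lop a v x * η x)) := i3.neg
      have k2 : Integrable (fun x => -(Lop a v x * η x) - 2 * χ x * v x * gq a v χ x) := k1.sub i2
      have k3 : Integrable (fun x => (1 / 2) * (χ x ^ 2 * gq a v v x)) := i1.const_mul _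
      rw [integral_sub k2 k3, integral_sub k1 i2, integral_neg]
    rw [h3, h1, id] at h2
    simp only [smul_eq_mul, measureReal_def, ← hV] at h2
    linarith
  have hEi : IntegrableOn (fun x => M ^ 2 + c0⁻¹ * (χ x ^ 2 * gq a v v x)) (Metric.closedBall z R2) :=
    Continuous.continuousOn (by fun_prop) |>.integrableOn_compact (isCompact_closedBall z R2)
  have s1 : ∫ x in Metric.closedBall z R2, En v x
      ≤ ∫ x in Metric.closedBall z R2, (M ^ 2 + c0⁻¹ * (χ x ^ 2 * gq a v v x)) := by
    refine setIntegral_mono_on ?_ hEi measurableSet_closedBall fun x hx => ?_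
    · exact (En_continuous hv1).continuousOn.integrableOn_compact (isCompact_closedBall z R2)
    · have hx3 : x ∈ Metric.closedBall z R3 := Metric.closedBall_subset_closedBall h23.le hx
      have hχ1 : χ x = 1 := T.one_of_mem_closedBall hx
      rw [hχ1]
      unfold En
      have q1 : v x ^ 2 ≤ M ^ 2 := by rw [← sq_abs]; gcongr; exact hM x hx3
      have q2 := H0 x hx (fun i => pd v i x)
      rw [← gq_self_eq] at q2
      have q3 : ∑ i, pd v i x ^ 2 ≤ c0⁻¹ * gq a v v x := by
        rw [le_inv_mul_iff₀ hc0]; exact q2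
      linarith
  have hgnn : ∀ x, 0 ≤ χ x ^ 2 * gq a v v x := fun x => by
    refine mul_nonneg (sq_nonneg _) ?_
    rw [gq_self_eq]
    by_cases h : (fun i => pd v i x) = 0
    · rw [h]; simp [qf]
    · exact (hC.pos x _ h).le
  have s2 : ∫ x in Metric.closedBall z R2, (M ^ 2 + c0⁻¹ * (χ x ^ 2 * gq a v v x))
      ≤ V * M ^ 2 + c0⁻¹ * (2 * ((P + 2 * A) * M ^ 2 * V)) := by
    have k1 : Integrable (fun _ : Eucl n => M ^ 2) (volume.restrict (Metric.closedBall z R2)) :=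
      integrableOn_const (measure_closedBall_lt_top (μ := volume)).ne
    have k2 : Integrable (fun x => c0⁻¹ * (χ x ^ 2 * gq a v v x))
        (volume.restrict (Metric.closedBall z R2)) := i1.restrict.const_mul _
    rw [integral_add k1 k2, setIntegral_const, integral_const_mul]
    have q1 : ∫ x in Metric.closedBall z R2, χ x ^ 2 * gq a v v x ≤ ∫ x, χ x ^ 2 * gq a v v x :=
      setIntegral_le_integral i1 (Filter.Eventually.of_forall hgnn)
    have q2 : volume.real (Metric.closedBall z R2) ≤ V :=
      ENNReal.toReal_mono hVfin.ne (measure_mono (Metric.closedBall_subset_closedBall h23.le))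
    rw [smul_eq_mul]
    gcongr
    exact q1.trans key
  refine s1.trans (s2.trans ?_)
  have : V * M ^ 2 + c0⁻¹ * (2 * ((P + 2 * A) * M ^ 2 * V))
      = (1 + 2 * (P + 2 * A) / c0) * V * M ^ 2 := by field_simp
  rw [this]
  gcongr
  linarith
end Part7

section Part8
open MeasureTheory Set
open scoped Topology RealInnerProductSpace Manifold ContDiff
variable {n : ℕ} {a b : Fin n → Fin n → Eucl n → ℝ}

/-- solutions of the differential inequality on `B` -/
def Sol (a : Fin n → Fin n → Eucl n → ℝ) (B : Set (Eucl n)) (P : ℝ) (v : Eucl n → ℝ) : Prop :=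
  ContDiffOn ℝ 2 v B ∧ ∀ x ∈ B, |Lop a v x| ≤ P * |v x|

/-- localise a solution: a globally `C²` function equal to `v` near `K`. -/
lemma Sol.localise {B : Set (Eucl n)} {P : ℝ} {v : Eucl n → ℝ} (hv : Sol a B P v) (hB : IsOpen B)
    {K : Set (Eucl n)} (hK : IsClosed K) (hKB : K ⊆ B) :
    ∃ w : Eucl n → ℝ, ContDiff ℝ 2 w ∧ ∀ x ∈ K, w =ᶠ[𝓝 x] v ∧ w x = v x ∧ En w x = En v x ∧
      |Lop a w x| ≤ P * |w x| := by
  obtain ⟨w, hw, U, hU, hKU, hUB, hwv⟩ := extend_smooth (k := 2) hB hK hKB hv.1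
  refine ⟨w, hw, fun x hx => ?_⟩
  have he : w =ᶠ[𝓝 x] v := by
    filter_upwards [hU.mem_nhds (hKU hx)] with y hy
    exact hwv y hy
  refine ⟨he, he.self_of_nhds, En_congr he, ?_⟩
  rw [Lop_congr he, he.self_of_nhds]
  exact hv.2 x (hKB hx)

lemma Sol.En_integrableOn {B : Set (Eucl n)} {P : ℝ} {v : Eucl n → ℝ} (hv : Sol a B P v) (hB : IsOpen B)
    {K : Set (Eucl n)} (hK : IsCompact K) (hKB : K ⊆ B) : IntegrableOn (En v) K := by
  obtain ⟨w, hw, h⟩ := hv.localise hB hK.isClosed hKB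
  have h1 : IntegrableOn (En w) K :=
    (En_continuous (hw.of_le (by norm_num))).continuousOn.integrableOn_compact hK
  exact h1.congr_fun (fun x hx => (h x hx).2.2.1) hK.measurableSet

def Good (a : Fin n → Fin n → Eucl n → ℝ) (B : Set (Eucl n)) (P : ℝ) (D : (Eucl n → ℝ) → ℝ)
    (x : Eucl n) : Prop :=
  ∃ ρ > 0, Metric.closedBall x ρ ⊆ B ∧ ∀ ε > 0, ∃ C : ℝ, 0 ≤ C ∧ ∀ v : Eucl n → ℝ, Sol a B P v →
    ∀ M : ℝ, (∀ y ∈ B, |v y| ≤ M) → ∫ y in Metric.ball x ρ, En v y ≤ ε * M ^ 2 + C * D v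

lemma Good.sub {B : Set (Eucl n)} (hB : IsOpen B) {P : ℝ} {D : (Eucl n → ℝ) → ℝ}
    {x y : Eucl n} {ρ σ : ℝ} (hρ : Metric.closedBall x ρ ⊆ B) (hσ : 0 < σ)
    (hsub : Metric.closedBall y σ ⊆ Metric.closedBall x ρ)
    (hsub' : Metric.ball y σ ⊆ Metric.ball x ρ)
    (h : ∀ ε > 0, ∃ C : ℝ, 0 ≤ C ∧ ∀ v : Eucl n → ℝ, Sol a B P v →
      ∀ M : ℝ, (∀ y ∈ B, |v y| ≤ M) → ∫ y in Metric.ball x ρ, En v y ≤ ε * M ^ 2 + C * D v) :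
    Metric.closedBall y σ ⊆ B ∧ ∀ ε > 0, ∃ C : ℝ, 0 ≤ C ∧ ∀ v : Eucl n → ℝ, Sol a B P v →
      ∀ M : ℝ, (∀ y ∈ B, |v y| ≤ M) → ∫ y in Metric.ball y σ, En v y ≤ ε * M ^ 2 + C * D v := by
  refine ⟨hsub.trans hρ, fun ε hε => ?_⟩
  obtain ⟨C, hC, H⟩ := h ε hε
  refine ⟨C, hC, fun v hv M hM => le_trans ?_ (H v hv M hM)⟩
  refine setIntegral_mono_set ?_ (Filter.Eventually.of_forall fun x => En_nonneg v x)
    hsub'.eventuallyLE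
  exact (hv.En_integrableOn hB (isCompact_closedBall x ρ) hρ).mono_set Metric.ball_subset_closedBall

lemma good_step (hC : IsCoef a b) {B : Set (Eucl n)} (hB : IsOpen B) {P : ℝ} (hP : 0 ≤ P)
    {D : (Eucl n → ℝ) → ℝ} (hD : ∀ v, 0 ≤ D v) {x : Eucl n} {t : ℝ} (ht : 0 < t)
    (hx : Good a B P D x) (hxB : Metric.closedBall x (5 * t) ⊆ B) :
    ∀ ε > 0, ∃ C : ℝ, 0 ≤ C ∧ ∀ v : Eucl n → ℝ, Sol a B P v →
      ∀ M : ℝ, (∀ y ∈ B, |v y| ≤ M) → ∫ y in Metric.ball x (2 * t), En v y ≤ ε * M ^ 2 + C * D v := by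
  obtain ⟨ρ0, hρ0, hρ0B, hgood0⟩ := hx
  set ρ := min ρ0 t with hρdef
  have hρ : 0 < ρ := lt_min hρ0 ht
  have hρt : ρ ≤ t := min_le_right _ _
  obtain ⟨hρB, hgood⟩ := Good.sub (y := x) (σ := ρ) hB hρ0B hρ
    (Metric.closedBall_subset_closedBall (min_le_left _ _))
    (Metric.ball_subset_ball (min_le_left _ _)) hgood0
  intro ε hε
  obtain ⟨Cc, hCc, Hc⟩ := caccioppoli hC x (R2 := 4 * t) (R3 := 5 * t) (by linarith) (by linarith) hP
  obtain ⟨C4, hC4, H4⟩ := step4 hC x (s := ρ / 3) (R0 := 2 * t) (R1 := 3 * t) (R2 := 4 * t)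
    (by linarith) (by linarith) (by linarith) (by linarith) hP (ε := ε / (2 * Cc)) (by positivity)
  let T : ContDiffBump x := ⟨ρ / 3, ρ / 2, by linarith, by linarith⟩
  have hT : ContDiff ℝ 1 (T : Eucl n → ℝ) := T.contDiff
  set θ : Eucl n → ℝ := fun y => 1 - T y with hθdef
  have hθ : ContDiff ℝ 1 θ := contDiff_const.sub hT
  obtain ⟨A, hA, HA⟩ := exists_bound (isCompact_closedBall x (4 * t)) (fun i : Fin n => pd θ i)
    (fun i => pd_continuous hθ i)
  set Q := C4 * (n * A) + 1 with hQ
  have hQ0 : 0 < Q := by positivity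
  obtain ⟨Cg, hCg, Hg⟩ := hgood (ε / (2 * Q)) (by positivity)
  refine ⟨Q * Cg, by positivity, fun v hv M hM => ?_⟩
  obtain ⟨w, hw, hwv⟩ := hv.localise hB (Metric.isClosed_closedBall) hxB
  have hsub : ∀ r, r ≤ 5 * t → Metric.closedBall x r ⊆ Metric.closedBall x (5 * t) := fun r hr =>
    Metric.closedBall_subset_closedBall hr
  have hwL := fun y hy => (hwv y hy).2.2.2
  have hwE := fun y hy => (hwv y hy).2.2.1
  have hEc := En_continuous (hw.of_le (by norm_num) : ContDiff ℝ 1 w)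
  have hE0 := En_nonneg w
  have ic : ∀ {f : Eucl n → ℝ} (r : ℝ), Continuous f → IntegrableOn f (Metric.closedBall x r) :=
    fun r hf => hf.continuousOn.integrableOn_compact (isCompact_closedBall x r)
  have icb : ∀ {f : Eucl n → ℝ} (r : ℝ), Continuous f → IntegrableOn f (Metric.ball x r) :=
    fun r hf => (ic r hf).mono_set Metric.ball_subset_closedBall
  have g1 : ∫ y in Metric.ball x ρ, En w y ≤ ε / (2 * Q) * M ^ 2 + Cg * D v := by
    refine le_trans (le_of_eq ?_) (Hg v hv M hM)
    refine setIntegral_congr_fun measurableSet_ball fun y hy => hwE y ?_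
    exact hsub ρ (by linarith) (Metric.ball_subset_closedBall hy)
  have g2 : ∫ y in Metric.closedBall x (4 * t), En w y ≤ Cc * M ^ 2 :=
    Hc w hw hwL M (fun y hy => by rw [(hwv y hy).2.1]; exact hM y (hxB hy))
  have g3 := H4 w hw (fun y hy => hwL y (hsub _ (by linarith) hy)) θ hθ
    (fun y => by simp only [hθdef]; linarith [T.le_one (x := y)])
    (fun y => by simp only [hθdef]; linarith [T.nonneg (x := y)])
    (fun y hy => by
      simp only [hθdef]
      rw [T.one_of_mem_closedBall (Metric.ball_subset_closedBall hy)]; ring)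
  have hbc : Continuous (fun y => (∑ i, |pd θ i y|) * En w y) :=
    (continuous_finsetSum _ fun i _ => (pd_continuous hθ i).abs).mul hEc
  have g4 : ∫ y in Metric.closedBall x (4 * t), (∑ i, |pd θ i y|) * En w y
      ≤ n * A * ∫ y in Metric.ball x ρ, En w y := by
    have hz : ∀ y, y ∉ Metric.ball x ρ → ∀ i, pd θ i y = 0 := by
      intro y hy i
      have : θ =ᶠ[𝓝 y] fun _ => 1 := by
        have : y ∉ Metric.closedBall x (ρ / 2) := fun h => hy
          (Metric.closedBall_subset_ball (by linarith) h)
        filter_upwards [Metric.isClosed_closedBall.isOpen_compl.mem_nhds this] with z hz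
        have : T z = 0 := T.zero_of_le_dist (by
          have : ¬ dist z x ≤ ρ / 2 := hz
          exact (not_le.1 this).le)
        simp [hθdef, this]
      rw [pd_congr this, pd_const]
    have e1 : ∫ y in Metric.closedBall x (4 * t), (∑ i, |pd θ i y|) * En w y
        = ∫ y in Metric.ball x ρ, (∑ i, |pd θ i y|) * En w y := by
      refine setIntegral_eq_of_subset_of_forall_sdiff_eq_zero measurableSet_closedBall
        (Metric.ball_subset_closedBall.trans (Metric.closedBall_subset_closedBall (by linarith))) ?_
      intro y hy
      simp [hz y hy.2]
    rw [e1, ← integral_const_mul]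
    refine setIntegral_mono_on (icb _ hbc) (icb _ (by fun_prop)) measurableSet_ball fun y hy => ?_
    refine mul_le_mul_of_nonneg_right ?_ (hE0 y)
    calc ∑ i, |pd θ i y| ≤ ∑ _i : Fin n, A := Finset.sum_le_sum fun i _ => HA i y
          (Metric.closedBall_subset_closedBall (by linarith) (Metric.ball_subset_closedBall hy))
      _ = _ := by simp
  have g5 : ∫ y in Metric.ball x (2 * t), En w y
      ≤ (∫ y in Metric.ball x (2 * t), θ y * En w y) + ∫ y in Metric.ball x ρ, En w y := by
    have hTc : Continuous (fun y => T y * En w y) := hT.continuous.mul hEc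
    have e1 : ∫ y in Metric.ball x (2 * t), En w y
        = (∫ y in Metric.ball x (2 * t), θ y * En w y)
          + ∫ y in Metric.ball x (2 * t), T y * En w y := by
      have k1 : IntegrableOn (fun y => θ y * En w y) (Metric.ball x (2 * t)) :=
        icb _ (hθ.continuous.mul hEc)
      have k2 : IntegrableOn (fun y => T y * En w y) (Metric.ball x (2 * t)) := icb _ hTc
      rw [← integral_add k1 k2]
      refine setIntegral_congr_fun measurableSet_ball fun y _ => ?_
      simp only [hθdef]; ring
    have e2 : ∫ y in Metric.ball x (2 * t), T y * En w y = ∫ y in Metric.ball x ρ, T y * En w y := by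
      refine setIntegral_eq_of_subset_of_forall_sdiff_eq_zero measurableSet_ball
        (Metric.ball_subset_ball (by linarith)) ?_
      intro y hy
      have : T y = 0 := T.zero_of_le_dist (by
        have : ¬ dist y x < ρ := hy.2
        show ρ / 2 ≤ _
        linarith)
      simp [this]
    rw [e1, e2]
    refine add_le_add le_rfl ?_
    refine setIntegral_mono_on (icb _ hTc) (icb _ hEc) measurableSet_ball fun y hy => ?_
    exact mul_le_of_le_one_left (hE0 y) T.le_one
  have g6 : ∫ y in Metric.ball x (2 * t), En v y = ∫ y in Metric.ball x (2 * t), En w y := by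
    refine setIntegral_congr_fun measurableSet_ball fun y hy => (hwE y ?_).symm
    exact hsub _ (by linarith) (Metric.ball_subset_closedBall hy)
  rw [g6]
  set I := ∫ y in Metric.ball x ρ, En w y
  have g7 : ε / (2 * Cc) * ∫ y in Metric.closedBall x (4 * t), En w y ≤ ε / 2 * M ^ 2 := by
    calc _ ≤ ε / (2 * Cc) * (Cc * M ^ 2) := by gcongr
      _ = _ := by field_simp
  calc _ ≤ _ := g5
    _ ≤ (C4 * (n * A * I) + ε / 2 * M ^ 2) + I := by
        gcongr
        refine g3.trans ?_
        gcongr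
    _ = Q * I + ε / 2 * M ^ 2 := by rw [hQ]; ring
    _ ≤ Q * (ε / (2 * Q) * M ^ 2 + Cg * D v) + ε / 2 * M ^ 2 := by gcongr
    _ = _ := by field_simp; ring

lemma good_all (hC : IsCoef a b) {B : Set (Eucl n)} (hB : IsOpen B) (hBc : IsPreconnected B)
    {P : ℝ} (hP : 0 ≤ P)
    {D : (Eucl n → ℝ) → ℝ} (hD : ∀ v, 0 ≤ D v) {x0 : Eucl n} (hx0B : x0 ∈ B) (hx0 : Good a B P D x0) :
    ∀ x ∈ B, Good a B P D x := by
  have hsub : B ⊆ {x | Good a B P D x} := by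
    refine hBc.subset_of_closure_inter_subset ?_ ⟨x0, hx0B, hx0⟩ ?_
    · rw [Metric.isOpen_iff]
      rintro x ⟨ρ, hρ, hρB, h⟩
      refine ⟨ρ / 2, by linarith, fun y hy => ?_⟩
      have hy' : dist y x < ρ / 2 := hy
      refine ⟨ρ / 2, by linarith, Good.sub hB hρB (by linarith) ?_ ?_ h⟩
      · exact Metric.closedBall_subset_closedBall' (by linarith)
      · exact Metric.ball_subset_ball' (by linarith)
    · rintro y ⟨hy, hyB⟩
      obtain ⟨R, hR, hRB⟩ := Metric.isOpen_iff.1 hB y hyB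
      set t := R / 8 with ht
      have ht0 : 0 < t := by positivity
      obtain ⟨x, hx, hxy⟩ := Metric.mem_closure_iff.1 hy t ht0
      have hxB : Metric.closedBall x (5 * t) ⊆ B := by
        refine Subset.trans ?_ hRB
        exact Metric.closedBall_subset_ball' (by rw [dist_comm]; linarith)
      have := good_step hC hB hP hD ht0 hx hxB
      refine ⟨t, ht0, Good.sub (x := x) (ρ := 2 * t) hB
        ((Metric.closedBall_subset_closedBall (by linarith)).trans hxB) ht0 ?_ ?_ this⟩
      · exact Metric.closedBall_subset_closedBall' (by linarith)
      · exact Metric.ball_subset_ball' (by linarith)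
  exact fun x hx => hsub hx
end Part8

section Part9
open MeasureTheory Set
open scoped Topology RealInnerProductSpace Manifold ContDiff ENNReal NNReal
variable {n : ℕ} {a b : Fin n → Fin n → Eucl n → ℝ}

lemma gradient_coord (u : Eucl n → ℝ) (x : Eucl n) (i : Fin n) : (gradient u x) i = pd u i x := by
  unfold pd gradient
  rw [← InnerProductSpace.toDual_symm_apply (𝕜 := ℝ) (x := EuclideanSpace.single i 1)
    (y := fderiv ℝ u x)]
  rw [EuclideanSpace.inner_single_right]
  simp

lemma gradient_ne_zero {u : Eucl n → ℝ} {x : Eucl n} (h : gradient u x ≠ 0) :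
    ∃ k, pd u k x ≠ 0 := by
  by_contra hc
  push Not at hc
  apply h
  ext i
  rw [gradient_coord, hc i]; rfl

/-- globally extended local defining function -/
structure FChart (D : Set (Eucl n)) (y0 : Eucl n) (ρ : Eucl n → ℝ) (R c σ : ℝ) (k : Fin n) : Prop where
  smooth : ContDiff ℝ 4 ρ
  Rpos : 0 < R
  cpos : 0 < c
  sig : σ = 1 ∨ σ = -1
  inside : ∀ y ∈ Metric.ball y0 R, (y ∈ D ↔ ρ y < 0)
  bdry : ∀ y ∈ Metric.ball y0 R, (y ∈ frontier D ↔ ρ y = 0)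
  deriv_ge : ∀ y ∈ Metric.ball y0 R, c ≤ σ * pd ρ k y

lemma fchart_of {D V : Set (Eucl n)} {y0 : Eucl n} {ρ0 : Eucl n → ℝ} (hV : IsOpen V) (hy0 : y0 ∈ V)
    (hρ : ContDiffOn ℝ 4 ρ0 V) (hg : gradient ρ0 y0 ≠ 0) (h1 : D ∩ V = {y | y ∈ V ∧ ρ0 y < 0})
    (h2 : frontier D ∩ V = {y | y ∈ V ∧ ρ0 y = 0}) :
    ∃ ρ R c σ k, FChart D y0 ρ R c σ k ∧ ∀ y ∈ Metric.ball y0 R, y ∈ V ∧ ρ =ᶠ[𝓝 y] ρ0 := by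
  obtain ⟨R1, hR1, hR1V⟩ := Metric.isOpen_iff.1 hV y0 hy0
  obtain ⟨ρ, hρs, U, hU, hKU, hUV, he⟩ := extend_smooth (k := 4) (K := {y0}) hV isClosed_singleton
    (by simpa using hy0) hρ
  have hy0U : y0 ∈ U := hKU rfl
  have hee : ∀ y ∈ U, ρ =ᶠ[𝓝 y] ρ0 := fun y hy => by
    filter_upwards [hU.mem_nhds hy] with z hz using he z hz
  obtain ⟨k, hk⟩ := gradient_ne_zero hg
  rw [← pd_congr (hee y0 hy0U)] at hk
  have hρ4 : ContDiff ℝ 4 ρ := hρs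
  have hcont : Continuous (pd ρ k) := pd_continuous (hρ4.of_le (by norm_num)) k
  obtain ⟨σ, hσ, hσk⟩ : ∃ σ : ℝ, (σ = 1 ∨ σ = -1) ∧ σ * pd ρ k y0 = |pd ρ k y0| := by
    rcases le_total 0 (pd ρ k y0) with h | h
    · exact ⟨1, Or.inl rfl, by rw [abs_of_nonneg h]; ring⟩
    · exact ⟨-1, Or.inr rfl, by rw [abs_of_nonpos h]; ring⟩
  have hpos : 0 < |pd ρ k y0| := abs_pos.2 hk
  have hn : ∀ᶠ y in 𝓝 y0, y ∈ U ∧ |pd ρ k y0| / 2 < σ * pd ρ k y := by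
    have hUe : ∀ᶠ y in 𝓝 y0, y ∈ U := hU.mem_nhds hy0U
    refine hUe.and ?_
    have : Continuous fun y => σ * pd ρ k y := by fun_prop
    refine this.continuousAt.eventually (lt_mem_nhds ?_)
    beta_reduce
    rw [hσk]; linarith
  obtain ⟨R, hR, H⟩ := Metric.eventually_nhds_iff_ball.1 hn
  refine ⟨ρ, R, |pd ρ k y0| / 2, σ, k, ⟨hρ4, hR, by positivity, hσ, fun y hy => ?_, fun y hy => ?_,
    fun y hy => (H y hy).2.le⟩, fun y hy => ⟨hUV (H y hy).1, hee y (H y hy).1⟩⟩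
  · have hyV := hUV (H y hy).1
    have := Set.ext_iff.1 h1 y
    simp only [mem_inter_iff, mem_ofPred_eq, hyV, and_true, true_and] at this
    rw [this, he y (H y hy).1]
  · have hyV := hUV (H y hy).1
    have := Set.ext_iff.1 h2 y
    simp only [mem_inter_iff, mem_ofPred_eq, hyV, and_true, true_and] at this
    rw [this, he y (H y hy).1]

lemma exists_fchart {D : Set (Eucl n)} (hD : HasC4Boundary D) {y0 : Eucl n} (hy : y0 ∈ frontier D) :
    ∃ ρ R c σ k, FChart D y0 ρ R c σ k := by
  obtain ⟨V, ρ0, hV, hyV, hs, hg, h1, h2⟩ := hD y0 hy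
  obtain ⟨ρ, R, c, σ, k, h, -⟩ := fchart_of hV hyV hs (hg y0 hyV) h1 h2
  exact ⟨ρ, R, c, σ, k, h⟩

lemma hasDerivAt_line {u : Eucl n → ℝ} (hu : Differentiable ℝ u) (y : Eucl n) (i : Fin n) (s : ℝ) :
    HasDerivAt (fun t : ℝ => u (y + t • EuclideanSpace.single i 1))
      (pd u i (y + s • EuclideanSpace.single i 1)) s := by
  have h1 : HasDerivAt (fun t : ℝ => y + t • (EuclideanSpace.single i 1 : Eucl n))
      (EuclideanSpace.single i 1) s := by
    simpa using ((hasDerivAt_id s).smul_const (EuclideanSpace.single i 1 : Eucl n)).const_add y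
  exact (hu _).hasFDerivAt.comp_hasDerivAt s h1

/-- lower bound for increments in the direction `e_k` -/
lemma FChart.incr {D : Set (Eucl n)} {y0 : Eucl n} {ρ : Eucl n → ℝ} {R c σ : ℝ} {k : Fin n}
    (h : FChart D y0 ρ R c σ k) {y : Eucl n} {t : ℝ} (ht : 0 ≤ t) (hy : y ∈ Metric.ball y0 R)
    (hy' : y + t • EuclideanSpace.single k 1 ∈ Metric.ball y0 R) :
    c * t ≤ σ * (ρ (y + t • EuclideanSpace.single k 1) - ρ y) := by
  have hd : Differentiable ℝ ρ := h.smooth.differentiable (by norm_num)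
  have hin : ∀ s ∈ Icc 0 t, y + s • (EuclideanSpace.single k 1 : Eucl n) ∈ Metric.ball y0 R := by
    intro s hs
    have hc := convex_ball y0 R
    have := hc.add_smul_sub_mem hy hy' (t := s / t) ⟨div_nonneg hs.1 ht, div_le_one_of_le₀ hs.2 ht⟩
    rcases eq_or_lt_of_le ht with h0 | h0
    · have : s = 0 := le_antisymm (by rw [h0]; exact hs.2) hs.1
      simpa [this] using hy
    · rw [add_sub_cancel_left, smul_smul, div_mul_cancel₀ _ h0.ne'] at this
      exact this
  have key : ∀ s ∈ Icc (0:ℝ) t, HasDerivAt (fun s : ℝ => σ * ρ (y + s • EuclideanSpace.single k 1))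
      (σ * pd ρ k (y + s • EuclideanSpace.single k 1)) s := fun s _ =>
    (hasDerivAt_line hd y k s).const_mul σ
  have := (convex_Icc (0:ℝ) t).mul_sub_le_image_sub_of_le_deriv (C := c)
    (f := fun s : ℝ => σ * ρ (y + s • EuclideanSpace.single k 1))
    (fun s hs => (key s hs).continuousAt.continuousWithinAt)
    (fun s hs => (key s (interior_subset hs)).differentiableAt.differentiableWithinAt)
    (fun s hs => by
      rw [(key s (interior_subset hs)).deriv]
      exact h.deriv_ge _ (hin s (interior_subset hs)))
    0 ⟨le_rfl, ht⟩ t ⟨ht, le_rfl⟩ ht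
  simp only [sub_zero, zero_smul, add_zero] at this
  linarith

lemma FChart.incr_abs {D : Set (Eucl n)} {y0 : Eucl n} {ρ : Eucl n → ℝ} {R c σ : ℝ} {k : Fin n}
    (h : FChart D y0 ρ R c σ k) {y : Eucl n} {t : ℝ} (hy : y ∈ Metric.ball y0 R)
    (hy' : y + t • EuclideanSpace.single k 1 ∈ Metric.ball y0 R) :
    c * |t| ≤ |ρ (y + t • EuclideanSpace.single k 1) - ρ y| := by
  have hs : ∀ z : ℝ, σ * z ≤ |z| := fun z => by
    rcases h.sig with e | e <;> rw [e]
    · simpa using le_abs_self z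
    · simpa using neg_le_abs z
  rcases le_total 0 t with ht | ht
  · rw [abs_of_nonneg ht]
    exact (h.incr ht hy hy').trans (hs _)
  · rw [abs_of_nonpos ht]
    have := h.incr (y := y + t • EuclideanSpace.single k 1) (t := -t) (by linarith) hy' (by simpa using hy)
    refine this.trans ((hs _).trans (le_of_eq ?_))
    rw [abs_sub_comm]; simp

/-- moving in the direction `σ e_k` increases `ρ` -/
lemma FChart.incr_sig {D : Set (Eucl n)} {y0 : Eucl n} {ρ : Eucl n → ℝ} {R c σ : ℝ} {k : Fin n}
    (h : FChart D y0 ρ R c σ k) {y : Eucl n} {t : ℝ} (ht : 0 ≤ t) (hy : y ∈ Metric.ball y0 R)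
    (hy' : y + (σ * t) • EuclideanSpace.single k 1 ∈ Metric.ball y0 R) :
    c * t ≤ ρ (y + (σ * t) • EuclideanSpace.single k 1) - ρ y := by
  rcases h.sig with e | e
  · subst e
    simp only [one_mul] at hy' ⊢
    have := h.incr ht hy hy'
    linarith
  · subst e
    have := h.incr (y := y + (-1 * t) • EuclideanSpace.single k 1) ht hy' (by simpa using hy)
    simp only [neg_mul, one_mul, neg_smul, neg_add_cancel_right] at this ⊢
    linarith
end Part9

section Part10
open MeasureTheory Set
open scoped Topology RealInnerProductSpace Manifold ContDiff ENNReal NNReal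
variable {m : ℕ}

/-- drop the coordinate `k` -/
def prj (k : Fin (m + 1)) (y : Eucl (m + 1)) : Fin m → ℝ := fun j => y (k.succAbove j)

lemma prj_lip (k : Fin (m + 1)) : LipschitzWith 1 (prj k) := by
  refine LipschitzWith.of_dist_le_mul fun x y => ?_
  rw [NNReal.coe_one, one_mul, dist_pi_le_iff dist_nonneg]
  intro j
  unfold prj
  rw [EuclideanSpace.dist_eq]
  refine Real.le_sqrt_of_sq_le ?_
  exact Finset.single_le_sum (f := fun i => dist (x i) (y i) ^ 2) (fun i _ => by positivity)
    (Finset.mem_univ (k.succAbove j))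

lemma eq_of_prj {k : Fin (m + 1)} {x y : Eucl (m + 1)} (h : prj k x = prj k y) :
    y = x + (y k - x k) • EuclideanSpace.single k 1 := by
  ext i
  rcases eq_or_ne i k with rfl | hi
  · simp
  · obtain ⟨j, rfl⟩ := Fin.exists_succAbove_eq hi
    have : x (k.succAbove j) = y (k.succAbove j) := congrFun h j
    simp [this]

lemma prj_add_single (k : Fin (m + 1)) (x : Eucl (m + 1)) (t : ℝ) :
    prj k (x + t • EuclideanSpace.single k 1) = prj k x := by
  ext j
  simp [prj]

lemma norm_le_prj (k : Fin (m + 1)) (x : Eucl (m + 1)) : ‖x‖ ≤ |x k| + m * ‖prj k x‖ := by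
  have h1 : ‖x‖ ≤ ∑ i, |x i| := by
    have : x = ∑ i, x i • (EuclideanSpace.single i 1 : Eucl (m + 1)) := by
      ext i; simp [Finset.sum_apply, Pi.single_apply]
    calc ‖x‖ = ‖∑ i, x i • (EuclideanSpace.single i 1 : Eucl (m + 1))‖ := by rw [← this]
      _ ≤ ∑ i, ‖x i • (EuclideanSpace.single i 1 : Eucl (m + 1))‖ := norm_sum_le _ _
      _ = _ := by simp [norm_smul]
  rw [Fin.sum_univ_succAbove _ k] at h1
  refine h1.trans ?_
  gcongr
  calc ∑ i, |x (k.succAbove i)| ≤ ∑ _i : Fin m, ‖prj k x‖ :=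
        Finset.sum_le_sum fun i _ => norm_le_pi_norm (prj k x) i
    _ = _ := by simp

lemma FChart.unique {D : Set (Eucl (m + 1))} {y0 : Eucl (m + 1)} {ρ : Eucl (m + 1) → ℝ} {R c σ : ℝ}
    {k : Fin (m + 1)} (h : FChart D y0 ρ R c σ k) {x y : Eucl (m + 1)} (hx : x ∈ Metric.ball y0 R)
    (hy : y ∈ Metric.ball y0 R) (hp : prj k x = prj k y) : c * |y k - x k| ≤ |ρ y - ρ x| := by
  have e := eq_of_prj hp
  have := h.incr_abs (y := x) (t := y k - x k) hx (by rw [← e]; exact hy)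
  rwa [← e] at this

lemma FChart.anti {D : Set (Eucl (m + 1))} {y0 : Eucl (m + 1)} {ρ : Eucl (m + 1) → ℝ} {R c σ : ℝ}
    {k : Fin (m + 1)} (h : FChart D y0 ρ R c σ k) : ∃ K : ℝ≥0,
    ∀ x ∈ frontier D ∩ Metric.ball y0 (R / 4), ∀ y ∈ frontier D ∩ Metric.ball y0 (R / 4),
      dist x y ≤ K * dist (prj k x) (prj k y) := by
  have hR := h.Rpos
  obtain ⟨G, hG⟩ := (h.smooth.of_le (m := 1) (by norm_num)).contDiffOn.exists_lipschitzOnWith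
    (s := Metric.closedBall y0 R) (by norm_num) (convex_closedBall y0 R) (isCompact_closedBall y0 R)
  refine ⟨NNReal.mk ((G * m) / c + m) (by have := h.cpos; positivity), fun x hx y hy => ?_⟩
  set t := y k - x k with ht
  have hxy : dist x y < R / 2 := by
    have h1 := hx.2; have h2 := hy.2
    rw [Metric.mem_ball] at h1 h2
    have := dist_triangle_right x y y0
    linarith
  have habs : |t| ≤ dist x y := by
    rw [dist_comm, EuclideanSpace.dist_eq]
    refine Real.le_sqrt_of_sq_le ?_
    have := Finset.single_le_sum (f := fun i => dist (y i) (x i) ^ 2) (fun i _ => by positivity)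
      (Finset.mem_univ k)
    simpa [Real.dist_eq] using this
  -- the intermediate point
  set z := x + t • EuclideanSpace.single k (1:ℝ) with hz
  have hzx : dist z x ≤ |t| := by
    rw [hz, dist_self_add_left, norm_smul]; simp
  have hxR : x ∈ Metric.ball y0 R := Metric.ball_subset_ball (by linarith) hx.2
  have hyR : y ∈ Metric.ball y0 R := Metric.ball_subset_ball (by linarith) hy.2
  have hzR : z ∈ Metric.ball y0 R := by
    have := dist_triangle z x y0
    have h1 := hx.2
    rw [Metric.mem_ball] at h1 ⊢
    linarith
  have hpz : prj k z = prj k x := prj_add_single _ _ _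
  have hzk : (z - y) k = 0 := by simp [hz, ht]
  have hzy : dist z y ≤ m * dist (prj k x) (prj k y) := by
    rw [dist_eq_norm]
    have := norm_le_prj k (z - y)
    rw [hzk, abs_zero, zero_add] at this
    have e : prj k (z - y) = prj k x - prj k y := by rw [← hpz]; rfl
    rwa [e, ← dist_eq_norm] at this
  have h1 := h.unique hxR hzR hpz.symm
  have hρx : ρ x = 0 := (h.bdry x hxR).1 hx.1
  have hρy : ρ y = 0 := (h.bdry y hyR).1 hy.1
  have h2 : |ρ z - ρ y| ≤ G * dist z y := by
    have := hG.dist_le_mul z (Metric.ball_subset_closedBall hzR) y (Metric.ball_subset_closedBall hyR)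
    rwa [Real.dist_eq] at this
  have hzxk : z k - x k = t := by simp [hz]
  rw [hzxk, hρx, sub_zero] at h1
  rw [hρy, sub_zero] at h2
  have h3 : |t| ≤ G * m / c * dist (prj k x) (prj k y) := by
    have : c * |t| ≤ G * (m * dist (prj k x) (prj k y)) := by
      refine h1.trans (h2.trans ?_)
      gcongr
    have hc := h.cpos
    rw [div_mul_eq_mul_div, le_div_iff₀ hc]
    linarith
  calc dist x y ≤ dist x z + dist z y := dist_triangle _ _ _
    _ ≤ G * m / c * dist (prj k x) (prj k y) + m * dist (prj k x) (prj k y) := by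
        rw [dist_comm x z]; gcongr; exact hzx.trans h3
    _ = _ := by rw [NNReal.coe_mk]; ring

lemma frontier_measure_lt_top {D : Set (Eucl (m + 1))} (hD : HasC4Boundary D)
    (hb : Bornology.IsBounded D) : μH[(m : ℝ)] (frontier D) < ⊤ := by
  have hcomp : IsCompact (frontier D) :=
    Metric.isCompact_of_isClosed_isBounded isClosed_frontier (hb.closure.subset frontier_subset_closure)
  refine hcomp.measure_lt_top_of_nhdsWithin fun y0 hy0 => ?_
  obtain ⟨ρ, R, c, σ, k, h⟩ := exists_fchart hD hy0
  obtain ⟨K, hK⟩ := h.anti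
  refine ⟨frontier D ∩ Metric.ball y0 (R / 4), inter_mem_nhdsWithin _ (Metric.ball_mem_nhds _ (by
    have := h.Rpos; linarith)), ?_⟩
  set S := frontier D ∩ Metric.ball y0 (R / 4) with hS
  have hinj : InjOn (prj k) S := fun x hx y hy e => by
    have := hK x hx y hy
    rw [e, dist_self, mul_zero] at this
    exact dist_le_zero.1 this
  have hlip : LipschitzOnWith K (Function.invFunOn (prj k) S) (prj k '' S) := by
    refine LipschitzOnWith.of_dist_le_mul ?_
    rintro _ ⟨x, hx, rfl⟩ _ ⟨y, hy, rfl⟩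
    rw [hinj.leftInvOn_invFunOn hx, hinj.leftInvOn_invFunOn hy]
    exact hK x hx y hy
  have him : Function.invFunOn (prj k) S '' (prj k '' S) = S := hinj.invFunOn_image Subset.rfl
  have h1 := hlip.hausdorffMeasure_image_le (d := m) (by positivity)
  rw [him] at h1
  refine h1.trans_lt (ENNReal.mul_lt_top (ENNReal.rpow_lt_top_of_nonneg (by positivity) (by simp)) ?_)
  have h2 := hausdorffMeasure_pi_real (ι := Fin m)
  rw [Fintype.card_fin] at h2
  rw [h2]
  have hbd : Bornology.IsBounded (prj k '' S) :=
    (prj_lip k).isBounded_image (Metric.isBounded_ball.subset inter_subset_right)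
  exact hbd.measure_lt_top
end Part10

section Part11
open MeasureTheory Set
open scoped Topology RealInnerProductSpace Manifold ContDiff ENNReal NNReal
variable {m : ℕ}

/-- splitting off the coordinate `k` -/
def spl (k : Fin (m + 1)) : Eucl (m + 1) ≃ᵐ ℝ × (Fin m → ℝ) :=
  (MeasurableEquiv.toLp 2 (Fin (m + 1) → ℝ)).symm.trans
    (MeasurableEquiv.piFinSuccAbove (fun _ => ℝ) k)

lemma spl_mp (k : Fin (m + 1)) : MeasurePreserving (spl k) := by
  unfold spl
  exact (volume_preserving_piFinSuccAbove (fun _ => ℝ) k).comp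
    (EuclideanSpace.volume_preserving_symm_measurableEquiv_toLp (Fin (m + 1)))

lemma spl_apply (k : Fin (m + 1)) (y : Eucl (m + 1)) : spl k y = (y k, prj k y) := rfl

lemma prj_symm (k : Fin (m + 1)) (t : ℝ) (x' : Fin m → ℝ) :
    prj k ((spl k).symm (t, x')) = x' ∧ ((spl k).symm (t, x')) k = t := by
  have := (spl k).apply_symm_apply (t, x')
  rw [spl_apply, Prod.ext_iff] at this
  exact ⟨this.2, this.1⟩

lemma lintegral_spl (k : Fin (m + 1)) {F : Eucl (m + 1) → ℝ≥0∞} (hF : Measurable F) :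
    ∫⁻ y, F y = ∫⁻ x', ∫⁻ t, F ((spl k).symm (t, x')) := by
  have h1 := (spl_mp k).symm.lintegral_comp hF
  rw [← h1]
  rw [show (volume : Measure (ℝ × (Fin m → ℝ))) = (volume : Measure ℝ).prod volume from rfl]
  exact lintegral_prod_symm' _ (hF.comp (spl k).symm.measurable)

/-- Lebesgue measure of a projection is controlled by Hausdorff measure -/
lemma lintegral_prj_le (k : Fin (m + 1)) {S : Set (Eucl (m + 1))} (hS : IsCompact S)
    (H : (Fin m → ℝ) → ℝ≥0∞) :
    ∫⁻ x' in prj k '' S, H x' ≤ ∫⁻ y in S, H (prj k y) ∂μH[(m : ℝ)] := by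
  have hc : Continuous (prj k) := (prj_lip k).continuous
  refine le_trans (lintegral_mono' ?_ le_rfl) (lintegral_map_le H (prj k))
  refine Measure.le_iff.2 fun A hA => ?_
  rw [Measure.restrict_apply hA, Measure.map_apply hc.measurable hA,
    Measure.restrict_apply (hc.measurable hA)]
  have h2 := hausdorffMeasure_pi_real (ι := Fin m)
  rw [Fintype.card_fin] at h2
  rw [← h2]
  have h3 := (prj_lip k).hausdorffMeasure_image_le (d := m) (by positivity) (prj k ⁻¹' A ∩ S)
  simp only [ENNReal.coe_one, ENNReal.one_rpow, one_mul] at h3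
  refine le_trans (measure_mono ?_) h3
  rintro _ ⟨hA, y, hy, rfl⟩
  exact ⟨y, ⟨hA, hy⟩, rfl⟩

lemma layer {D : Set (Eucl (m + 1))} {y0 : Eucl (m + 1)} {ρ : Eucl (m + 1) → ℝ} {R c σ : ℝ}
    {k : Fin (m + 1)} (h : FChart D y0 ρ R c σ k) {f : Eucl (m + 1) → ℝ} (hf : Continuous f)
    (hf0 : ∀ x, 0 ≤ f x) {δ : ℝ} (hδ : 0 < δ) : ∃ η0 > 0, ∀ η, 0 < η → η < η0 →
    ∫⁻ x in Metric.closedBall y0 (R / 4) ∩ {x | -η < ρ x ∧ ρ x < 0}, ENNReal.ofReal (f x) ≤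
      ENNReal.ofReal (2 * η / c) *
        ∫⁻ x in frontier D ∩ Metric.closedBall y0 (R / 2), ENNReal.ofReal (f x + δ) ∂μH[(m : ℝ)] := by
  have hR := h.Rpos
  have hc := h.cpos
  have hρc : Continuous ρ := h.smooth.continuous
  have huc := (isCompact_closedBall y0 R).uniformContinuousOn_of_continuous hf.continuousOn
  rw [Metric.uniformContinuousOn_iff] at huc
  obtain ⟨τ, hτ, huc⟩ := huc δ hδ
  refine ⟨c * min (R / 8) (τ / 2), by positivity, fun η hη hη0 => ?_⟩
  have hq : η / c < min (R / 8) (τ / 2) := by rw [div_lt_iff₀ hc]; linarith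
  have hq1 : η / c < R / 8 := lt_of_lt_of_le hq (min_le_left _ _)
  have hq2 : η / c < τ / 2 := lt_of_lt_of_le hq (min_le_right _ _)
  have hq0 : 0 < η / c := by positivity
  set L := Metric.closedBall y0 (R / 4) ∩ {x | -η < ρ x ∧ ρ x < 0} with hL
  have hLm : MeasurableSet L := by
    refine measurableSet_closedBall.inter ?_
    exact ((isOpen_lt continuous_const hρc).inter (isOpen_lt hρc continuous_const)).measurableSet
  set S := frontier D ∩ Metric.closedBall y0 (R / 2) with hS
  have hSc : IsCompact S := (isCompact_closedBall y0 (R / 2)).inter_left isClosed_frontier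
  have hSR : ∀ y ∈ S, y ∈ Metric.ball y0 R := fun y hy =>
    Metric.closedBall_subset_ball (by linarith) hy.2
  have hSρ : ∀ y ∈ S, ρ y = 0 := fun y hy => (h.bdry y (hSR y hy)).1 hy.1
  have hLR : ∀ y ∈ L, y ∈ Metric.ball y0 R := fun y hy =>
    Metric.closedBall_subset_ball (by linarith) hy.1
  have hinj : InjOn (prj k) S := fun x hx y hy e => by
    have := h.unique (hSR x hx) (hSR y hy) e
    rw [hSρ x hx, hSρ y hy, sub_zero, abs_zero] at this
    have h0 : |y k - x k| = 0 := le_antisymm (by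
      by_contra hcon
      push Not at hcon
      nlinarith) (abs_nonneg _)
    have e2 := eq_of_prj e
    rw [abs_eq_zero.1 h0, zero_smul, add_zero] at e2
    exact e2.symm
  -- existence of the foot point
  have hfoot : ∀ y ∈ L, ∃ z ∈ S, prj k z = prj k y := by
    intro y hy
    have hyb : dist y y0 ≤ R / 4 := hy.1
    have hin : ∀ t ∈ Icc 0 (η / c), y + (σ * t) • EuclideanSpace.single k (1:ℝ) ∈
        Metric.closedBall y0 (R / 2) := by
      intro t ht
      have : dist (y + (σ * t) • EuclideanSpace.single k (1:ℝ)) y ≤ η / c := by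
        rw [dist_self_add_left, norm_smul]
        have : |σ| = 1 := by rcases h.sig with e | e <;> rw [e] <;> simp
        simp [this, abs_of_nonneg ht.1, ht.2]
      have h3 := dist_triangle (y + (σ * t) • EuclideanSpace.single k (1:ℝ)) y y0
      rw [Metric.mem_closedBall]
      linarith
    have hmem : (0:ℝ) ∈ Icc (ρ (y + (σ * 0) • EuclideanSpace.single k (1:ℝ)))
        (ρ (y + (σ * (η / c)) • EuclideanSpace.single k (1:ℝ))) := by
      have h4 := h.incr_sig (y := y) (t := η / c) hq0.le (hLR y hy)
        (Metric.closedBall_subset_ball (by linarith) (hin _ ⟨hq0.le, le_rfl⟩))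
      rw [mul_div_cancel₀ _ hc.ne'] at h4
      have h5 := hy.2.1
      have h6 := hy.2.2
      constructor
      · simpa using h6.le
      · linarith
    have hcont : ContinuousOn (fun t : ℝ => ρ (y + (σ * t) • EuclideanSpace.single k (1:ℝ)))
        (Icc 0 (η / c)) := by fun_prop
    obtain ⟨t, ht, ht0⟩ := intermediate_value_Icc hq0.le hcont hmem
    refine ⟨_, ⟨?_, hin t ht⟩, prj_add_single k y (σ * t)⟩
    exact (h.bdry _ (Metric.closedBall_subset_ball (by linarith) (hin t ht))).2 ht0
  classical
  set H : (Fin m → ℝ) → ℝ≥0∞ := fun x' =>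
    ENNReal.ofReal (f (Function.invFunOn (prj k) S x') + δ) with hH
  have hmeas : Measurable (L.indicator fun x => ENNReal.ofReal (f x)) :=
    (ENNReal.measurable_ofReal.comp hf.measurable).indicator hLm
  rw [← lintegral_indicator hLm, lintegral_spl k hmeas]
  have hslice : ∀ x', ∫⁻ t, L.indicator (fun x => ENNReal.ofReal (f x)) ((spl k).symm (t, x')) ≤
      (prj k '' S).indicator (fun x' => ENNReal.ofReal (2 * η / c) * H x') x' := by
    intro x'
    by_cases hx' : x' ∈ prj k '' S
    · rw [indicator_of_mem hx']
      obtain ⟨z, hz, rfl⟩ := hx'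
      have hHz : H (prj k z) = ENNReal.ofReal (f z + δ) := by
        simp only [hH]; rw [hinj.leftInvOn_invFunOn hz]
      rw [hHz]
      have hpt : ∀ t, L.indicator (fun x => ENNReal.ofReal (f x)) ((spl k).symm (t, prj k z)) ≤
          (Icc (z k - η / c) (z k + η / c)).indicator (fun _ => ENNReal.ofReal (f z + δ)) t := by
        intro t
        by_cases hy : (spl k).symm (t, prj k z) ∈ L
        · set y := (spl k).symm (t, prj k z) with hydef
          have hyp := prj_symm k t (prj k z)
          rw [← hydef] at hyp
          have h7 := h.unique (hLR y hy) (hSR z hz) hyp.1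
          rw [hSρ z hz, hyp.2, zero_sub, abs_neg, abs_of_neg hy.2.2] at h7
          have h8 : |z k - t| ≤ η / c := by
            rw [le_div_iff₀ hc]
            have := hy.2.1
            linarith
          have h9 := abs_le.1 h8
          have hdist : dist y z ≤ η / c := by
            have e := eq_of_prj hyp.1
            rw [hyp.2] at e
            rw [dist_comm, e, dist_self_add_left, norm_smul]
            simpa using h8
          rw [indicator_of_mem hy, indicator_of_mem (show t ∈ Icc _ _ from ⟨by linarith, by linarith⟩)]
          refine ENNReal.ofReal_le_ofReal ?_
          have := huc y (Metric.ball_subset_closedBall (hLR y hy)) z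
            (Metric.ball_subset_closedBall (hSR z hz)) (by linarith)
          rw [Real.dist_eq] at this
          have := (abs_lt.1 this).2
          linarith
        · rw [indicator_of_notMem hy]; exact zero_le
      refine (lintegral_mono hpt).trans (le_of_eq ?_)
      rw [lintegral_indicator measurableSet_Icc, setLIntegral_const, Real.volume_Icc, mul_comm]
      congr 2
      ring
    · rw [indicator_of_notMem hx']
      refine le_of_eq ?_
      rw [lintegral_eq_zero_of_ae_eq_zero]
      refine Filter.Eventually.of_forall fun t => ?_
      refine indicator_of_notMem (fun hy => hx' ?_) _
      obtain ⟨z, hz, e⟩ := hfoot _ hy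
      rw [(prj_symm k t x').1] at e
      exact ⟨z, hz, e⟩
  refine (lintegral_mono hslice).trans ?_
  have hpm : MeasurableSet (prj k '' S) := (hSc.image (prj_lip k).continuous).measurableSet
  rw [lintegral_indicator hpm, lintegral_const_mul' _ _ (by simp)]
  gcongr
  refine (lintegral_prj_le k hSc H).trans (le_of_eq ?_)
  refine setLIntegral_congr_fun hSc.measurableSet fun y hy => ?_
  simp only [hH]; rw [hinj.leftInvOn_invFunOn hy]
end Part11

section Part12
open MeasureTheory Set
open scoped Topology RealInnerProductSpace Manifold ContDiff ENNReal NNReal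

lemma FChart.shrink {n : ℕ} {D : Set (Eucl n)} {y0 : Eucl n} {ρ : Eucl n → ℝ} {R c σ : ℝ} {k : Fin n}
    (h : FChart D y0 ρ R c σ k) {R' : ℝ} (h0 : 0 < R') (hR : R' ≤ R) : FChart D y0 ρ R' c σ k :=
  ⟨h.smooth, h0, h.cpos, h.sig, fun y hy => h.inside y (Metric.ball_subset_ball hR hy),
    fun y hy => h.bdry y (Metric.ball_subset_ball hR hy),
    fun y hy => h.deriv_ge y (Metric.ball_subset_ball hR hy)⟩

lemma deriv_smoothTransition_zero {x : ℝ} (hx : x ≤ 0 ∨ 1 ≤ x) :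
    deriv Real.smoothTransition x = 0 := by
  rcases hx with hx | hx
  · refine IsLocalMin.deriv_eq_zero (Filter.Eventually.of_forall fun y => ?_)
    rw [Real.smoothTransition.zero_of_nonpos hx]
    exact Real.smoothTransition.nonneg y
  · refine IsLocalMax.deriv_eq_zero (Filter.Eventually.of_forall fun y => ?_)
    rw [Real.smoothTransition.one_of_one_le hx]
    exact Real.smoothTransition.le_one y

lemma deriv_smoothTransition_bound : ∃ C : ℝ, 0 < C ∧ ∀ x, |deriv Real.smoothTransition x| ≤ C := by
  have hc : Continuous (deriv Real.smoothTransition) :=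
    (Real.smoothTransition.contDiff (n := 1)).continuous_deriv le_rfl
  obtain ⟨C, hC⟩ := isCompact_Icc.exists_bound_of_continuousOn (s := Icc (0:ℝ) 1) hc.continuousOn
  refine ⟨|C| + 1, by positivity, fun x => ?_⟩
  by_cases hx : x ∈ Icc (0:ℝ) 1
  · have := hC x hx
    rw [Real.norm_eq_abs] at this
    linarith [le_abs_self C]
  · have : x ≤ 0 ∨ 1 ≤ x := by
      by_contra hcon
      push Not at hcon
      exact hx ⟨hcon.1.le, hcon.2.le⟩
    rw [deriv_smoothTransition_zero this]
    simp; positivity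

variable {m : ℕ} {a b : Fin (m + 1) → Fin (m + 1) → Eucl (m + 1) → ℝ}

lemma integrableOn_frontier {D : Set (Eucl (m + 1))} (hD : HasC4Boundary D)
    (hb : Bornology.IsBounded D) {f : Eucl (m + 1) → ℝ} (hf : ContinuousOn f (frontier D)) :
    IntegrableOn f (frontier D) μH[(m : ℝ)] := by
  have hcomp : IsCompact (frontier D) :=
    Metric.isCompact_of_isClosed_isBounded isClosed_frontier (hb.closure.subset frontier_subset_closure)
  have : IsFiniteMeasure ((μH[(m : ℝ)] : Measure (Eucl (m + 1))).restrict (frontier D)) :=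
    ⟨by rw [Measure.restrict_apply_univ]; exact frontier_measure_lt_top hD hb⟩
  obtain ⟨C, hC⟩ := hcomp.exists_bound_of_continuousOn hf
  refine Integrable.of_bound (hf.aestronglyMeasurable_of_isCompact hcomp hcomp.measurableSet) C ?_
  exact (ae_restrict_iff' hcomp.measurableSet).2 (Filter.Eventually.of_forall hC)

set_option maxHeartbeats 1600000 in
lemma good_start (hC : IsCoef a b) {B Ω : Set (Eucl (m + 1))} (hB : IsOpen B)
    (hΩb : Bornology.IsBounded Ω) (hΩ4 : HasC4Boundary Ω) (hΩB : closure Ω ⊆ B)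
    (hne : (frontier Ω).Nonempty) {P : ℝ} (hP : 0 ≤ P) :
    ∃ x0 ∈ B, Good a B P (fun v => ∫ x in frontier Ω, En v x ∂μH[(m : ℝ)]) x0 := by
  obtain ⟨y0, hy0⟩ := hne
  obtain ⟨ρ, R', c, σ, k, h'⟩ := exists_fchart hΩ4 hy0
  have hΓB : frontier Ω ⊆ B := frontier_subset_closure.trans hΩB
  obtain ⟨R'', hR'', hRB''⟩ := Metric.isOpen_iff.1 hB y0 (hΓB hy0)
  set R := min R' (R'' / 2) with hRdef
  have hR : 0 < R := lt_min h'.Rpos (by linarith)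
  have h := h'.shrink hR (min_le_left _ _)
  have hRB : Metric.closedBall y0 R ⊆ B := (Metric.closedBall_subset_ball (by
    have := min_le_right R' (R'' / 2); linarith)).trans hRB''
  have hc := h.cpos
  have hρ1 : ContDiff ℝ 1 ρ := h.smooth.of_le (by norm_num)
  have hρc : Continuous ρ := hρ1.continuous
  set t := R / 16 with ht
  have ht0 : 0 < t := by positivity
  set z := y0 + (σ * t) • EuclideanSpace.single k (1:ℝ) with hz
  have hzy : dist z y0 = t := by
    rw [hz, dist_self_add_left, norm_smul]
    have : |σ| = 1 := by rcases h.sig with e | e <;> rw [e] <;> simp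
    simp [this, abs_of_pos ht0]
  have hρy0 : ρ y0 = 0 := (h.bdry y0 (Metric.mem_ball_self hR)).1 hy0
  have hρz : 0 < ρ z := by
    have := h.incr_sig (y := y0) (t := t) ht0.le (Metric.mem_ball_self hR)
      (by rw [← hz, Metric.mem_ball, hzy]; linarith)
    rw [← hz, hρy0] at this
    nlinarith
  obtain ⟨s', hs', hs'ρ⟩ := Metric.isOpen_iff.1 (isOpen_lt continuous_const hρc) z hρz
  set s := min s' t with hs
  have hs0 : 0 < s := lt_min hs' ht0
  have hst : s ≤ t := min_le_right _ _
  have hsρ : ∀ x ∈ Metric.ball z s, 0 < ρ x := fun x hx =>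
    hs'ρ (Metric.ball_subset_ball (min_le_left _ _) hx)
  -- the good point
  obtain ⟨x0, hx0Ω, hx0y⟩ := Metric.mem_closure_iff.1 (frontier_subset_closure hy0) t ht0
  have hx0R : x0 ∈ Metric.ball y0 R := by rw [Metric.mem_ball, dist_comm]; linarith
  have hρx0 : ρ x0 < 0 := (h.inside x0 hx0R).1 hx0Ω
  set η1 := -ρ x0 / 2 with hη1
  have hη10 : 0 < η1 := by linarith
  have hx0z : x0 ∈ Metric.ball z (2 * t) := by
    have := dist_triangle x0 y0 z
    rw [Metric.mem_ball]
    rw [dist_comm y0 z, dist_comm x0 y0] at this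
    linarith
  have hopen : IsOpen (Metric.ball z (2 * t) ∩ {x | ρ x < -η1}) :=
    Metric.isOpen_ball.inter (isOpen_lt hρc continuous_const)
  obtain ⟨r', hr', hr'sub⟩ := Metric.isOpen_iff.1 hopen x0 ⟨hx0z, by
    show ρ x0 < -η1
    linarith⟩
  set r := r' / 2 with hr
  have hr0 : 0 < r := by positivity
  have hrsub : Metric.closedBall x0 r ⊆ Metric.ball z (2 * t) ∩ {x | ρ x < -η1} :=
    (Metric.closedBall_subset_ball (by linarith)).trans hr'sub
  have hzR : ∀ q, q ≤ 15 * t → Metric.closedBall z q ⊆ Metric.closedBall y0 R := fun q hq =>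
    Metric.closedBall_subset_closedBall' (by rw [hzy]; linarith)
  refine ⟨x0, hΩB (subset_closure hx0Ω), r, hr0, ?_, fun ε hε => ?_⟩
  · exact (hrsub.trans inter_subset_left).trans
      (Metric.ball_subset_closedBall.trans ((hzR _ (by linarith)).trans hRB))
  obtain ⟨Cc, hCc, Hc⟩ := caccioppoli hC z (R2 := 3 * t) (R3 := 4 * t) (by linarith) (by linarith) hP
  obtain ⟨C4, hC4, H4⟩ := step4 hC z (s := s) (R0 := 2 * t) (R1 := 5 / 2 * t) (R2 := 3 * t)
    hs0 (by linarith) (by linarith) (by linarith) hP (ε := ε / Cc) (by positivity)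
  obtain ⟨CT, hCT, HT⟩ := deriv_smoothTransition_bound
  obtain ⟨G, hG, HG⟩ := exists_bound (isCompact_closedBall z (3 * t)) (fun i : Fin (m + 1) => pd ρ i)
    (fun i => pd_continuous hρ1 i)
  set Q := ((m + 1 : ℕ) : ℝ) * (CT * G) with hQ
  have hQ0 : 0 ≤ Q := by positivity
  refine ⟨C4 * (Q * (2 / c)), by positivity, fun v hv M hM => ?_⟩
  set Γ := frontier Ω with hΓ
  set μ := (μH[(m : ℝ)] : Measure (Eucl (m + 1))) with hμ
  have hμΓ : μ Γ < ⊤ := frontier_measure_lt_top hΩ4 hΩb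
  obtain ⟨w, hw, hwv⟩ := hv.localise hB (K := Γ ∪ Metric.closedBall y0 R)
    (isClosed_frontier.union Metric.isClosed_closedBall) (union_subset hΓB hRB)
  have hEc := En_continuous (hw.of_le (by norm_num) : ContDiff ℝ 1 w)
  have hE0 := En_nonneg w
  have hΓm : MeasurableSet Γ := isClosed_frontier.measurableSet
  have hDint : IntegrableOn (En w) Γ μ := integrableOn_frontier hΩ4 hΩb hEc.continuousOn
  have hD : ∫ x in Γ, En v x ∂μ = ∫ x in Γ, En w x ∂μ :=
    setIntegral_congr_fun hΓm fun x hx => ((hwv x (Or.inl hx)).2.2.1).symm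
  have hBall : ∀ x ∈ Metric.closedBall z (4 * t), x ∈ Γ ∪ Metric.closedBall y0 R := fun x hx =>
    Or.inr (hzR _ (by linarith) hx)
  have g2 : ∫ y in Metric.closedBall z (3 * t), En w y ≤ Cc * M ^ 2 :=
    Hc w hw (fun x hx => (hwv x (hBall x hx)).2.2.2) M (fun y hy => by
      rw [(hwv y (hBall y hy)).2.1]
      exact hM y (hRB (hzR _ (by linarith) hy)))
  have g6 : ∫ y in Metric.ball x0 r, En v y = ∫ y in Metric.ball x0 r, En w y := by
    refine setIntegral_congr_fun measurableSet_ball fun y hy => ((hwv y (Or.inr ?_)).2.2.1).symm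
    exact hzR (2 * t) (by linarith)
      (Metric.ball_subset_closedBall (hrsub (Metric.ball_subset_closedBall hy)).1)
  beta_reduce
  rw [g6, hD]
  refine le_of_forall_pos_le_add fun δ' hδ' => ?_
  set δ := δ' / (C4 * (Q * (2 / c)) * μ.real Γ + 1) with hδ
  have hμr : 0 ≤ μ.real Γ := measureReal_nonneg
  have hδ0 : 0 < δ := by positivity
  obtain ⟨η0, hη0, hlay⟩ := layer h hEc hE0 hδ0
  set η := min η1 (η0 / 2) with hη
  have hηp : 0 < η := lt_min hη10 (by linarith)
  have hηη0 : η < η0 := lt_of_le_of_lt (min_le_right _ _) (by linarith)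
  have hlay := hlay η hηp hηη0
  set θ : Eucl (m + 1) → ℝ := fun x => Real.smoothTransition (-ρ x / η) with hθ
  have hθs : ContDiff ℝ 1 θ :=
    (Real.smoothTransition.contDiff (n := 1)).comp (hρ1.neg.div_const η)
  have g3 := H4 w hw (fun x hx => (hwv x (hBall x
      (Metric.closedBall_subset_closedBall (by linarith) hx))).2.2.2) θ hθs
    (fun x => Real.smoothTransition.nonneg _) (fun x => Real.smoothTransition.le_one _)
    (fun x hx => Real.smoothTransition.zero_of_nonpos
      (div_nonpos_of_nonpos_of_nonneg (by linarith [hsρ x hx]) hηp.le))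
  have ic : ∀ {f : Eucl (m + 1) → ℝ} (x : Eucl (m + 1)) (r : ℝ), Continuous f →
      IntegrableOn f (Metric.closedBall x r) :=
    fun x r hf => hf.continuousOn.integrableOn_compact (isCompact_closedBall x r)
  have hθE : Continuous (fun x => θ x * En w x) := hθs.continuous.mul hEc
  have g1 : ∫ y in Metric.ball x0 r, En w y ≤ ∫ y in Metric.ball z (2 * t), θ y * En w y := by
    have e1 : ∫ y in Metric.ball x0 r, En w y = ∫ y in Metric.ball x0 r, θ y * En w y := by
      refine setIntegral_congr_fun measurableSet_ball fun y hy => ?_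
      have h1 : ρ y < -η1 := (hrsub (Metric.ball_subset_closedBall hy)).2
      have h2 : η ≤ η1 := min_le_left _ _
      have : θ y = 1 := Real.smoothTransition.one_of_one_le (by
        rw [le_div_iff₀ hηp]; linarith)
      simp [this]
    rw [e1]
    refine setIntegral_mono_set ((ic z (2 * t) hθE).mono_set Metric.ball_subset_closedBall)
      (Filter.Eventually.of_forall fun x => mul_nonneg (Real.smoothTransition.nonneg _) (hE0 x)) ?_
    exact (Metric.ball_subset_closedBall.trans (hrsub.trans inter_subset_left)).eventuallyLE
  set L := Metric.closedBall y0 (R / 4) ∩ {x | -η < ρ x ∧ ρ x < 0} with hL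
  have hLm : MeasurableSet L := by
    refine measurableSet_closedBall.inter ?_
    exact ((isOpen_lt continuous_const hρc).inter (isOpen_lt hρc continuous_const)).measurableSet
  have hpd : ∀ x i, pd θ i x = deriv Real.smoothTransition (-ρ x / η) * (-(pd ρ i x) / η) := by
    intro x i
    have hd : DifferentiableAt ℝ ρ x := hρ1.differentiable (by norm_num) x
    have e : (fun x => -ρ x / η) = fun x => (-1 / η) * ρ x := by ext x; ring
    rw [hθ, pd_comp (f := Real.smoothTransition) (u := fun x => -ρ x / η)
      ((Real.smoothTransition.contDiff (n := 1)).differentiable (by norm_num) _)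
      (by rw [e]; exact hd.const_mul _)]
    rw [e, pd_const_mul _ hd]
    ring
  have hpt : ∀ x ∈ Metric.closedBall z (3 * t), (∑ i, |pd θ i x|) * En w x ≤
      L.indicator (fun x => Q / η * En w x) x := by
    intro x hx
    by_cases hxL : x ∈ L
    · rw [indicator_of_mem hxL]
      refine mul_le_mul_of_nonneg_right ?_ (hE0 x)
      calc ∑ i, |pd θ i x| ≤ ∑ _i : Fin (m + 1), CT * (G / η) := by
            refine Finset.sum_le_sum fun i _ => ?_
            rw [hpd, abs_mul, abs_div, abs_neg, abs_of_pos hηp]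
            have := HG i x hx
            gcongr
            exact HT _
        _ = _ := by rw [hQ]; simp; ring
    · rw [indicator_of_notMem hxL]
      have hx4 : x ∈ Metric.closedBall y0 (R / 4) := by
        have := dist_triangle x z y0
        rw [Metric.mem_closedBall] at hx ⊢
        linarith
      have hz0 : ∀ i, pd θ i x = 0 := by
        intro i
        rw [hpd, deriv_smoothTransition_zero, zero_mul]
        by_contra hcon
        push Not at hcon
        rw [div_pos_iff_of_pos_right hηp, div_lt_one hηp] at hcon
        exact hxL ⟨hx4, by constructor <;> linarith⟩
      simp [hz0]
  have hLint : IntegrableOn (En w) L := (ic y0 (R / 4) hEc).mono_set inter_subset_left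
  have g4 : ∫ x in Metric.closedBall z (3 * t), (∑ i, |pd θ i x|) * En w x ≤
      Q / η * ∫ x in L, En w x := by
    have hbc : Continuous (fun y => (∑ i, |pd θ i y|) * En w y) :=
      (continuous_finsetSum _ fun i _ => (pd_continuous hθs i).abs).mul hEc
    have hintg : Integrable (L.indicator (fun x => Q / η * En w x)) :=
      IntegrableOn.integrable_indicator (Integrable.const_mul hLint _) hLm
    rw [← integral_const_mul, ← integral_indicator hLm]
    refine (setIntegral_mono_on (ic _ _ hbc) hintg.integrableOn measurableSet_closedBall hpt).trans ?_
    refine setIntegral_le_integral hintg (Filter.Eventually.of_forall fun x => ?_)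
    exact indicator_nonneg (fun x _ => mul_nonneg (by positivity) (hE0 x)) x
  have : IsFiniteMeasure (μ.restrict Γ) := ⟨by rw [Measure.restrict_apply_univ]; exact hμΓ⟩
  have hDδ : IntegrableOn (fun x => En w x + δ) Γ μ := hDint.add (integrable_const δ)
  have g5 : ∫ x in L, En w x ≤ 2 * η / c * ((∫ x in Γ, En w x ∂μ) + δ * μ.real Γ) := by
    have e1 : ENNReal.ofReal (∫ x in L, En w x) = ∫⁻ x in L, ENNReal.ofReal (En w x) :=
      ofReal_integral_eq_lintegral_ofReal hLint (Filter.Eventually.of_forall hE0)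
    have e2 : ENNReal.ofReal (∫ x in Γ, (En w x + δ) ∂μ) = ∫⁻ x in Γ, ENNReal.ofReal (En w x + δ) ∂μ :=
      ofReal_integral_eq_lintegral_ofReal hDδ
        (Filter.Eventually.of_forall fun x => add_nonneg (hE0 x) hδ0.le)
    have e3 : ∫ x in Γ, (En w x + δ) ∂μ = (∫ x in Γ, En w x ∂μ) + δ * μ.real Γ := by
      rw [integral_add hDint (integrable_const δ), setIntegral_const, smul_eq_mul, mul_comm δ]
    rw [← e3]
    have hnn : 0 ≤ ∫ x in Γ, (En w x + δ) ∂μ := integral_nonneg fun x => add_nonneg (hE0 x) hδ0.le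
    rw [← ENNReal.ofReal_le_ofReal_iff (by positivity), ENNReal.ofReal_mul (by positivity), e1, e2]
    refine hlay.trans ?_
    gcongr
    exact inter_subset_left
  set I := ∫ x in Γ, En w x ∂μ with hI
  have g7 : ε / Cc * ∫ y in Metric.closedBall z (3 * t), En w y ≤ ε * M ^ 2 := by
    calc _ ≤ ε / Cc * (Cc * M ^ 2) := by gcongr
      _ = _ := by field_simp
  have g8 : Q / η * ∫ x in L, En w x ≤ Q * (2 / c) * (I + δ * μ.real Γ) := by
    calc _ ≤ Q / η * (2 * η / c * (I + δ * μ.real Γ)) := by gcongr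
      _ = _ := by field_simp
  have g9 : C4 * (Q * (2 / c)) * (δ * μ.real Γ) ≤ δ' := by
    have : δ' = δ * (C4 * (Q * (2 / c)) * μ.real Γ + 1) := by
      rw [hδ, div_mul_cancel₀]; positivity
    rw [this]
    have e : δ * (C4 * (Q * (2 / c)) * μ.real Γ + 1) = C4 * (Q * (2 / c)) * (δ * μ.real Γ) + δ := by
      ring
    linarith
  calc _ ≤ _ := g1
    _ ≤ _ := g3
    _ ≤ C4 * (Q * (2 / c) * (I + δ * μ.real Γ)) + ε * M ^ 2 := by
        refine add_le_add (mul_le_mul_of_nonneg_left (g4.trans g8) hC4.le) g7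
    _ ≤ _ := by linarith
end Part12

section Part13
open MeasureTheory Set
open scoped Topology RealInnerProductSpace Manifold ContDiff ENNReal NNReal
variable {n : ℕ} {a b : Fin n → Fin n → Eucl n → ℝ}

lemma hasDerivAt_max_pow (k : ℕ) (t : ℝ) :
    HasDerivAt (fun t : ℝ => (max 0 t) ^ (k + 2)) (((k + 2 : ℕ) : ℝ) * (max 0 t) ^ (k + 1)) t := by
  rcases lt_trichotomy t 0 with ht | rfl | ht
  · have : (fun t : ℝ => (max 0 t) ^ (k + 2)) =ᶠ[𝓝 t] fun _ => 0 := by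
      filter_upwards [gt_mem_nhds ht] with s hs
      rw [max_eq_left hs.le]; simp
    rw [max_eq_left ht.le]
    simpa using (hasDerivAt_const t (0:ℝ)).congr_of_eventuallyEq this
  · rw [hasDerivAt_iff_isLittleO]
    simp only [max_self, sub_zero, ne_eq, Nat.add_eq_zero_iff, OfNat.ofNat_ne_zero, one_ne_zero,
      and_false, not_false_eq_true, zero_pow, mul_zero, smul_zero]
    refine Asymptotics.IsBigO.trans_isLittleO (g := fun x : ℝ => x ^ (k + 2)) ?_ ?_
    · refine Asymptotics.IsBigO.of_bound 1 (Filter.Eventually.of_forall fun x => ?_)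
      rw [one_mul, norm_pow, norm_pow]
      gcongr
      rw [Real.norm_eq_abs, Real.norm_eq_abs, abs_of_nonneg (le_max_left _ _)]
      exact max_le (abs_nonneg x) (le_abs_self x)
    · have := Asymptotics.isLittleO_pow_pow (𝕜 := ℝ) (m := 1) (n := k + 2) (by omega)
      simpa using this
  · have : (fun t : ℝ => (max 0 t) ^ (k + 2)) =ᶠ[𝓝 t] fun t => t ^ (k + 2) := by
      filter_upwards [lt_mem_nhds ht] with s hs
      rw [max_eq_right hs.le]
    rw [max_eq_right ht.le]
    exact (hasDerivAt_pow (k + 2) t).congr_of_eventuallyEq this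

lemma contDiff_max_pow (k : ℕ) : ContDiff ℝ 1 (fun t : ℝ => (max 0 t) ^ (k + 2)) := by
  rw [contDiff_one_iff_deriv]
  refine ⟨fun t => (hasDerivAt_max_pow k t).differentiableAt, ?_⟩
  have : deriv (fun t : ℝ => (max 0 t) ^ (k + 2)) =
      fun t => ((k + 2 : ℕ) : ℝ) * (max 0 t) ^ (k + 1) := by
    ext t; exact (hasDerivAt_max_pow k t).deriv
  rw [this]; fun_prop

def ell (β : Fin n → Fin n → ℝ) (j : Fin n) (z : Eucl n) : ℝ := ∑ k, β j k * z k
def qz (β : Fin n → Fin n → ℝ) (z : Eucl n) : ℝ := ∑ j, z j * ell β j z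
def ff (β : Fin n → Fin n → ℝ) (κ : ℝ) (z : Eucl n) : ℝ := max 0 (1 - κ * qz β z)

lemma coord_contDiff {m : WithTop ℕ∞} (k : Fin n) : ContDiff ℝ m (fun z : Eucl n => z k) :=
  (EuclideanSpace.proj k : Eucl n →L[ℝ] ℝ).contDiff

lemma pd_coord (k i : Fin n) (z : Eucl n) : pd (fun z : Eucl n => z k) i z = if k = i then 1 else 0 := by
  unfold pd
  have : fderiv ℝ (fun z : Eucl n => z k) z = EuclideanSpace.proj k :=
    (EuclideanSpace.proj k : Eucl n →L[ℝ] ℝ).fderiv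
  rw [this]
  simp [Pi.single_apply]

lemma ell_contDiff {m : WithTop ℕ∞} (β : Fin n → Fin n → ℝ) (j : Fin n) : ContDiff ℝ m (ell β j) := by
  unfold ell
  exact ContDiff.sum fun k _ => contDiff_const.mul (coord_contDiff k)

lemma qz_contDiff {m : WithTop ℕ∞} (β : Fin n → Fin n → ℝ) : ContDiff ℝ m (qz β) := by
  unfold qz
  exact ContDiff.sum fun k _ => (coord_contDiff k).mul (ell_contDiff β k)

lemma pd_ell (β : Fin n → Fin n → ℝ) (j i : Fin n) (z : Eucl n) : pd (ell β j) i z = β j i := by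
  have hd : ∀ k, DifferentiableAt ℝ (fun z : Eucl n => z k) z := fun k =>
    (coord_contDiff (m := 1) k).differentiable (by norm_num) z
  unfold ell
  rw [pd_sum _ (fun k => (hd k).const_mul _)]
  simp_rw [fun k => pd_const_mul (β j k) (hd k) i, pd_coord]
  simp

lemma pd_qz {β : Fin n → Fin n → ℝ} (hβ : ∀ i j, β i j = β j i) (i : Fin n) (z : Eucl n) :
    pd (qz β) i z = 2 * ell β i z := by
  have hd : ∀ k, DifferentiableAt ℝ (fun z : Eucl n => z k) z := fun k =>
    (coord_contDiff (m := 1) k).differentiable (by norm_num) z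
  have he : ∀ k, DifferentiableAt ℝ (ell β k) z := fun k =>
    (ell_contDiff (m := 1) β k).differentiable (by norm_num) z
  unfold qz
  rw [pd_sum _ (fun k => show DifferentiableAt ℝ (fun z : Eucl n => z k * ell β k z) z from (hd k).mul (he k))]
  simp_rw [fun k => pd_mul (hd k) (he k) i, pd_coord, pd_ell]
  rw [Finset.sum_add_distrib]
  simp only [ite_mul, one_mul, zero_mul, Finset.sum_ite_eq', Finset.mem_univ, if_true]
  have : ∑ x, z.ofLp x * β x i = ell β i z := by
    unfold ell
    exact Finset.sum_congr rfl fun k _ => by rw [hβ i k, mul_comm]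
  rw [this]; ring

lemma ff_pow_contDiff (β : Fin n → Fin n → ℝ) (κ : ℝ) (k : ℕ) :
    ContDiff ℝ 1 (fun z => ff β κ z ^ (k + 2)) :=
  (contDiff_max_pow k).comp (contDiff_const.sub (contDiff_const.mul (qz_contDiff β)))

lemma pd_ff_pow {β : Fin n → Fin n → ℝ} (hβ : ∀ i j, β i j = β j i) (κ : ℝ) (k : ℕ) (i : Fin n)
    (z : Eucl n) : pd (fun z => ff β κ z ^ (k + 2)) i z =
      ((k + 2 : ℕ) : ℝ) * ff β κ z ^ (k + 1) * (-(2 * κ * ell β i z)) := by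
  have hq : DifferentiableAt ℝ (qz β) z := (qz_contDiff (m := 1) β).differentiable (by norm_num) z
  have h := pd_comp (f := fun t : ℝ => (max 0 t) ^ (k + 2)) (u := fun z => 1 - κ * qz β z) (x := z)
    (hasDerivAt_max_pow k _).differentiableAt ((hq.const_mul κ).const_sub 1) i
  rw [(hasDerivAt_max_pow k _).deriv] at h
  unfold ff
  rw [h, pd_sub (differentiableAt_const _) (hq.const_mul κ), pd_const, pd_const_mul _ hq, pd_qz hβ]
  ring

lemma ff_nonneg (β : Fin n → Fin n → ℝ) (κ : ℝ) (z : Eucl n) : 0 ≤ ff β κ z := le_max_left _ _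

lemma ff_continuous (β : Fin n → Fin n → ℝ) (κ : ℝ) : Continuous (ff β κ) := by
  unfold ff
  have := (qz_contDiff (m := 0) β).continuous
  fun_prop

lemma pd_affine {f : Eucl n → ℝ} {y z : Eucl n} {s : ℝ} (hf : DifferentiableAt ℝ f (y + s • z))
    (i : Fin n) : pd (fun z => f (y + s • z)) i z = s * pd f i (y + s • z) := by
  have h1 : HasFDerivAt (fun z : Eucl n => y + s • z) (s • ContinuousLinearMap.id ℝ (Eucl n)) z :=
    ((hasFDerivAt_id z).const_smul s).const_add y
  have h2 := (hf.hasFDerivAt.comp z h1).fderiv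
  unfold pd
  change fderiv ℝ (f ∘ fun z => y + s • z) z _ = _
  rw [h2]
  simp

/-- the key integration by parts for frozen coefficients -/
lemma frozen_identity (hC : IsCoef a b) {w : Eucl n → ℝ} (hw : ContDiff ℝ 2 w) (y : Eucl n) {κ s : ℝ}
    (hκ : 0 < κ) (hs : 0 < s) (hcs : HasCompactSupport (ff (fun i j => b i j y) κ)) :
    ∫ z, (∑ i, pd w i (y + s • z) * z i) * ff (fun i j => b i j y) κ z ^ 2 =
      ∫ z, (s * (Lop a w (y + s • z) * (ff (fun i j => b i j y) κ z ^ 3 / (6 * κ))) +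
        ∑ i, ∑ j, w (y + s • z) * (pd (a i j) i (y + s • z)
            * (ff (fun i j => b i j y) κ z ^ 2 * ell (fun i j => b i j y) j z)
          + (a i j (y + s • z) - a i j y) / s *
            (ff (fun i j => b i j y) κ z ^ 2 * b j i y
              - 4 * κ * ff (fun i j => b i j y) κ z * ell (fun i j => b i j y) i z
                * ell (fun i j => b i j y) j z))) := by
  set β : Fin n → Fin n → ℝ := fun i j => b i j y with hβdef
  have hβ : ∀ i j, β i j = β j i := fun i j => hC.bsymm i j y
  set f := ff β κ with hfdef
  have haff : ∀ {k : WithTop ℕ∞}, ContDiff ℝ k (fun z : Eucl n => y + s • z) := fun {k} =>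
    contDiff_const.add (contDiff_const_smul s)
  have hf2 : ContDiff ℝ 1 (fun z => f z ^ 2) := ff_pow_contDiff β κ 0
  have hf3 : ContDiff ℝ 1 (fun z => f z ^ 3) := ff_pow_contDiff β κ 1
  have hcs2 : HasCompactSupport (fun z => f z ^ 2) := hcs.comp_left (g := fun t : ℝ => t ^ 2) (by simp)
  have hcs3 : HasCompactSupport (fun z => f z ^ 3) := hcs.comp_left (g := fun t : ℝ => t ^ 3) (by simp)
  have hfc : Continuous f := ff_continuous β κ
  have hwc : Continuous fun z => w (y + s • z) := hw.continuous.comp (haff (k := 0)).continuous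
  have hac : Continuous fun z : Eucl n => y + s • z := (haff (k := 0)).continuous
  have hpwc : ∀ i, Continuous fun z => pd w i (y + s • z) := fun i =>
    (pd_continuous (hw.of_le (by norm_num)) i).comp hac
  have hacoef : ∀ i j, Continuous fun z => a i j (y + s • z) := fun i j =>
    (hC.smooth i j).continuous.comp hac
  have hel : ∀ j, Continuous (ell β j) := fun j => (ell_contDiff (m := 0) β j).continuous
  -- integrability helper
  have int2 : ∀ {g : Eucl n → ℝ}, Continuous g → Integrable fun z => g z * f z ^ 2 := fun hg =>
    (hg.mul (hfc.pow 2)).integrable_of_hasCompactSupport (hcs2.mul_left)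
  -- Step 1: pointwise algebra
  have alg : ∀ z, (∑ i, pd w i (y + s • z) * z i) * f z ^ 2 =
      (∑ i, flux a w i (y + s • z) * (f z ^ 2 * ell β i z))
      + ∑ i, ∑ j, (-(a i j (y + s • z) - a i j y) * (f z ^ 2 * ell β j z)) * pd w i (y + s • z) := by
    intro z
    have h1 : ∀ i, ∑ j, a i j y * ell β j z = z i := by
      intro i
      unfold ell
      simp_rw [Finset.mul_sum]
      rw [Finset.sum_comm]
      have : ∀ k, ∑ j, a i j y * (β j k * z k) = (if i = k then 1 else 0) * z k := fun k => by
        rw [← hC.inv i k y, Finset.sum_mul]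
        exact Finset.sum_congr rfl fun j _ => by simp only [hβdef]; ring
      simp_rw [this]
      simp
    have h2 : ∑ i, flux a w i (y + s • z) * (f z ^ 2 * ell β i z) =
        ∑ i, ∑ j, a i j (y + s • z) * pd w i (y + s • z) * (f z ^ 2 * ell β j z) := by
      unfold flux
      simp_rw [Finset.sum_mul]
      rw [Finset.sum_comm]
      refine Finset.sum_congr rfl fun i _ => Finset.sum_congr rfl fun j _ => ?_
      rw [hC.symm j i]
    rw [h2, ← Finset.sum_add_distrib, Finset.sum_mul]
    refine Finset.sum_congr rfl fun i _ => ?_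
    rw [← Finset.sum_add_distrib]
    conv_lhs => rw [← h1 i]
    rw [Finset.mul_sum, Finset.sum_mul]
    refine Finset.sum_congr rfl fun j _ => ?_
    ring
  -- Step 2: flux term
  have hfl : ∀ i, ContDiff ℝ 1 (flux a w i) := fun i => flux_contDiff hC hw (by norm_num) (by norm_num) i
  have stepA : ∀ i, ∫ z, flux a w i (y + s • z) * (f z ^ 2 * ell β i z) =
      ∫ z, s * pd (flux a w i) i (y + s • z) * (f z ^ 3 / (6 * κ)) := by
    intro i
    have h := ibp (F := fun z => flux a w i (y + s • z)) (θ := fun z => 1 / (6 * κ) * f z ^ 3)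
      ((hfl i).comp haff) (contDiff_const.mul hf3) hcs3.mul_left i
    have e1 : ∀ z, pd (fun z => 1 / (6 * κ) * f z ^ 3) i z = -(f z ^ 2 * ell β i z) := by
      intro z
      rw [pd_const_mul _ (hf3.differentiable (by norm_num) z), hfdef, pd_ff_pow hβ κ 1 i z]
      push_cast
      field_simp
      ring
    have e2 : ∀ z, pd (fun z => flux a w i (y + s • z)) i z = s * pd (flux a w i) i (y + s • z) :=
      fun z => pd_affine ((hfl i).differentiable (by norm_num) _) i
    simp_rw [e1, e2, mul_neg, integral_neg, neg_neg] at h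
    rw [← h]
    congr 1; ext z; ring
  -- Step 3: perturbation term
  have stepB : ∀ i j, ∫ z, (-(a i j (y + s • z) - a i j y) * (f z ^ 2 * ell β j z)) * pd w i (y + s • z) =
      ∫ z, w (y + s • z) * (pd (a i j) i (y + s • z) * (f z ^ 2 * ell β j z)
          + (a i j (y + s • z) - a i j y) / s *
            (f z ^ 2 * b j i y - 4 * κ * f z * ell β i z * ell β j z)) := by
    intro i j
    have ha1 : ContDiff ℝ 1 (a i j) := (hC.smooth i j).of_le (by norm_num)
    have hθa : ContDiff ℝ 1 (fun z => a i j (y + s • z) - a i j y) :=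
      (ha1.comp haff).sub contDiff_const
    have hθb : ContDiff ℝ 1 (fun z => f z ^ 2 * ell β j z) := hf2.mul (ell_contDiff β j)
    have h := ibp (F := fun z => w (y + s • z))
      (θ := fun z => (a i j (y + s • z) - a i j y) * (f z ^ 2 * ell β j z))
      ((hw.of_le (by norm_num)).comp haff) (hθa.mul hθb) (hcs2.mul_right.mul_left) i
    have e2 : ∀ z, pd (fun z => w (y + s • z)) i z = s * pd w i (y + s • z) :=
      fun z => pd_affine ((hw.of_le (by norm_num) : ContDiff ℝ 1 w).differentiable (by norm_num) _) i
    have e1 : ∀ z, pd (fun z => (a i j (y + s • z) - a i j y) * (f z ^ 2 * ell β j z)) i z =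
        s * (pd (a i j) i (y + s • z) * (f z ^ 2 * ell β j z)
          + (a i j (y + s • z) - a i j y) / s *
            (f z ^ 2 * b j i y - 4 * κ * f z * ell β i z * ell β j z)) := by
      intro z
      have d1 := hθa.differentiable (by norm_num) z
      have d2 := hf2.differentiable (by norm_num) z
      have d3 := (ell_contDiff (m := 1) β j).differentiable (by norm_num) z
      have da : DifferentiableAt ℝ (fun z => a i j (y + s • z)) z :=
        (ha1.comp haff).differentiable (by norm_num) z
      have d23 : DifferentiableAt ℝ (fun z => f z ^ 2 * ell β j z) z := d2.mul d3
      rw [pd_mul d1 d23, pd_mul d2 d3, pd_ell,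
        pd_sub da (differentiableAt_const _), pd_const,
        pd_affine (ha1.differentiable (by norm_num) _), hfdef, pd_ff_pow hβ κ 0 i z]
      push_cast
      simp only [hβdef]
      field_simp
      ring
    simp_rw [e1, e2] at h
    have l1 : ∫ z, s * pd w i (y + s • z) * ((a i j (y + s • z) - a i j y) * (f z ^ 2 * ell β j z)) =
        -s * ∫ z, (-(a i j (y + s • z) - a i j y) * (f z ^ 2 * ell β j z)) * pd w i (y + s • z) := by
      rw [← integral_const_mul]; congr 1; ext z; ring
    have l2 : ∫ z, w (y + s • z) * (s * (pd (a i j) i (y + s • z) * (f z ^ 2 * ell β j z)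
          + (a i j (y + s • z) - a i j y) / s *
            (f z ^ 2 * b j i y - 4 * κ * f z * ell β i z * ell β j z))) =
        s * ∫ z, w (y + s • z) * (pd (a i j) i (y + s • z) * (f z ^ 2 * ell β j z)
          + (a i j (y + s • z) - a i j y) / s *
            (f z ^ 2 * b j i y - 4 * κ * f z * ell β i z * ell β j z)) := by
      rw [← integral_const_mul]; congr 1; ext z; ring
    rw [l1, l2] at h
    have : s * (∫ z, (-(a i j (y + s • z) - a i j y) * (f z ^ 2 * ell β j z)) * pd w i (y + s • z)) =
      s * ∫ z, w (y + s • z) * (pd (a i j) i (y + s • z) * (f z ^ 2 * ell β j z)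
          + (a i j (y + s • z) - a i j y) / s *
            (f z ^ 2 * b j i y - 4 * κ * f z * ell β i z * ell β j z)) := by linarith
    exact mul_left_cancel₀ hs.ne' this
  -- integrability
  have iA : ∀ i, Integrable fun z => flux a w i (y + s • z) * (f z ^ 2 * ell β i z) := by
    intro i
    have := int2 (g := fun z => flux a w i (y + s • z) * ell β i z)
      (((hfl i).continuous.comp hac).mul (hel i))
    refine this.congr (Filter.Eventually.of_forall fun z => ?_)
    ring
  have iB : ∀ i j, Integrable fun z =>
      (-(a i j (y + s • z) - a i j y) * (f z ^ 2 * ell β j z)) * pd w i (y + s • z) := by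
    intro i j
    have := int2 (g := fun z => (-(a i j (y + s • z) - a i j y) * ell β j z) * pd w i (y + s • z))
      ((((hacoef i j).sub continuous_const).neg.mul (hel j)).mul (hpwc i))
    refine this.congr (Filter.Eventually.of_forall fun z => ?_)
    ring
  have iA' : ∀ i, Integrable fun z => s * pd (flux a w i) i (y + s • z) * (f z ^ 3 / (6 * κ)) := by
    intro i
    refine Continuous.integrable_of_hasCompactSupport ?_ ?_
    · have := (pd_continuous (hfl i) i).comp hac
      have h2 : Continuous fun z => pd (flux a w i) i (y + s • z) := this
      fun_prop
    · exact HasCompactSupport.mul_left (hcs.comp_left (g := fun t : ℝ => t ^ 3 / (6 * κ)) (by simp))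
  have iB' : ∀ i j, Integrable fun z => w (y + s • z) * (pd (a i j) i (y + s • z) * (f z ^ 2 * ell β j z)
          + (a i j (y + s • z) - a i j y) / s *
            (f z ^ 2 * b j i y - 4 * κ * f z * ell β i z * ell β j z)) := by
    intro i j
    have h2 : Continuous fun z => pd (a i j) i (y + s • z) :=
      (pd_continuous ((hC.smooth i j).of_le (by norm_num)) i).comp hac
    have h3 := hacoef i j
    have h4 := hel i
    have h5 := hel j
    have : Continuous fun z => w (y + s • z) * (pd (a i j) i (y + s • z) * (f z * ell β j z)
          + (a i j (y + s • z) - a i j y) / s *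
            (f z * b j i y - 4 * κ * ell β i z * ell β j z)) := by
      exact hwc.mul ((h2.mul (hfc.mul h5)).add (((h3.sub continuous_const).div_const s).mul
        ((hfc.mul continuous_const).sub ((continuous_const.mul h4).mul h5))))
    refine ((this.mul hfc).integrable_of_hasCompactSupport hcs.mul_left).congr
      (Filter.Eventually.of_forall fun z => ?_)
    simp only [Pi.mul_apply]
    ring
  simp_rw [alg]
  rw [integral_add (integrable_finsetSum _ fun i _ => iA i)
    (integrable_finsetSum _ fun i _ => integrable_finsetSum _ fun j _ => iB i j),
    integral_finsetSum _ (fun i _ => iA i),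
    integral_finsetSum _ (fun i _ => integrable_finsetSum _ fun j _ => iB i j)]
  simp_rw [fun i => integral_finsetSum Finset.univ (fun j _ => iB i j), stepA, stepB]
  have eL : ∀ z, s * (Lop a w (y + s • z) * (f z ^ 3 / (6 * κ))) =
      ∑ i, s * pd (flux a w i) i (y + s • z) * (f z ^ 3 / (6 * κ)) := by
    intro z
    unfold Lop
    rw [Finset.sum_mul, Finset.mul_sum]
    exact Finset.sum_congr rfl fun i _ => by ring
  simp_rw [eL]
  rw [integral_add (integrable_finsetSum _ fun i _ => iA' i)
    (integrable_finsetSum _ fun i _ => integrable_finsetSum _ fun j _ => iB' i j),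
    integral_finsetSum _ (fun i _ => iA' i),
    integral_finsetSum _ (fun i _ => integrable_finsetSum _ fun j _ => iB' i j)]
  simp_rw [fun i => integral_finsetSum Finset.univ (fun j _ => iB' i j)]
end Part13

section Part14
open MeasureTheory Set
open scoped Topology RealInnerProductSpace Manifold ContDiff ENNReal NNReal
variable {n : ℕ} {a b : Fin n → Fin n → Eucl n → ℝ}

lemma qz_pos (hC : IsCoef a b) (y : Eucl n) {ξ : Fin n → ℝ} (hξ : ξ ≠ 0) :
    0 < ∑ j, ξ j * ∑ k, b j k y * ξ k := by
  set η : Fin n → ℝ := fun j => ∑ k, b j k y * ξ k with hη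
  have h1 : ∀ i, ∑ j, a i j y * η j = ξ i := by
    intro i
    simp only [hη]
    simp_rw [Finset.mul_sum]
    rw [Finset.sum_comm]
    have : ∀ k, ∑ j, a i j y * (b j k y * ξ k) = (if i = k then 1 else 0) * ξ k := fun k => by
      rw [← hC.inv i k y, Finset.sum_mul]
      exact Finset.sum_congr rfl fun j _ => by ring
    simp_rw [this]
    simp
  have hη0 : η ≠ 0 := by
    intro h
    apply hξ
    ext i
    rw [← h1 i, h]; simp
  have := hC.pos y η hη0
  convert this using 1
  refine Finset.sum_congr rfl fun i _ => ?_
  rw [← h1 i, Finset.sum_mul]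
  exact Finset.sum_congr rfl fun j _ => by simp only [hη]; ring

lemma qz_bounds (hC : IsCoef a b) {K : Set (Eucl n)} (hK : IsCompact K) :
    ∃ c C : ℝ, 0 < c ∧ 1 ≤ C ∧ ∀ y ∈ K, ∀ z : Eucl n, c * ‖z‖ ^ 2 ≤ qz (fun i j => b i j y) z ∧
      qz (fun i j => b i j y) z ≤ C * ‖z‖ ^ 2 := by
  have hF : Continuous (fun q : Eucl n × (Fin n → ℝ) => ∑ j, q.2 j * ∑ k, b j k q.1 * q.2 k) := by
    have := hC.bcont
    fun_prop
  have hh : ∀ (x : Eucl n) (s : ℝ) (ξ : Fin n → ℝ), (∑ j, (s • ξ) j * ∑ k, b j k x * (s • ξ) k) =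
      s ^ 2 * ∑ j, ξ j * ∑ k, b j k x * ξ k := by
    intro x s ξ
    simp_rw [Finset.mul_sum, Pi.smul_apply, smul_eq_mul]
    refine Finset.sum_congr rfl fun i _ => Finset.sum_congr rfl fun j _ => by ring
  obtain ⟨c, hc, h1⟩ := qform_lower hK (F := fun x ξ => ∑ j, ξ j * ∑ k, b j k x * ξ k) hF hh
    (fun x ξ h => qz_pos hC x h)
  obtain ⟨C, hC1, h2⟩ := qform_upper hK (F := fun x ξ => ∑ j, ξ j * ∑ k, b j k x * ξ k) hF hh
  refine ⟨c, C, hc, hC1, fun y hy z => ?_⟩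
  have e : ‖z‖ ^ 2 = ∑ i, z i ^ 2 := by
    rw [EuclideanSpace.norm_sq_eq]; simp
  rw [e]
  exact ⟨h1 y hy (fun i => z i), (le_abs_self _).trans (h2 y hy (fun i => z i))⟩

lemma sum_pd_mul {w : Eucl n → ℝ} (x z : Eucl n) :
    fderiv ℝ w x z = ∑ i, pd w i x * z i := by
  have : z = ∑ i, z i • EuclideanSpace.single i (1:ℝ) := by
    ext j; simp [Pi.single_apply]
  conv_lhs => rw [this]
  rw [map_sum]
  refine Finset.sum_congr rfl fun i _ => ?_
  rw [map_smul, smul_eq_mul, mul_comm]; rfl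

lemma I_deriv {w φ : Eucl n → ℝ} (hw : ContDiff ℝ 2 w) (hφ : Continuous φ) (hc : HasCompactSupport φ)
    (y : Eucl n) (s : ℝ) :
    HasDerivAt (fun s => ∫ z, w (y + s • z) * φ z) (∫ z, (∑ i, pd w i (y + s • z) * z i) * φ z) s := by
  have hpc := fun i => pd_continuous (hw.of_le (by norm_num) : ContDiff ℝ 1 w) i
  have hcont : Continuous fun q : ℝ × Eucl n => (∑ i, pd w i (y + q.1 • q.2) * q.2 i) * φ q.2 := by
    have : ∀ i, Continuous fun q : ℝ × Eucl n => pd w i (y + q.1 • q.2) := fun i =>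
      (hpc i).comp (by fun_prop)
    fun_prop
  obtain ⟨C, hC⟩ := ((isCompact_closedBall s 1).prod hc).exists_bound_of_continuousOn
    (f := fun q : ℝ × Eucl n => (∑ i, pd w i (y + q.1 • q.2) * q.2 i) * φ q.2) hcont.continuousOn
  refine (hasDerivAt_integral_of_dominated_loc_of_deriv_le (s := Metric.closedBall s 1)
    (F := fun s z => w (y + s • z) * φ z)
    (F' := fun s z => (∑ i, pd w i (y + s • z) * z i) * φ z)
    (bound := (tsupport φ).indicator fun _ => C)
    (Metric.closedBall_mem_nhds s one_pos) ?_ ?_ ?_ ?_ ?_ ?_).2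
  · refine Filter.Eventually.of_forall fun t => ?_
    exact ((hw.continuous.comp (by fun_prop : Continuous fun z : Eucl n => y + t • z)).mul
      hφ).aestronglyMeasurable
  · exact ((hw.continuous.comp (by fun_prop : Continuous fun z : Eucl n => y + s • z)).mul
      hφ).integrable_of_hasCompactSupport hc.mul_left
  · exact (hcont.comp (by fun_prop : Continuous fun z : Eucl n => (s, z))).aestronglyMeasurable
  · refine Filter.Eventually.of_forall fun z t ht => ?_
    by_cases hz : z ∈ tsupport φ
    · rw [indicator_of_mem hz]
      exact hC (t, z) ⟨ht, hz⟩
    · rw [indicator_of_notMem hz, image_eq_zero_of_notMem_tsupport hz]; simp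
  · exact (integrable_indicator_iff (isClosed_tsupport φ).measurableSet).2
      (integrableOn_const hc.measure_lt_top.ne)
  · refine Filter.Eventually.of_forall fun z t _ => ?_
    have h1 : HasDerivAt (fun t : ℝ => y + t • z) z t := by
      simpa using ((hasDerivAt_id t).smul_const z).const_add y
    have h2 := ((hw.differentiable (by norm_num) (y + t • z)).hasFDerivAt.comp_hasDerivAt t h1).mul_const
      (φ z)
    rw [sum_pd_mul] at h2
    exact h2

lemma lip_on_ball {f : Eucl n → ℝ} (hf : ContDiff ℝ 1 f) (ρ : ℝ) : ∃ G : ℝ, 0 ≤ G ∧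
    ∀ y ∈ Metric.closedBall (0 : Eucl n) ρ, ∀ x ∈ Metric.closedBall (0 : Eucl n) ρ,
      |f x - f y| ≤ G * ‖x - y‖ := by
  obtain ⟨C, hC⟩ := (isCompact_closedBall (0 : Eucl n) ρ).exists_bound_of_continuousOn
    (hf.continuous_fderiv (by norm_num)).continuousOn
  refine ⟨max C 0, le_max_right _ _, fun y hy x hx => ?_⟩
  refine (convex_closedBall (0 : Eucl n) ρ).norm_image_sub_le_of_norm_fderiv_le (𝕜 := ℝ)
    (fun z _ => hf.differentiable (by norm_num) z) (fun z hz => (hC z hz).trans (le_max_left _ _)) hy hx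

lemma ff_le_one (hC : IsCoef a b) (y : Eucl n) {κ : ℝ} (hκ : 0 < κ) (z : Eucl n) :
    ff (fun i j => b i j y) κ z ≤ 1 := by
  obtain ⟨c, C, hc, -, h⟩ := qz_bounds hC (isCompact_singleton (x := y))
  have := (h y rfl z).1
  unfold ff
  refine max_le zero_le_one ?_
  have : 0 ≤ qz (fun i j => b i j y) z := le_trans (by positivity) this
  nlinarith
end Part14

section Part15
open MeasureTheory Set
open scoped Topology RealInnerProductSpace Manifold ContDiff ENNReal NNReal
variable {n : ℕ} {a b : Fin n → Fin n → Eucl n → ℝ}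

lemma integral_scaled_ball {F : Eucl n → ℝ} (y : Eucl n) {t : ℝ} (ht : 0 < t) :
    ∫ z in Metric.closedBall (0 : Eucl n) 1, F (y + t • z) =
      (t ^ n)⁻¹ * ∫ x in Metric.closedBall y t, F x := by
  have h1 := Measure.setIntegral_comp_smul_of_pos (volume : Measure (Eucl n)) (fun x => F (y + x))
    (Metric.closedBall (0 : Eucl n) 1) ht
  rw [h1, smul_closedBall _ _ zero_le_one]
  have h2 := (measurePreserving_add_left (volume : Measure (Eucl n)) y).setIntegral_preimage_emb
    (MeasurableEquiv.addLeft y).measurableEmbedding F (Metric.closedBall y t)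
  have h3 : (fun x => y + x) ⁻¹' Metric.closedBall y t = Metric.closedBall (0 : Eucl n) t := by
    ext x; simp [dist_eq_norm]
  rw [h3] at h2
  simp [abs_of_pos ht, h2]

set_option maxHeartbeats 1600000 in
lemma mean_value (hC : IsCoef a b) (ρ : ℝ) {P : ℝ} (hP : 0 ≤ P) :
    ∃ C : ℝ, 0 < C ∧ ∀ t : ℝ, 0 < t → t ≤ 1 → ∃ Ct : ℝ, 0 ≤ Ct ∧
      ∀ y ∈ Metric.closedBall (0 : Eucl n) ρ, ∀ w : Eucl n → ℝ, ContDiff ℝ 2 w → ∀ M : ℝ, 0 ≤ M →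
      (∀ x ∈ Metric.closedBall y t, |Lop a w x| ≤ P * |w x| ∧ |w x| ≤ M) →
      M * |w y| ≤ C * t * M ^ 2 + Ct * ∫ x in Metric.closedBall y t, w x ^ 2 := by
  have hKc := isCompact_closedBall (0 : Eucl n) ρ
  obtain ⟨c, C2, hc, hC2, hq⟩ := qz_bounds hC hKc
  obtain ⟨b0, hb0, hb⟩ := exists_bound hKc (fun q : Fin n × Fin n => b q.1 q.2)
    (fun q => hC.bcont q.1 q.2)
  obtain ⟨G, hG, hGa⟩ := exists_bound (isCompact_closedBall (0 : Eucl n) (ρ + 1))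
    (fun q : Fin n × Fin n => pd (a q.1 q.2) q.1)
    (fun q => pd_continuous ((hC.smooth q.1 q.2).of_le (by norm_num)) q.1)
  have hlip := fun i j => lip_on_ball ((hC.smooth i j).of_le (by norm_num) : ContDiff ℝ 1 (a i j)) (ρ + 1)
  choose G2 hG20 hG2 using hlip
  set L : ℝ := ∑ i, ∑ j, G2 i j with hL
  have hL0 : 0 ≤ L := Finset.sum_nonneg fun i _ => Finset.sum_nonneg fun j _ => hG20 i j
  have hLe : ∀ i j, G2 i j ≤ L := fun i j => by
    rw [hL]
    refine le_trans ?_ (Finset.single_le_sum (f := fun i => ∑ j, G2 i j)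
      (fun i _ => Finset.sum_nonneg fun j _ => hG20 i j) (Finset.mem_univ i))
    exact Finset.single_le_sum (f := fun j => G2 i j) (fun j _ => hG20 i j) (Finset.mem_univ j)
  set κ : ℝ := 1 / c with hκdef
  have hκ : 0 < κ := by positivity
  set E : ℝ := n * b0 with hE
  have hE0 : 0 ≤ E := by positivity
  set C1 : ℝ := P / (6 * κ) + n * (n * (G * E + L * (b0 + 4 * κ * E * E))) with hC1
  have hC10 : 0 ≤ C1 := by positivity
  set V : ℝ := (volume (Metric.closedBall (0 : Eucl n) 1)).toReal with hV
  have hV0 : 0 ≤ V := ENNReal.toReal_nonneg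
  set r1 : ℝ := 1 / (2 * κ * C2 + 1) with hr1
  have hr1p : 0 < r1 := by positivity
  have hr1le : r1 ≤ 1 := by
    rw [hr1, div_le_one (by positivity)]
    have : 0 ≤ 2 * κ * C2 := by positivity
    linarith
  set J0 : ℝ := (volume (Metric.ball (0 : Eucl n) r1)).toReal / 4 with hJ0
  have hJ0p : 0 < J0 := by
    have := ENNReal.toReal_pos (Metric.measure_ball_pos volume (0 : Eucl n) hr1p).ne'
      measure_ball_lt_top.ne
    positivity
  refine ⟨(V + C1 * V + 1) / J0, by positivity, fun t ht ht1 => ⟨(t⁻¹ * (t ^ n)⁻¹) / J0, by positivity,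
    fun y hy w hw M hM hx => ?_⟩⟩
  set β : Fin n → Fin n → ℝ := fun i j => b i j y with hβ
  set f := ff β κ with hf
  have hfc : Continuous f := ff_continuous β κ
  have hf0 : ∀ z, 0 ≤ f z := ff_nonneg β κ
  have hf1 : ∀ z, f z ≤ 1 := ff_le_one hC y hκ
  have hfz : ∀ z, 1 ≤ ‖z‖ → f z = 0 := by
    intro z hz
    have h1 := (hq y hy z).1
    rw [hf]; unfold ff
    refine max_eq_left ?_
    have h2 : c ≤ qz β z := le_trans (le_mul_of_one_le_right hc.le (one_le_pow₀ hz)) h1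
    have : 1 ≤ κ * qz β z := by
      rw [hκdef, div_mul_eq_mul_div, one_mul, le_div_iff₀ hc]; linarith
    linarith
  have hcs : HasCompactSupport f := by
    refine HasCompactSupport.intro (isCompact_closedBall (0 : Eucl n) 1) fun z hz => hfz z ?_
    rw [mem_closedBall_zero_iff] at hz
    linarith
  have hcs2 : HasCompactSupport (fun z => f z ^ 2) := hcs.comp_left (g := fun t : ℝ => t ^ 2) (by simp)
  have hmem : ∀ s z, 0 ≤ s → s ≤ t → ‖z‖ ≤ 1 → y + s • z ∈ Metric.closedBall y t := by
    intro s z hs hst hz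
    rw [mem_closedBall_iff_norm, add_sub_cancel_left, norm_smul, Real.norm_eq_abs, abs_of_nonneg hs]
    nlinarith [norm_nonneg z]
  have hy' : ‖y‖ ≤ ρ := by simpa using hy
  have hmem2 : ∀ s z, 0 ≤ s → s ≤ t → ‖z‖ ≤ 1 → y + s • z ∈ Metric.closedBall (0 : Eucl n) (ρ + 1) := by
    intro s z hs hst hz
    have := hmem s z hs hst hz
    rw [mem_closedBall_iff_norm, add_sub_cancel_left] at this
    rw [mem_closedBall_zero_iff]
    have := norm_add_le y (s • z)
    linarith
  have hel : ∀ j z, ‖z‖ ≤ 1 → |ell β j z| ≤ E := by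
    intro j z hz
    unfold ell
    refine (Finset.abs_sum_le_sum_abs _ _).trans ?_
    have : ∀ k ∈ Finset.univ, |β j k * z k| ≤ b0 := by
      intro k _
      rw [abs_mul]
      have h1 : |β j k| ≤ b0 := hb (j, k) y hy
      have h2 : |z k| ≤ 1 := (PiLp.norm_apply_le z k).trans hz
      nlinarith [abs_nonneg (β j k), abs_nonneg (z k)]
    refine (Finset.sum_le_sum this).trans ?_
    simp [hE]
  set I : ℝ → ℝ := fun s => ∫ z, w (y + s • z) * f z ^ 2 with hI
  have hder := fun s => I_deriv hw (hfc.pow 2) hcs2 y s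
  -- derivative bound
  have hdb : ∀ s, 0 < s → s < t →
      |∫ z, (∑ i, pd w i (y + s • z) * z i) * f z ^ 2| ≤ C1 * M * V := by
    intro s hs hst
    rw [frozen_identity hC hw y hκ hs hcs]
    have hpt : ∀ z, |(s * (Lop a w (y + s • z) * (f z ^ 3 / (6 * κ))) +
        ∑ i, ∑ j, w (y + s • z) * (pd (a i j) i (y + s • z) * (f z ^ 2 * ell β j z)
          + (a i j (y + s • z) - a i j y) / s *
            (f z ^ 2 * b j i y - 4 * κ * f z * ell β i z * ell β j z)))| ≤
        (Metric.closedBall (0 : Eucl n) 1).indicator (fun _ => C1 * M) z := by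
      intro z
      by_cases hz : ‖z‖ ≤ 1
      · rw [indicator_of_mem (by simpa using hz)]
        obtain ⟨hx1, hx2⟩ := hx _ (hmem s z hs.le hst.le hz)
        have g0 := hf0 z
        have g1 := hf1 z
        have f2 : f z ^ 2 ≤ 1 := pow_le_one₀ g0 g1
        have f3 : f z ^ 3 ≤ 1 := pow_le_one₀ g0 g1
        have t1 : |s * (Lop a w (y + s • z) * (f z ^ 3 / (6 * κ)))| ≤ P / (6 * κ) * M := by
          rw [abs_mul, abs_mul, abs_of_pos hs, abs_of_nonneg (by positivity : 0 ≤ f z ^ 3 / (6 * κ))]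
          have hl : |Lop a w (y + s • z)| ≤ P * M := hx1.trans (by gcongr)
          calc s * (|Lop a w (y + s • z)| * (f z ^ 3 / (6 * κ))) ≤ 1 * (P * M * (1 / (6 * κ))) := by
                gcongr
                linarith
            _ = _ := by ring
        have t2 : ∀ i j, |w (y + s • z) * (pd (a i j) i (y + s • z) * (f z ^ 2 * ell β j z)
          + (a i j (y + s • z) - a i j y) / s *
            (f z ^ 2 * b j i y - 4 * κ * f z * ell β i z * ell β j z))| ≤
            M * (G * E + L * (b0 + 4 * κ * E * E)) := by
          intro i j
          rw [abs_mul]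
          have k1 : |pd (a i j) i (y + s • z)| ≤ G := hGa (i, j) _ (hmem2 s z hs.le hst.le hz)
          have k2 : |(a i j (y + s • z) - a i j y) / s| ≤ L := by
            rw [abs_div, abs_of_pos hs, div_le_iff₀ hs]
            have := hG2 i j y (by simpa using hmem2 0 z le_rfl ht.le hz) _ (hmem2 s z hs.le hst.le hz)
            rw [add_sub_cancel_left, norm_smul, Real.norm_eq_abs, abs_of_pos hs] at this
            refine this.trans ?_
            have h5 := hLe i j
            have h6 := hG20 i j
            calc G2 i j * (s * ‖z‖) ≤ L * (s * 1) := by gcongr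
              _ = L * s := by ring
          have k3 : |f z ^ 2 * ell β j z| ≤ E := by
            rw [abs_mul, abs_of_nonneg (by positivity)]
            exact (mul_le_of_le_one_left (abs_nonneg _) f2).trans (hel j z hz)
          have k4 : |f z ^ 2 * b j i y - 4 * κ * f z * ell β i z * ell β j z| ≤ b0 + 4 * κ * E * E := by
            refine (abs_sub _ _).trans (add_le_add ?_ ?_)
            · rw [abs_mul, abs_of_nonneg (by positivity)]
              have : |b j i y| ≤ b0 := hb (j, i) y hy
              exact (mul_le_of_le_one_left (abs_nonneg _) f2).trans this
            · rw [abs_mul, abs_mul, abs_of_nonneg (by positivity : 0 ≤ 4 * κ * f z)]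
              have e1 := hel i z hz
              have e2 := hel j z hz
              calc 4 * κ * f z * |ell β i z| * |ell β j z| ≤ 4 * κ * 1 * E * E := by gcongr
                _ = _ := by ring
          refine mul_le_mul hx2 ((abs_add_le _ _).trans (add_le_add ?_ ?_)) (abs_nonneg _) hM
          · rw [abs_mul]; gcongr
          · rw [abs_mul]; gcongr
        refine (abs_add_le _ _).trans ?_
        have t3 : |∑ i, ∑ j, w (y + s • z) * (pd (a i j) i (y + s • z) * (f z ^ 2 * ell β j z)
          + (a i j (y + s • z) - a i j y) / s *
            (f z ^ 2 * b j i y - 4 * κ * f z * ell β i z * ell β j z))| ≤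
            ∑ i : Fin n, ∑ j : Fin n, M * (G * E + L * (b0 + 4 * κ * E * E)) := by
          refine (Finset.abs_sum_le_sum_abs _ _).trans (Finset.sum_le_sum fun i _ => ?_)
          exact (Finset.abs_sum_le_sum_abs _ _).trans (Finset.sum_le_sum fun j _ => t2 i j)
        simp only [Finset.sum_const, Finset.card_univ, Fintype.card_fin, nsmul_eq_mul] at t3
        calc _ ≤ _ := add_le_add t1 t3
          _ = _ := by rw [hC1]; ring
      · rw [indicator_of_notMem (by simpa using hz), hfz z (by linarith)]
        simp
    rw [← Real.norm_eq_abs]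
    refine (norm_integral_le_of_norm_le (g := (Metric.closedBall (0 : Eucl n) 1).indicator
      (fun _ => C1 * M)) ?_ (Filter.Eventually.of_forall fun z => (Real.norm_eq_abs _).trans_le (hpt z))).trans ?_
    · exact (integrable_indicator_iff Metric.isClosed_closedBall.measurableSet).2
        (integrableOn_const (isCompact_closedBall _ _).measure_lt_top.ne)
    · rw [integral_indicator Metric.isClosed_closedBall.measurableSet, setIntegral_const, smul_eq_mul]
      rw [hV, Measure.real]
      linarith
  obtain ⟨ξ, ⟨hξ0, hξt⟩, hsl⟩ := exists_hasDerivAt_eq_slope I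
    (fun s => ∫ z, (∑ i, pd w i (y + s • z) * z i) * f z ^ 2) ht
    (fun s _ => (hder s).continuousAt.continuousWithinAt) (fun s _ => hder s)
  have hIdiff : |I t - I 0| ≤ t * (C1 * M * V) := by
    have h1 := hdb ξ hξ0 hξt
    simp only at hsl
    rw [hsl, sub_zero, abs_div, abs_of_pos ht, div_le_iff₀ ht] at h1
    linarith
  -- I 0
  have hint2 : Integrable fun z => f z ^ 2 := (hfc.pow 2).integrable_of_hasCompactSupport hcs2
  have hI0 : I 0 = w y * ∫ z, f z ^ 2 := by
    simp only [hI, zero_smul, add_zero]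
    rw [integral_const_mul]
  have hJ : J0 ≤ ∫ z, f z ^ 2 := by
    have h1 : ∫ z in Metric.ball (0 : Eucl n) r1, (1 / 4 : ℝ) ≤
        ∫ z in Metric.ball (0 : Eucl n) r1, f z ^ 2 := by
      refine setIntegral_mono_on (integrableOn_const measure_ball_lt_top.ne) hint2.integrableOn
        Metric.isOpen_ball.measurableSet fun z hz => ?_
      rw [mem_ball_zero_iff] at hz
      have h2 := (hq y hy z).2
      have h3 : ‖z‖ ^ 2 ≤ r1 := by nlinarith [norm_nonneg z]
      have h4 : κ * qz β z ≤ 1 / 2 := by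
        have : κ * qz β z ≤ κ * (C2 * r1) := by gcongr; exact h2.trans (by gcongr)
        refine this.trans ?_
        rw [hr1]
        rw [mul_one_div, mul_div_assoc', div_le_div_iff₀ (by positivity) (by norm_num)]
        nlinarith
      have h5 : 1 / 2 ≤ f z := le_trans (by linarith) (le_max_right _ _)
      nlinarith
    have h2 : ∫ z in Metric.ball (0 : Eucl n) r1, f z ^ 2 ≤ ∫ z, f z ^ 2 :=
      setIntegral_le_integral hint2 (Filter.Eventually.of_forall fun z => by positivity)
    rw [setIntegral_const, smul_eq_mul] at h1
    rw [hJ0]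
    simp only [Measure.real] at h1
    linarith
  -- I t
  have hwt : Continuous fun z : Eucl n => w (y + t • z) := hw.continuous.comp (by fun_prop)
  have hIt : M * |I t| ≤ t * M ^ 2 * V + t⁻¹ * ((t ^ n)⁻¹ * ∫ x in Metric.closedBall y t, w x ^ 2) := by
    have e1 : I t = ∫ z in Metric.closedBall (0 : Eucl n) 1, w (y + t • z) * f z ^ 2 := by
      rw [hI, setIntegral_eq_integral_of_forall_compl_eq_zero]
      intro z hz
      rw [mem_closedBall_zero_iff] at hz
      rw [hfz z (by linarith)]; simp
    have icb : ∀ {F : Eucl n → ℝ}, Continuous F → IntegrableOn F (Metric.closedBall (0 : Eucl n) 1) :=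
      fun hF => hF.continuousOn.integrableOn_compact (isCompact_closedBall _ _)
    have e2 : M * |I t| ≤ ∫ z in Metric.closedBall (0 : Eucl n) 1, (t * M ^ 2 + t⁻¹ * w (y + t • z) ^ 2) := by
      rw [e1]
      have h1 := abs_integral_le_integral_abs (f := fun z => w (y + t • z) * f z ^ 2)
        (μ := volume.restrict (Metric.closedBall (0 : Eucl n) 1))
      refine (mul_le_mul_of_nonneg_left h1 hM).trans ?_
      rw [← integral_const_mul]
      refine setIntegral_mono_on (icb (by fun_prop)) (icb (by fun_prop))
        Metric.isClosed_closedBall.measurableSet fun z _ => ?_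
      have f2 : f z ^ 2 ≤ 1 := pow_le_one₀ (hf0 z) (hf1 z)
      rw [abs_mul, abs_of_nonneg (by positivity : 0 ≤ f z ^ 2)]
      have h3 : M * (|w (y + t • z)| * f z ^ 2) ≤ M * |w (y + t • z)| := by
        refine mul_le_mul_of_nonneg_left ?_ hM
        nlinarith [abs_nonneg (w (y + t • z))]
      refine h3.trans ?_
      have h4 : 0 ≤ t⁻¹ * (t * M - |w (y + t • z)|) ^ 2 := by positivity
      have h5 : t⁻¹ * (t * M - |w (y + t • z)|) ^ 2 =
          t * M ^ 2 - 2 * (M * |w (y + t • z)|) + t⁻¹ * |w (y + t • z)| ^ 2 := by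
        field_simp; ring
      rw [sq_abs] at h5
      have h6 : 0 ≤ M * |w (y + t • z)| := by positivity
      have h7 : 0 ≤ t⁻¹ * w (y + t • z) ^ 2 := by positivity
      nlinarith [mul_nonneg ht.le (sq_nonneg M)]
    refine e2.trans (le_of_eq ?_)
    rw [integral_add (icb (by fun_prop)) (icb (by fun_prop)), setIntegral_const, integral_const_mul,
      integral_scaled_ball (F := fun x => w x ^ 2) y ht, smul_eq_mul]
    simp only [Measure.real, hV]
    ring
  set S := ∫ x in Metric.closedBall y t, w x ^ 2 with hS
  have hS0 : 0 ≤ S := integral_nonneg fun x => by positivity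
  have k1 : |w y| * J0 ≤ |I 0| := by
    rw [hI0, abs_mul, abs_of_nonneg (le_trans hJ0p.le hJ)]
    gcongr
  have k2 : |I 0| ≤ |I t| + t * (C1 * M * V) := by
    have := abs_sub_abs_le_abs_sub (I 0) (I t)
    rw [abs_sub_comm] at this
    linarith
  have k3 : M * |w y| * J0 ≤ (V + C1 * V + 1) * t * M ^ 2 + t⁻¹ * (t ^ n)⁻¹ * S := by
    have k4 := mul_le_mul_of_nonneg_left (k1.trans k2) hM
    nlinarith [mul_nonneg ht.le (sq_nonneg M)]
  have k5 : M * |w y| ≤ ((V + C1 * V + 1) * t * M ^ 2 + t⁻¹ * (t ^ n)⁻¹ * S) / J0 := by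
    rwa [le_div_iff₀ hJ0p]
  refine k5.trans (le_of_eq ?_)
  ring
end Part15

section Part16
open MeasureTheory Set
open scoped Topology RealInnerProductSpace Manifold ContDiff ENNReal NNReal
variable {n : ℕ} {a b : Fin n → Fin n → Eucl n → ℝ}

lemma second_deriv_test {f : ℝ → ℝ} {x : ℝ} (hf : ContinuousAt f x) (hmax : IsLocalMax f x) :
    deriv (deriv f) x ≤ 0 := by
  by_contra h
  push Not at h
  have hmin := isLocalMin_of_deriv_deriv_pos h hmax.deriv_eq_zero hf
  have hconst : f =ᶠ[𝓝 x] fun _ => f x := by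
    filter_upwards [hmax, hmin] with y h1 h2
    exact le_antisymm h1 h2
  have h2 : deriv f =ᶠ[𝓝 x] fun _ => 0 := by
    filter_upwards [hconst.eventuallyEq_nhds] with y hy
    rw [hy.deriv_eq]; simp
  rw [h2.deriv_eq] at h
  simp at h

lemma hasDerivAt_dir {u : Eucl n → ℝ} (hu : Differentiable ℝ u) (y ξ : Eucl n) (s : ℝ) :
    HasDerivAt (fun t : ℝ => u (y + t • ξ)) (∑ i, pd u i (y + s • ξ) * ξ i) s := by
  have h1 : HasDerivAt (fun t : ℝ => y + t • ξ) ξ s := by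
    simpa using ((hasDerivAt_id s).smul_const ξ).const_add y
  rw [← sum_pd_mul]
  exact (hu _).hasFDerivAt.comp_hasDerivAt s h1

lemma hess_nonpos {w : Eucl n → ℝ} (hw : ContDiff ℝ 2 w) {x : Eucl n} (hmax : IsLocalMax w x)
    (ξ : Fin n → ℝ) : ∑ i, ∑ j, pd (pd w i) j x * ξ i * ξ j ≤ 0 := by
  set η : Eucl n := WithLp.toLp 2 ξ with hη
  have hc : Continuous fun t : ℝ => x + t • η := by fun_prop
  have hm : IsLocalMax (fun t : ℝ => w (x + t • η)) 0 := by
    have : Filter.Tendsto (fun t : ℝ => x + t • η) (𝓝 0) (𝓝 x) := by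
      have := hc.tendsto 0
      simpa using this
    have h2 := this.eventually hmax
    filter_upwards [h2] with t ht
    simpa using ht
  have h1 := second_deriv_test (hw.continuous.comp hc).continuousAt hm
  have e1 : deriv (fun t : ℝ => w (x + t • η)) = fun s => ∑ i, pd w i (x + s • η) * η i := by
    ext s; exact (hasDerivAt_dir (hw.differentiable (by norm_num)) x η s).deriv
  have e2 : HasDerivAt (fun s : ℝ => ∑ i, pd w i (x + s • η) * η i)
      (∑ i, (∑ j, pd (pd w i) j (x + (0:ℝ) • η) * η j) * η i) 0 := by
    exact HasDerivAt.fun_sum (u := Finset.univ) (x := (0:ℝ)) (fun i _ => (hasDerivAt_dir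
      ((pd_contDiff (k := 1) hw (by norm_num) i).differentiable (by norm_num)) x η 0).mul_const (η i))
  change deriv (deriv (fun t : ℝ => w (x + t • η))) 0 ≤ 0 at h1
  rw [e1, e2.deriv] at h1
  convert h1 using 1
  refine Finset.sum_congr rfl fun i _ => ?_
  rw [Finset.sum_mul]
  refine Finset.sum_congr rfl fun j _ => ?_
  simp [hη]; ring

lemma pd_zero_of_max {w : Eucl n → ℝ} {x : Eucl n} (hmax : IsLocalMax w x) (i : Fin n) :
    pd w i x = 0 := by
  unfold pd; rw [hmax.fderiv_eq_zero]; simp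

lemma max_principle (hC : IsCoef a b) {w : Eucl n → ℝ} (hw : ContDiff ℝ 2 w) {x : Eucl n}
    (hmax : IsLocalMax w x) : Lop a w x ≤ 0 := by
  have hd : ∀ i, DifferentiableAt ℝ (pd w i) x := fun i =>
    (pd_contDiff (k := 1) hw (by norm_num) i).differentiable (by norm_num) x
  have ha : ∀ i j, DifferentiableAt ℝ (a i j) x := fun i j =>
    (hC.smooth i j).differentiable (by norm_num) x
  have e1 : Lop a w x = ∑ i, ∑ j, a i j x * pd (pd w j) i x := by
    unfold Lop flux
    refine Finset.sum_congr rfl fun i _ => ?_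
    rw [pd_sum _ (fun j => show DifferentiableAt ℝ (fun y => a i j y * pd w j y) x from (ha i j).mul (hd j))]
    refine Finset.sum_congr rfl fun j _ => ?_
    rw [pd_mul (ha i j) (hd j), pd_zero_of_max hmax]; ring
  have hps : (Matrix.of fun i j => a i j x).PosSemidef := by
    refine Matrix.PosSemidef.of_dotProduct_mulVec_nonneg ?_ fun ξ => ?_
    · ext i j; simp [hC.symm j i x]
    · by_cases h : ξ = 0
      · simp [h]
      · have := (hC.pos x ξ h).le
        convert this using 1
        simp only [dotProduct, Matrix.mulVec, star_trivial, Matrix.of_apply, Finset.mul_sum]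
        exact Finset.sum_congr rfl fun i _ => Finset.sum_congr rfl fun j _ => by ring
  obtain ⟨c, hc⟩ : ∃ c : Matrix (Fin n) (Fin n) ℝ, (Matrix.of fun i j => a i j x) = c.transpose * c := by
    open scoped MatrixOrder in
    obtain ⟨c, hc⟩ := CStarAlgebra.nonneg_iff_eq_star_mul_self.1 hps.nonneg
    exact ⟨c, by rw [hc]; rfl⟩
  have hcc : ∀ i j, a i j x = ∑ k, c k i * c k j := fun i j => by
    have := congrFun (congrFun hc i) j
    simpa [Matrix.mul_apply] using this
  rw [e1]
  have e2 : ∑ i, ∑ j, a i j x * pd (pd w j) i x =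
      ∑ k, ∑ i, ∑ j, pd (pd w i) j x * c k i * c k j := by
    rw [Finset.sum_comm' (t' := Finset.univ) (s' := fun _ => Finset.univ) (by simp)]
    simp_rw [hcc, Finset.sum_mul]
    rw [Finset.sum_comm]
    conv_rhs => rw [Finset.sum_comm]
    rw [Finset.sum_comm]
    refine Finset.sum_congr rfl fun i _ => ?_
    rw [Finset.sum_comm]
    refine Finset.sum_congr rfl fun j _ => Finset.sum_congr rfl fun k _ => ?_
    ring
  rw [e2]
  exact Finset.sum_nonpos fun k _ => hess_nonpos hw hmax (fun i => c k i)

lemma Lop_lin (hC : IsCoef a b) {w φ : Eucl n → ℝ} (hw : ContDiff ℝ 2 w) (hφ : ContDiff ℝ 2 φ)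
    (s c : ℝ) (x : Eucl n) :
    Lop a (fun y => w y + (s * φ y + c)) x = Lop a w x + s * Lop a φ x := by
  have e : ∀ i, flux a (fun y => w y + (s * φ y + c)) i = fun y => flux a w i y + s * flux a φ i y := by
    intro i
    ext y
    have d1 := hw.differentiable (by norm_num) y
    have d2 := hφ.differentiable (by norm_num) y
    have d3 : DifferentiableAt ℝ (fun y => s * φ y) y := d2.const_mul s
    have d4 : DifferentiableAt ℝ (fun y => s * φ y + c) y := d3.add_const c
    unfold flux
    rw [Finset.mul_sum, ← Finset.sum_add_distrib]
    refine Finset.sum_congr rfl fun j _ => ?_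
    rw [pd_add d1 d4, pd_add d3 (differentiableAt_const c), pd_const, pd_const_mul _ d2]
    ring
  unfold Lop
  rw [Finset.mul_sum, ← Finset.sum_add_distrib]
  refine Finset.sum_congr rfl fun i _ => ?_
  have f1 := (flux_contDiff (k := 1) hC hw (by norm_num) (by norm_num) i).differentiable (by norm_num) x
  have f2 := (flux_contDiff (k := 1) hC hφ (by norm_num) (by norm_num) i).differentiable (by norm_num) x
  rw [e, pd_add f1 (f2.const_mul s), pd_const_mul _ f2]
end Part16

section Part17
open MeasureTheory Set
open scoped Topology RealInnerProductSpace Manifold ContDiff ENNReal NNReal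
variable {n : ℕ} {a b : Fin n → Fin n → Eucl n → ℝ}

lemma inner_gradient (u : Eucl n → ℝ) (x e : Eucl n) : ⟪gradient u x, e⟫ = fderiv ℝ u x e := by
  unfold gradient
  exact InnerProductSpace.toDual_symm_apply (𝕜 := ℝ) (x := e) (y := fderiv ℝ u x)

lemma dir_neg {ρ : Eucl n → ℝ} {x e : Eucl n} (hρ : DifferentiableAt ℝ ρ x) (h0 : ρ x = 0)
    (h : ⟪gradient ρ x, e⟫ < 0) : ∀ᶠ t : ℝ in 𝓝[>] 0, ρ (x + t • e) < 0 := by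
  have h1 : HasDerivAt (fun t : ℝ => x + t • e) e 0 := by
    simpa using ((hasDerivAt_id (0:ℝ)).smul_const e).const_add x
  have hρ' : HasFDerivAt ρ (fderiv ℝ ρ x) (x + (0:ℝ) • e) := by simpa using hρ.hasFDerivAt
  have h2 := hρ'.comp_hasDerivAt (0:ℝ) h1
  rw [← inner_gradient, hasDerivAt_iff_tendsto_slope] at h2
  have h3 := (h2.eventually (gt_mem_nhds h)).filter_mono
    (nhdsWithin_mono 0 (fun t (ht : 0 < t) => ht.ne') : 𝓝[>] (0:ℝ) ≤ 𝓝[≠] 0)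
  filter_upwards [h3, self_mem_nhdsWithin] with t ht ht0
  simp only [slope_def_field, Function.comp, zero_smul, add_zero, sub_zero, h0] at ht
  have : 0 < t := ht0
  by_contra hc
  push Not at hc
  exact absurd ht (not_lt.2 (by positivity))

lemma unit_grad_unique {D : Set (Eucl n)} {ρ₁ ρ₂ : Eucl n → ℝ} {x : Eucl n}
    (hd1 : DifferentiableAt ℝ ρ₁ x) (hd2 : DifferentiableAt ℝ ρ₂ x) (h1 : ρ₁ x = 0) (h2 : ρ₂ x = 0)
    (g1 : gradient ρ₁ x ≠ 0) (g2 : gradient ρ₂ x ≠ 0)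
    (i1 : ∀ᶠ y in 𝓝 x, (y ∈ D ↔ ρ₁ y < 0)) (i2 : ∀ᶠ y in 𝓝 x, (y ∈ D ↔ ρ₂ y < 0)) :
    ‖gradient ρ₁ x‖⁻¹ • gradient ρ₁ x = ‖gradient ρ₂ x‖⁻¹ • gradient ρ₂ x := by
  set u1 := ‖gradient ρ₁ x‖⁻¹ • gradient ρ₁ x with hu1
  set u2 := ‖gradient ρ₂ x‖⁻¹ • gradient ρ₂ x with hu2
  have n1 : ‖u1‖ = 1 := by rw [hu1]; exact norm_smul_inv_norm (𝕜 := ℝ) g1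
  have n2 : ‖u2‖ = 1 := by rw [hu2]; exact norm_smul_inv_norm (𝕜 := ℝ) g2
  by_contra hne
  have hlt : ⟪u1, u2⟫ < 1 := inner_lt_one_iff_real_of_norm_eq_one n1 n2 |>.2 hne
  have p1 : 0 < ‖gradient ρ₁ x‖ := norm_pos_iff.2 g1
  have p2 : 0 < ‖gradient ρ₂ x‖ := norm_pos_iff.2 g2
  have e1 : ⟪gradient ρ₁ x, u2 - u1⟫ < 0 := by
    have : gradient ρ₁ x = ‖gradient ρ₁ x‖ • u1 := by
      rw [hu1, smul_smul, mul_inv_cancel₀ p1.ne', one_smul]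
    rw [this, real_inner_smul_left, inner_sub_right, real_inner_self_eq_norm_sq, n1]
    nlinarith
  have e2 : ⟪gradient (fun y => -ρ₂ y) x, u2 - u1⟫ < 0 := by
    rw [inner_gradient, fderiv_fun_neg, neg_apply, ← inner_gradient]
    have : gradient ρ₂ x = ‖gradient ρ₂ x‖ • u2 := by
      rw [hu2, smul_smul, mul_inv_cancel₀ p2.ne', one_smul]
    rw [this, real_inner_smul_left, inner_sub_right, real_inner_self_eq_norm_sq, n2,
      real_inner_comm]
    nlinarith
  have f1 := dir_neg hd1 h1 e1
  have f2 := dir_neg (ρ := fun y => -ρ₂ y) hd2.neg (by simp [h2]) e2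
  have hten : Filter.Tendsto (fun t : ℝ => x + t • (u2 - u1)) (𝓝[>] 0) (𝓝 x) := by
    have hc : Continuous fun t : ℝ => x + t • (u2 - u1) := by fun_prop
    have := (hc.tendsto 0).mono_left (nhdsWithin_le_nhds (s := Ioi 0))
    simpa using this
  obtain ⟨t, ht1, ht2, ht3, ht4⟩ := (f1.and (f2.and ((hten.eventually i1).and (hten.eventually i2)))).exists
  have := ht4.1 (ht3.2 ht1)
  linarith

lemma normal_eq {D : Set (Eucl n)} {ν : Eucl n → Eucl n} (hν : IsOutwardNormalField D ν)
    {y0 : Eucl n} {ρ : Eucl n → ℝ} {R c σ : ℝ} {k : Fin n} (hF : FChart D y0 ρ R c σ k)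
    {x : Eucl n} (hx : x ∈ frontier D) (hxR : x ∈ Metric.ball y0 R) :
    gradient ρ x ≠ 0 ∧ ν x = ‖gradient ρ x‖⁻¹ • gradient ρ x := by
  have hg : gradient ρ x ≠ 0 := by
    intro h
    have h1 := hF.deriv_ge x hxR
    rw [← gradient_coord, h] at h1
    have := hF.cpos
    simp at h1; linarith
  refine ⟨hg, ?_⟩
  obtain ⟨V, ρ0, hV, hxV, hs, hg0, h1, h2, h3⟩ := hν x hx
  rw [h3]
  refine unit_grad_unique (D := D) ((hs.contDiffAt (hV.mem_nhds hxV)).differentiableAt (by norm_num))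
    (hF.smooth.differentiable (by norm_num) x) ?_ ((hF.bdry x hxR).1 hx) (hg0 x hxV) hg ?_ ?_
  · have : x ∈ frontier D ∩ V := ⟨hx, hxV⟩
    rw [h2] at this
    exact this.2
  · filter_upwards [hV.mem_nhds hxV] with y hy
    constructor
    · intro h
      have : y ∈ D ∩ V := ⟨h, hy⟩
      rw [h1] at this
      exact this.2
    · intro h
      have : y ∈ {y | y ∈ V ∧ ρ0 y < 0} := ⟨hy, h⟩
      rw [← h1] at this
      exact this.1
  · filter_upwards [Metric.isOpen_ball.mem_nhds hxR] with y hy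
    exact hF.inside y hy

lemma continuous_gradient {u : Eucl n → ℝ} (hu : ContDiff ℝ 1 u) : Continuous (gradient u) := by
  unfold gradient
  exact (LinearIsometryEquiv.continuous _).comp (hu.continuous_fderiv (by norm_num))

lemma hasC4_of_normal {D : Set (Eucl n)} {ν : Eucl n → Eucl n} (hν : IsOutwardNormalField D ν) :
    HasC4Boundary D := by
  intro x hx
  obtain ⟨V, ρ0, hV, hxV, hs, hg0, h1, h2, h3⟩ := hν x hx
  exact ⟨V, ρ0, hV, hxV, hs, hg0, h1, h2⟩

lemma normal_continuousOn {D : Set (Eucl n)} {ν : Eucl n → Eucl n} (hν : IsOutwardNormalField D ν) :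
    ContinuousOn ν (frontier D) := by
  intro x hx
  obtain ⟨ρ, R, c, σ, k, hF⟩ := exists_fchart (hasC4_of_normal hν) hx
  have hxR : x ∈ Metric.ball x R := Metric.mem_ball_self hF.Rpos
  have hgc := continuous_gradient (hF.smooth.of_le (by norm_num) : ContDiff ℝ 1 ρ)
  have h1 : ContinuousWithinAt (fun y => ‖gradient ρ y‖⁻¹ • gradient ρ y) (frontier D) x := by
    refine ContinuousAt.continuousWithinAt ?_
    exact ContinuousAt.smul (hgc.norm.continuousAt.inv₀ (norm_ne_zero_iff.2 (normal_eq hν hF hx hxR).1))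
      hgc.continuousAt
  refine h1.congr_of_eventuallyEq ?_ (normal_eq hν hF hx hxR).2
  filter_upwards [self_mem_nhdsWithin, mem_nhdsWithin_of_mem_nhds (Metric.isOpen_ball.mem_nhds hxR)]
    with y hy hyR
  exact (normal_eq hν hF hy hyR).2

lemma normal_norm {D : Set (Eucl n)} {ν : Eucl n → Eucl n} (hν : IsOutwardNormalField D ν)
    {x : Eucl n} (hx : x ∈ frontier D) : ‖ν x‖ = 1 := by
  obtain ⟨V, ρ0, hV, hxV, hs, hg0, h1, h2, h3⟩ := hν x hx
  rw [h3]
  exact norm_smul_inv_norm (𝕜 := ℝ) (hg0 x hxV)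

lemma En_split {D : Set (Eucl n)} {ν : Eucl n → Eucl n} (hν : IsOutwardNormalField D ν)
    (v : Eucl n → ℝ) {x : Eucl n} (hx : x ∈ frontier D) :
    En v x = (v x ^ 2 + ‖tangGrad ν v x‖ ^ 2) + normalDeriv ν v x ^ 2 := by
  have h1 : ‖gradient v x‖ ^ 2 = ∑ i, pd v i x ^ 2 := by
    rw [EuclideanSpace.norm_sq_eq]
    exact Finset.sum_congr rfl fun i _ => by rw [gradient_coord, Real.norm_eq_abs, sq_abs]
  have h2 : ‖tangGrad ν v x‖ ^ 2 = ‖gradient v x‖ ^ 2 - normalDeriv ν v x ^ 2 := by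
    unfold tangGrad
    rw [@norm_sub_sq_real, real_inner_smul_right, norm_smul, normal_norm hν hx, mul_one,
      Real.norm_eq_abs, sq_abs]
    unfold normalDeriv
    ring
  unfold En
  rw [h2, h1]; ring
end Part17

section Part18
open MeasureTheory Set
open scoped Topology RealInnerProductSpace Manifold ContDiff ENNReal NNReal
variable {n : ℕ} {a b : Fin n → Fin n → Eucl n → ℝ}

lemma chord_flat {D : Set (Eucl n)} {ν : Eucl n → Eucl n} (hν : IsOutwardNormalField D ν)
    {x0 : Eucl n} (hx0 : x0 ∈ frontier D)
    {ρ : Eucl n → ℝ} {R c σ : ℝ} {k : Fin n} (hF : FChart D x0 ρ R c σ k) :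
    ∃ R' : ℝ, 0 < R' ∧ R' < R ∧ ∀ x ∈ frontier D, ‖x - x0‖ ≤ R' →
      |⟪x - x0, ν x⟫| ≤ 1 / 2 * ‖x - x0‖ := by
  have hxR : x0 ∈ Metric.ball x0 R := Metric.mem_ball_self hF.Rpos
  have hgc := continuous_gradient (hF.smooth.of_le (by norm_num) : ContDiff ℝ 1 ρ)
  have hG : 0 < ‖gradient ρ x0‖ := norm_pos_iff.2 (normal_eq hν hF hx0 hxR).1
  set G := ‖gradient ρ x0‖ with hGd
  have h1 : ∀ᶠ x in 𝓝 x0, ‖gradient ρ x - gradient ρ x0‖ < G / 8 := by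
    have := Metric.tendsto_nhds.1 (hgc.tendsto x0) (G/8) (by positivity)
    simpa [dist_eq_norm] using this
  have h2 : ∀ᶠ x in 𝓝 x0, ‖ρ x - ρ x0 - fderiv ℝ ρ x0 (x - x0)‖ ≤ G / 8 * ‖x - x0‖ := by
    have hd : HasFDerivAt ρ (fderiv ℝ ρ x0) x0 :=
      (hF.smooth.differentiable (by norm_num) x0).hasFDerivAt
    exact (hd.isLittleO).def (by positivity)
  obtain ⟨δ, hδ, hb⟩ := Metric.eventually_nhds_iff.1 (h1.and h2)
  refine ⟨min (δ/2) (R/2), lt_min (by positivity) (by have := hF.Rpos; positivity), ?_, ?_⟩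
  · have := min_le_right (δ/2) (R/2); have := hF.Rpos; linarith
  intro x hx hle
  have l1 : ‖x - x0‖ ≤ δ/2 := hle.trans (min_le_left _ _)
  have l2 : ‖x - x0‖ ≤ R/2 := hle.trans (min_le_right _ _)
  have hxb : x ∈ Metric.ball x0 R := by
    rw [Metric.mem_ball, dist_eq_norm]; have := hF.Rpos; linarith
  obtain ⟨e1, e2⟩ := hb (show dist x x0 < δ by rw [dist_eq_norm]; linarith)
  rw [(hF.bdry x hxb).1 hx, (hF.bdry x0 hxR).1 hx0, ← inner_gradient, Real.norm_eq_abs] at e2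
  obtain ⟨hg, hνx⟩ := normal_eq hν hF hx hxb
  have hp : 0 < ‖gradient ρ x‖ := norm_pos_iff.2 hg
  have hlow : 7 * G / 8 ≤ ‖gradient ρ x‖ := by
    have := norm_sub_norm_le (gradient ρ x0) (gradient ρ x)
    rw [norm_sub_rev] at this
    linarith
  have e3 : |⟪gradient ρ x - gradient ρ x0, x - x0⟫| ≤ G / 8 * ‖x - x0‖ :=
    (abs_real_inner_le_norm _ _).trans (mul_le_mul_of_nonneg_right e1.le (norm_nonneg _))
  have e4 : |⟪gradient ρ x, x - x0⟫| ≤ G / 4 * ‖x - x0‖ := by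
    rw [inner_sub_left] at e3
    rw [sub_self, zero_sub, abs_neg] at e2
    have := abs_add_le (⟪gradient ρ x, x - x0⟫ - ⟪gradient ρ x0, x - x0⟫) ⟪gradient ρ x0, x - x0⟫
    rw [sub_add_cancel] at this
    linarith
  rw [hνx, real_inner_smul_right, real_inner_comm, abs_mul, abs_inv, abs_norm,
    inv_mul_le_iff₀ hp]
  refine e4.trans ?_
  have := norm_nonneg (x - x0)
  nlinarith

lemma bdry_osc {D : Set (Eucl n)} {ν : Eucl n → Eucl n}
    (hν : IsOutwardNormalField D ν)
    {x0 : Eucl n} (hx0 : x0 ∈ frontier D) {r : ℝ} (hr : 0 ≤ r) :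
    ∃ N R' : ℝ, 0 ≤ N ∧ 0 < R' ∧ ∀ A : Eucl n → ℝ, ContDiff ℝ 1 A → ∀ M : ℝ, 0 < M →
      (∀ x ∈ frontier D, |A x| ≤ M ∧ ‖tangGrad ν A x‖ ≤ r * M) →
      ∀ x ∈ frontier D, ‖x - x0‖ ≤ R' → A x ≤ A x0 + N * M * ‖x - x0‖ := by
  obtain ⟨ρ, R, c, σ, k, hF⟩ := exists_fchart (hasC4_of_normal hν) hx0
  obtain ⟨R', hR', hRR, hflat⟩ := chord_flat hν hx0 hF
  refine ⟨3 * r + 3 / R', R', by positivity, hR', ?_⟩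
  set N := 3 * r + 3 / R' with hN
  intro A hA M hM hAM
  have hcomp : IsCompact (frontier D ∩ Metric.closedBall x0 R') :=
    (isCompact_closedBall x0 R').inter_left isClosed_frontier
  have hA0 : Continuous A := hA.continuous
  obtain ⟨z, ⟨hzD, hzR⟩, hmax⟩ := hcomp.exists_isMaxOn ⟨x0, hx0, Metric.mem_closedBall_self hR'.le⟩
    (f := fun x => A x - N * M * Real.sqrt (‖x - x0‖ ^ 2)) (by fun_prop)
  have hmax' : ∀ x ∈ frontier D, ‖x - x0‖ ≤ R' →
      A x - N * M * ‖x - x0‖ ≤ A z - N * M * ‖z - x0‖ := by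
    intro x hx hxR
    have := hmax (show x ∈ frontier D ∩ Metric.closedBall x0 R' from
      ⟨hx, by rwa [Metric.mem_closedBall, dist_eq_norm]⟩)
    simpa [Real.sqrt_sq (norm_nonneg _)] using this
  have hzR2 : ‖z - x0‖ ≤ R' := by rwa [Metric.mem_closedBall, dist_eq_norm] at hzR
  by_cases hz0 : z = x0
  · intro x hx hxR
    have := hmax' x hx hxR
    rw [hz0] at this
    simp at this; linarith
  exfalso
  have hzp : 0 < ‖z - x0‖ := norm_pos_iff.2 (sub_ne_zero.2 hz0)
  have hNp : 0 < N := by positivity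
  rcases hzR2.eq_or_lt with heq | hlt
  · have h1 := hmax' x0 hx0 (by simp [hR'.le])
    rw [heq] at h1
    have h2 : N * M * R' = (3 * r * R' + 3) * M := by rw [hN]; field_simp
    have h3 := abs_le.1 (hAM x0 hx0).1
    have h4 := abs_le.1 (hAM z hzD).1
    have : 0 ≤ 3 * r * R' * M := by positivity
    simp at h1
    linarith [h3.1, h4.2]
  · have hzb : z ∈ Metric.ball x0 R := by rw [Metric.mem_ball, dist_eq_norm]; linarith
    obtain ⟨hg, hνz⟩ := normal_eq hν hF hzD hzb
    have hρz := (hF.bdry z hzb).1 hzD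
    have hext : IsLocalExtrOn (fun x => A x - N * M * Real.sqrt (‖x - x0‖ ^ 2))
        {x | ρ x = ρ z} z := by
      right
      have hnear : ∀ᶠ y in 𝓝 z, ‖y - x0‖ < R' :=
        (show Continuous fun y : Eucl n => ‖y - x0‖ by fun_prop).tendsto z |>.eventually (gt_mem_nhds hlt)
      filter_upwards [self_mem_nhdsWithin, mem_nhdsWithin_of_mem_nhds hnear] with y hy hyR
      have hyb : y ∈ Metric.ball x0 R := by rw [Metric.mem_ball, dist_eq_norm]; linarith
      have hyD : y ∈ frontier D := (hF.bdry y hyb).2 (by rw [← hρz]; exact hy)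
      have := hmax' y hyD hyR.le
      simpa [Real.sqrt_sq (norm_nonneg _)] using this
    have hρ' : HasStrictFDerivAt ρ (fderiv ℝ ρ z) z :=
      hF.smooth.contDiffAt.hasStrictFDerivAt (by norm_num)
    have hA' : HasStrictFDerivAt A (fderiv ℝ A z) z :=
      hA.contDiffAt.hasStrictFDerivAt (by norm_num)
    have hn0 : HasStrictFDerivAt (fun x : Eucl n => ‖x - x0‖ ^ 2)
        ((2 • (innerSL ℝ (z - x0))).comp (ContinuousLinearMap.id ℝ (Eucl n))) z :=
      (hasStrictFDerivAt_norm_sq (z - x0)).comp z ((hasStrictFDerivAt_id z).sub_const x0)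
    have hn' := hn0.sqrt (by positivity)
    have hΦ' := hA'.sub (hn'.const_mul (N * M))
    obtain ⟨l, m, hlm, hlin⟩ := IsLocalExtrOn.exists_multipliers_of_hasStrictFDerivAt_1d hext hρ' hΦ'
    set q := ⟪z - x0, ν z⟫ with hq
    set w := z - x0 - q • ν z with hw
    have hν1 := normal_norm hν hzD
    have hwν : ⟪ν z, w⟫ = 0 := by
      rw [hw, inner_sub_right, real_inner_smul_right, real_inner_self_eq_norm_sq, hν1,
        real_inner_comm, ← hq]; ring
    have hgν : gradient ρ z = ‖gradient ρ z‖ • ν z := by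
      rw [hνz, smul_smul, mul_inv_cancel₀ (norm_ne_zero_iff.2 hg), one_smul]
    have hzw : ⟪z - x0, w⟫ = ‖z - x0‖ ^ 2 - q ^ 2 := by
      rw [hw, inner_sub_right, real_inner_smul_right, real_inner_self_eq_norm_sq, ← hq]; ring
    have hww : ‖w‖ ^ 2 = ‖z - x0‖ ^ 2 - q ^ 2 := by
      rw [← hzw, ← real_inner_self_eq_norm_sq]
      nth_rewrite 1 [hw]
      rw [inner_sub_left, real_inner_smul_left, hwν]; ring
    have hqle := hflat z hzD hzR2
    have hq2 : q ^ 2 ≤ 1 / 4 * ‖z - x0‖ ^ 2 := by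
      rw [← sq_abs q]
      have := pow_le_pow_left₀ (abs_nonneg _) hqle 2
      nlinarith
    have hm : m ≠ 0 := by
      intro h0
      rw [h0, zero_smul, add_zero] at hlin
      have h1 := DFunLike.congr_fun hlin (ν z)
      simp only [smul_apply, zero_apply, smul_eq_mul] at h1
      rw [← inner_gradient, hgν, real_inner_smul_left, real_inner_self_eq_norm_sq, hν1] at h1
      have : l ≠ 0 := by
        intro hl
        exact hlm (by rw [hl, h0]; rfl)
      have hg2 : ‖gradient ρ z‖ ≠ 0 := norm_ne_zero_iff.2 hg
      have h3 : l * (‖gradient ρ z‖ * 1 ^ 2) ≠ 0 := by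
        rw [one_pow, mul_one]; exact mul_ne_zero this hg2
      exact h3 h1
    have h1 := DFunLike.congr_fun hlin w
    simp only [smul_apply, zero_apply, smul_eq_mul, add_apply, sub_apply] at h1
    rw [← inner_gradient ρ, hgν, real_inner_smul_left, hwν] at h1
    simp only [mul_zero, zero_add, mul_eq_zero, hm, false_or] at h1
    simp [Real.sqrt_sq (norm_nonneg _)] at h1
    rw [← inner_sub_left, hzw] at h1
    have hDA : fderiv ℝ A z w = ⟪tangGrad ν A z, w⟫ := by
      rw [← inner_gradient]
      unfold tangGrad
      rw [inner_sub_left, real_inner_smul_left, hwν]; ring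
    have hws : ‖w‖ ≤ ‖z - x0‖ := by
      refine le_of_sq_le_sq (a := ‖w‖) ?_ hzp.le
      rw [hww]; linarith [sq_nonneg q]
    have hup : fderiv ℝ A z w ≤ r * M * ‖z - x0‖ := by
      rw [hDA]
      refine (real_inner_le_norm _ _).trans ?_
      exact mul_le_mul (hAM z hzD).2 hws (norm_nonneg _) (by positivity)
    have hlo : N * M * (3 / 4 * ‖z - x0‖) ≤
        N * M * (‖z - x0‖⁻¹ * 2⁻¹ * (2 * (‖z - x0‖ ^ 2 - q ^ 2))) := by
      refine mul_le_mul_of_nonneg_left ?_ (by positivity)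
      have e : ‖z - x0‖⁻¹ * 2⁻¹ * (2 * (‖z - x0‖ ^ 2 - q ^ 2))
          = (‖z - x0‖ ^ 2 - q ^ 2) / ‖z - x0‖ := by field_simp
      rw [e, le_div_iff₀ hzp]
      linarith
    have hc : N * (3 / 4) ≤ r := by
      have hMs : 0 < M * ‖z - x0‖ := by positivity
      refine le_of_mul_le_mul_right ?_ hMs
      linarith
    have : 0 < 3 / R' := by positivity
    linarith
end Part18

section Part19
open MeasureTheory Set
open scoped Topology RealInnerProductSpace Manifold ContDiff ENNReal NNReal
variable {n : ℕ} {a b : Fin n → Fin n → Eucl n → ℝ}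

lemma barrier_exists (hC : IsCoef a b) {D : Set (Eucl n)} {x0 : Eucl n} (hx0 : x0 ∈ frontier D)
    (hD : HasC4Boundary D) :
    ∃ (E : Eucl n → ℝ) (R' c3 : ℝ), ContDiff ℝ 2 E ∧ 0 < R' ∧ 0 < c3 ∧ E x0 = 1 ∧
      (∀ x ∈ closure D, ‖x - x0‖ ≤ R' → x ≠ x0 → E x < 1) ∧
      ∀ x, ‖x - x0‖ ≤ R' → c3 ≤ Lop a E x := by
  obtain ⟨ρ, R, c, σ, k, hF⟩ := exists_fchart hD hx0
  have hR := hF.Rpos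
  have hc := hF.cpos
  have hxR : x0 ∈ Metric.ball x0 R := Metric.mem_ball_self hR
  set ψ : Eucl n → ℝ := fun x => ρ x + psiR x0 x with hψdef
  have hψ : ContDiff ℝ 3 ψ := (hF.smooth.of_le (by norm_num)).add (psiR_contDiff x0)
  set R' := min (R / 2) (c / 4) with hR'
  have hR'p : 0 < R' := lt_min (by positivity) (by positivity)
  have hl1 : R' ≤ R / 2 := min_le_left _ _
  have hl2 : R' ≤ c / 4 := min_le_right _ _
  have hK := isCompact_closedBall x0 R'
  obtain ⟨c0, hc0, H0⟩ := qf_lower hC hK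
  have hball : ∀ x, ‖x - x0‖ ≤ R' → x ∈ Metric.ball x0 R := by
    intro x hx; rw [Metric.mem_ball, dist_eq_norm]; linarith
  have hgq : ∀ x, ‖x - x0‖ ≤ R' → c0 * (c / 2) ^ 2 ≤ gq a ψ ψ x := by
    intro x hx
    have h1 := H0 x (by rw [Metric.mem_closedBall, dist_eq_norm]; exact hx) (fun i => pd ψ i x)
    have h2 : qf a x (fun i => pd ψ i x) = gq a ψ ψ x := by
      unfold qf gq flux
      refine Finset.sum_congr rfl fun i _ => ?_
      rw [Finset.sum_mul]
      exact Finset.sum_congr rfl fun j _ => by ring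
    rw [← h2]
    refine le_trans ?_ h1
    refine mul_le_mul_of_nonneg_left ?_ hc0.le
    refine le_trans ?_ (Finset.single_le_sum (f := fun i => pd ψ i x ^ 2) (fun i _ => sq_nonneg _)
      (Finset.mem_univ k))
    have h3 : pd ψ k x = pd ρ k x + -2 * (x k - x0 k) := by
      rw [← pd_psiR]
      exact pd_add (hF.smooth.differentiable (by norm_num) x)
        ((psiR_contDiff x0 (k := 1)).differentiable (by norm_num) x) k
    have h4 := hF.deriv_ge x (hball x hx)
    have h5 : |x k - x0 k| ≤ c / 4 := by
      have := PiLp.norm_apply_le (x - x0) k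
      simp at this
      linarith
    have h6 := abs_le.1 h5
    have h7 : c / 2 ≤ |pd ψ k x| := by
      rw [h3]
      rcases hF.sig with hs | hs
      · rw [hs] at h4
        refine le_trans ?_ (le_abs_self _); linarith [h6.1, h6.2]
      · rw [hs] at h4
        refine le_trans ?_ (neg_le_abs _); linarith [h6.1, h6.2]
    rw [← sq_abs (pd ψ k x)]
    exact pow_le_pow_left₀ (by positivity) h7 2
  obtain ⟨L, hL, HL⟩ := exists_bound1 hK (Lop_continuous hC (hψ.of_le (by norm_num)))
  set γ := c0 * (c / 2) ^ 2 with hγ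
  have hγp : 0 < γ := by positivity
  set κ := (L + 1) / γ with hκ
  have hκp : 0 < κ := by positivity
  have hE : ContDiff ℝ 2 (fun y => Real.exp (κ * ψ y)) :=
    (contDiff_const.mul (hψ.of_le (by norm_num))).exp
  have hpos : ∀ x, ‖x - x0‖ ≤ R' → 0 < Lop a (fun y => Real.exp (κ * ψ y)) x := by
    intro x hx
    rw [Lop_wt hC hψ]
    have h1 := abs_le.1 (HL x (by rw [Metric.mem_closedBall, dist_eq_norm]; exact hx))
    have h2 := mul_le_mul_of_nonneg_left (hgq x hx) hκp.le
    have h3 : κ * γ = L + 1 := by rw [hκ]; field_simp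
    have : 0 < Lop a ψ x + κ * gq a ψ ψ x := by linarith [h1.1]
    positivity
  obtain ⟨z, hz, hmin⟩ := hK.exists_isMinOn ⟨x0, Metric.mem_closedBall_self hR'p.le⟩
    (Lop_continuous hC hE).continuousOn
  refine ⟨fun y => Real.exp (κ * ψ y), R', Lop a (fun y => Real.exp (κ * ψ y)) z, hE, hR'p,
    hpos z (by rwa [Metric.mem_closedBall, dist_eq_norm] at hz), ?_, ?_, ?_⟩
  · simp [hψdef, psiR, (hF.bdry x0 hxR).1 hx0]
  · intro x hx hxR' hne
    have hb := hball x hxR'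
    have h1 : ρ x ≤ 0 := by
      rw [closure_eq_self_union_frontier] at hx
      rcases hx with hx | hx
      · exact ((hF.inside x hb).1 hx).le
      · exact ((hF.bdry x hb).1 hx).le
    have h2 : 0 < ‖x - x0‖ := norm_pos_iff.2 (sub_ne_zero.2 hne)
    have h3 : ψ x < 0 := by
      simp only [hψdef, psiR]
      have : 0 < ‖x - x0‖ ^ 2 := by positivity
      linarith
    have : κ * ψ x < 0 := mul_neg_of_pos_of_neg hκp h3
    simpa using this
  · intro x hx
    exact hmin (show x ∈ Metric.closedBall x0 R' by rw [Metric.mem_closedBall, dist_eq_norm]; exact hx)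

/-- Admissible data on a domain. -/
structure Adm (a : Fin n → Fin n → Eucl n → ℝ) (B : Set (Eucl n)) (ν : Eucl n → Eucl n) (P r : ℝ)
    (v A : Eucl n → ℝ) (M : ℝ) : Prop where
  sol : Sol a B P v
  cont : ContinuousOn v (closure B)
  A1 : ContDiff ℝ 1 A
  Mpos : 0 < M
  le : ∀ x ∈ closure B, |v x| ≤ M
  eq : ∀ x ∈ frontier B, v x = A x
  tang : ∀ x ∈ frontier B, ‖tangGrad ν A x‖ ≤ r * M

lemma Adm.neg {B : Set (Eucl n)} {ν : Eucl n → Eucl n} {P r : ℝ} {v A : Eucl n → ℝ} {M : ℝ}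
    (h : Adm a B ν P r v A M) : Adm a B ν P r (fun x => - v x) (fun x => - A x) M := by
  refine ⟨⟨h.sol.1.neg, fun x hx => ?_⟩, h.cont.neg, h.A1.neg, h.Mpos, fun x hx => ?_,
    fun x hx => by rw [h.eq x hx], fun x hx => ?_⟩
  · have e1 : ∀ i, flux a (fun y => - v y) i = fun y => - flux a v i y := by
      intro i; ext y
      unfold flux
      rw [← Finset.sum_neg_distrib]
      exact Finset.sum_congr rfl fun j _ => by rw [pd_neg]; ring
    have e2 : Lop a (fun y => - v y) x = - Lop a v x := by
      unfold Lop
      rw [← Finset.sum_neg_distrib]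
      exact Finset.sum_congr rfl fun i _ => by rw [e1, pd_neg]
    rw [e2, abs_neg, abs_neg]
    exact h.sol.2 x hx
  · rw [abs_neg]; exact h.le x hx
  · have e : tangGrad ν (fun x => - A x) x = - tangGrad ν A x := by
      have e1 : gradient (fun x => - A x) x = - gradient A x := by
        unfold gradient
        rw [fderiv_fun_neg, map_neg]
      unfold tangGrad normalDeriv
      rw [e1, inner_neg_left, neg_smul]; abel
    rw [e, norm_neg]
    exact h.tang x hx

set_option maxHeartbeats 1600000 in
lemma barrier_upper (hC : IsCoef a b) {B : Set (Eucl n)} (hB : IsOpen B)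
    {ν : Eucl n → Eucl n}
    (hν : IsOutwardNormalField B ν) {P r : ℝ} (hP : 0 ≤ P) (hr : 0 ≤ r)
    {x0 : Eucl n} (hx0 : x0 ∈ frontier B) {ε : ℝ} (hε : 0 < ε) :
    ∃ δ > 0, ∀ v A M, Adm a B ν P r v A M → ∀ x ∈ closure B, ‖x - x0‖ < δ → v x ≤ A x0 + ε * M := by
  obtain ⟨E, R1, c3, hE, hR1, hc3, hE0, hE1, hE2⟩ := barrier_exists hC hx0 (hasC4_of_normal hν)
  obtain ⟨N, R2, hN, hR2, hosc⟩ := bdry_osc hν hx0 hr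
  set ε1 := ε / 2 with hε1
  have hε1p : 0 < ε1 := by positivity
  set r2 := min R1 (min R2 (ε1 / (N + 1))) with hr2
  have hr2p : 0 < r2 := lt_min hR1 (lt_min hR2 (by positivity))
  have hr2a : r2 ≤ R1 := min_le_left _ _
  have hr2b : r2 ≤ R2 := (min_le_right _ _).trans (min_le_left _ _)
  have hr2c : N * r2 ≤ ε1 := by
    have h1 : r2 ≤ ε1 / (N + 1) := (min_le_right _ _).trans (min_le_right _ _)
    rw [le_div_iff₀ (by positivity)] at h1
    linarith
  have hx0c : x0 ∈ closure B := frontier_subset_closure hx0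
  have hKc : IsCompact (closure B ∩ Metric.closedBall x0 R1) :=
    (isCompact_closedBall x0 R1).inter_left isClosed_closure
  have hw0 : ∃ w0 > 0, ∀ x ∈ closure B, ‖x - x0‖ ≤ R1 → r2 ≤ ‖x - x0‖ → w0 ≤ 1 - E x := by
    have hK2 : IsCompact ((closure B ∩ Metric.closedBall x0 R1) \ Metric.ball x0 r2) :=
      hKc.diff Metric.isOpen_ball
    rcases ((closure B ∩ Metric.closedBall x0 R1) \ Metric.ball x0 r2).eq_empty_or_nonempty with he | hne
    · refine ⟨1, one_pos, fun x hx h1 h2 => ?_⟩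
      exfalso
      have : x ∈ ((closure B ∩ Metric.closedBall x0 R1) \ Metric.ball x0 r2) :=
        ⟨⟨hx, by rwa [Metric.mem_closedBall, dist_eq_norm]⟩,
          by rw [Metric.mem_ball, dist_eq_norm]; exact not_lt.2 h2⟩
      rw [he] at this
      exact this
    · obtain ⟨z, ⟨⟨hz1, hz2⟩, hz3⟩, hmax⟩ := hK2.exists_isMaxOn hne hE.continuous.continuousOn
      rw [Metric.mem_closedBall, dist_eq_norm] at hz2
      refine ⟨1 - E z, ?_, fun x hx h1 h2 => ?_⟩
      · have := hE1 z hz1 hz2 (by rintro rfl; exact hz3 (Metric.mem_ball_self hr2p))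
        linarith
      · have : E x ≤ E z := hmax (show x ∈ ((closure B ∩ Metric.closedBall x0 R1) \ Metric.ball x0 r2) from
          ⟨⟨hx, by rwa [Metric.mem_closedBall, dist_eq_norm]⟩,
          by rw [Metric.mem_ball, dist_eq_norm]; exact not_lt.2 h2⟩)
        linarith
  obtain ⟨w0, hw0p, hw0⟩ := hw0
  set T := 2 / w0 + (P + 1) / c3 with hT
  have hTp : 0 < T := by positivity
  have hT1 : 2 ≤ T * w0 := by
    have : T * w0 = 2 + (P + 1) / c3 * w0 := by rw [hT]; field_simp
    rw [this]
    have : 0 ≤ (P + 1) / c3 * w0 := by positivity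
    linarith
  have hT2 : P + 1 ≤ T * c3 := by
    have : T * c3 = 2 / w0 * c3 + (P + 1) := by rw [hT]; field_simp
    rw [this]
    have : 0 ≤ 2 / w0 * c3 := by positivity
    linarith
  have hev : ∀ᶠ x in 𝓝 x0, T * (1 - E x) < ε1 := by
    have hc : Continuous fun x => T * (1 - E x) := by have := hE.continuous; fun_prop
    refine hc.tendsto x0 |>.eventually (gt_mem_nhds ?_)
    rw [hE0]; simpa using hε1p
  obtain ⟨δ, hδ, hδE⟩ := Metric.eventually_nhds_iff.1 hev
  refine ⟨min δ R1, lt_min hδ hR1, ?_⟩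
  intro v A M hA
  have hM := hA.Mpos
  -- main claim
  have key : ∀ x ∈ closure B, ‖x - x0‖ ≤ R1 →
      v x + (T * M * E x + (- A x0 - ε1 * M - T * M)) ≤ 0 := by
    by_contra hcon
    push Not at hcon
    obtain ⟨x1, hx1, hx1R, hx1p⟩ := hcon
    obtain ⟨z, ⟨hz1, hz2⟩, hmax⟩ := hKc.exists_isMaxOn
      (f := fun x => v x + (T * M * E x + (- A x0 - ε1 * M - T * M)))
      ⟨x0, hx0c, Metric.mem_closedBall_self hR1.le⟩
      ((hA.cont.mono inter_subset_left).add (Continuous.continuousOn (by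
        have := hE.continuous; fun_prop)))
    have hzp : 0 < v z + (T * M * E z + (- A x0 - ε1 * M - T * M)) :=
      lt_of_lt_of_le hx1p (hmax (show x1 ∈ closure B ∩ Metric.closedBall x0 R1 from
        ⟨hx1, by rwa [Metric.mem_closedBall, dist_eq_norm]⟩))
    have hz2' : ‖z - x0‖ ≤ R1 := by rwa [Metric.mem_closedBall, dist_eq_norm] at hz2
    have hEz : E z ≤ 1 := by
      by_cases h : z = x0
      · rw [h, hE0]
      · exact (hE1 z hz1 hz2' h).le
    have hA0 : |A x0| ≤ M := by rw [← hA.eq x0 hx0]; exact hA.le x0 hx0c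
    have hTM : 0 < T * M := by positivity
    have hεM : 0 < ε1 * M := by positivity
    by_cases hzr : r2 ≤ ‖z - x0‖
    · have h1 := hw0 z hz1 hz2' hzr
      have h2 : T * w0 * M ≤ T * M * (1 - E z) := by
        have := mul_le_mul_of_nonneg_left h1 hTM.le
        linarith
      have h3 : 2 * M ≤ T * w0 * M := mul_le_mul_of_nonneg_right hT1 hM.le
      have h4 := (abs_le.1 (hA.le z hz1)).2
      have h5 := (abs_le.1 hA0).1
      linarith
    push Not at hzr
    rw [closure_eq_self_union_frontier] at hz1
    rcases hz1 with hzB | hzF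
    · -- interior
      have hloc : ∀ᶠ y in 𝓝 z, v y + (T * M * E y + (- A x0 - ε1 * M - T * M)) ≤
          v z + (T * M * E z + (- A x0 - ε1 * M - T * M)) := by
        have hnear : ∀ᶠ y in 𝓝 z, ‖y - x0‖ < R1 :=
          (show Continuous fun y : Eucl n => ‖y - x0‖ by fun_prop).tendsto z |>.eventually
            (gt_mem_nhds (lt_of_lt_of_le hzr hr2a))
        filter_upwards [hB.mem_nhds hzB, hnear] with y hy hyR
        exact hmax (show y ∈ closure B ∩ Metric.closedBall x0 R1 from
          ⟨subset_closure hy, by rw [Metric.mem_closedBall, dist_eq_norm]; exact hyR.le⟩)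
      obtain ⟨w, hw, hwz⟩ := hA.sol.localise hB (K := {z}) isClosed_singleton (by simpa using hzB)
      obtain ⟨hw1, hw2, -, hw4⟩ := hwz z rfl
      have hlm : IsLocalMax (fun y => w y + (T * M * E y + (- A x0 - ε1 * M - T * M))) z := by
        filter_upwards [hloc, hw1] with y hy1 hy2
        rw [hw2, hy2]; exact hy1
      have hmp := max_principle hC (hw.add ((contDiff_const.mul hE).add contDiff_const)) hlm
      rw [Lop_lin hC hw hE] at hmp
      have h1 := (abs_le.1 hw4).1
      have h2 : P * |w z| ≤ P * M := by
        rw [hw2]; exact mul_le_mul_of_nonneg_left (hA.le z (subset_closure hzB)) hP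
      have h3 := mul_le_mul_of_nonneg_left (hE2 z hz2') hTM.le
      have h4 : (P + 1) * M ≤ T * c3 * M := mul_le_mul_of_nonneg_right hT2 hM.le
      linarith
    · have h1 := hosc A hA.A1 M hM (fun x hx => ⟨by
        rw [← hA.eq x hx]; exact hA.le x (frontier_subset_closure hx), hA.tang x hx⟩) z hzF
        (hzr.le.trans hr2b)
      have h2 : N * M * ‖z - x0‖ ≤ ε1 * M := by
        have := mul_le_mul_of_nonneg_left hzr.le hN
        have := mul_le_mul_of_nonneg_right (this.trans hr2c) hM.le
        linarith
      have h3 : T * M * E z ≤ T * M * 1 := mul_le_mul_of_nonneg_left hEz hTM.le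
      rw [← hA.eq z hzF] at h1
      linarith
  intro x hx hxδ
  have h1 := key x hx (hxδ.le.trans (min_le_right _ _))
  have h2 := hδE (show dist x x0 < δ by rw [dist_eq_norm]; exact lt_of_lt_of_le hxδ (min_le_left _ _))
  have h3 := mul_le_mul_of_nonneg_right h2.le hM.le
  have h4 : ε * M = ε1 * M + ε1 * M := by rw [hε1]; ring
  linarith

lemma barrier_both (hC : IsCoef a b) {B : Set (Eucl n)} (hB : IsOpen B)
    {ν : Eucl n → Eucl n}
    (hν : IsOutwardNormalField B ν) {P r : ℝ} (hP : 0 ≤ P) (hr : 0 ≤ r)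
    {x0 : Eucl n} (hx0 : x0 ∈ frontier B) {ε : ℝ} (hε : 0 < ε) :
    ∃ δ > 0, ∀ v A M, Adm a B ν P r v A M → ∀ x ∈ closure B, ‖x - x0‖ < δ →
      |v x - A x0| ≤ ε * M := by
  obtain ⟨δ, hδ, H⟩ := barrier_upper hC hB hν hP hr hx0 hε
  refine ⟨δ, hδ, fun v A M hA x hx hxδ => abs_le.2 ⟨?_, ?_⟩⟩
  · have := H _ _ M hA.neg x hx hxδ
    linarith
  · have := H v A M hA x hx hxδ
    linarith
end Part19

section Part20
open MeasureTheory Set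
open scoped Topology RealInnerProductSpace Manifold ContDiff ENNReal NNReal
variable {n : ℕ} {a b : Fin n → Fin n → Eucl n → ℝ}

lemma setIntegral_le_sum {ι : Type*} [Fintype ι] {K : Set (Eucl n)} {s : ι → Set (Eucl n)}
    (hK : K ⊆ ⋃ i, s i) {f : Eucl n → ℝ} (hf : ∀ x, 0 ≤ f x) (hi : ∀ i, IntegrableOn f (s i)) :
    ∫ x in K, f x ≤ ∑ i, ∫ x in s i, f x := by
  have h1 : (volume : Measure (Eucl n)).restrict K ≤ ∑ i, volume.restrict (s i) := by
    rw [← Measure.sum_fintype]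
    exact (Measure.restrict_mono hK le_rfl).trans Measure.restrict_iUnion_le
  have h2 : Integrable f (∑ i, (volume : Measure (Eucl n)).restrict (s i)) :=
    integrable_finsetSum_measure.2 fun i _ => hi i
  rw [← integral_finsetSum_measure (fun i _ => hi i)]
  exact integral_mono_measure h1 (Filter.Eventually.of_forall hf) h2

lemma good_compact {B : Set (Eucl n)} (hB : IsOpen B) {P : ℝ} {D : (Eucl n → ℝ) → ℝ}
    (hall : ∀ x ∈ B, Good a B P D x) {K : Set (Eucl n)} (hK : IsCompact K) (hKB : K ⊆ B)
    {ε : ℝ} (hε : 0 < ε) :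
    ∃ C : ℝ, 0 ≤ C ∧ ∀ v : Eucl n → ℝ, Sol a B P v →
      ∀ M : ℝ, (∀ y ∈ B, |v y| ≤ M) → ∫ y in K, En v y ≤ ε * M ^ 2 + C * D v := by
  have hall' := fun x (hx : x ∈ K) => hall x (hKB hx)
  unfold Good at hall'
  choose! ρ hρ hρB hg using hall'
  obtain ⟨t, ht⟩ := hK.elim_nhds_subcover' (fun x _ => Metric.ball x (ρ x))
    (fun x hx => Metric.ball_mem_nhds x (hρ x hx))
  set N : ℝ := (t.card : ℝ) + 1 with hN
  have hNp : 0 < N := by positivity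
  have hch := fun x : K => hg x.1 x.2 (ε / N) (by positivity)
  choose C hC0 hC using hch
  refine ⟨∑ x ∈ t, C x, Finset.sum_nonneg fun x _ => hC0 x, fun v hv M hM => ?_⟩
  have hsub : K ⊆ ⋃ i : t, Metric.ball (i.1.1 : Eucl n) (ρ i.1.1) := by
    intro y hy
    obtain ⟨x, hx, hyx⟩ := mem_iUnion₂.1 (ht hy)
    exact mem_iUnion.2 ⟨⟨x, hx⟩, hyx⟩
  have h1 := setIntegral_le_sum hsub (En_nonneg v) (fun i =>
    (hv.En_integrableOn hB (isCompact_closedBall _ _) (hρB i.1.1 i.1.2)).mono_set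
      Metric.ball_subset_closedBall)
  refine h1.trans ?_
  rw [Finset.sum_coe_sort t (fun i => ∫ x in Metric.ball (i.1 : Eucl n) (ρ i.1), En v x)]
  refine (Finset.sum_le_sum fun x _ => hC x v hv M hM).trans ?_
  rw [Finset.sum_add_distrib, Finset.sum_const, ← Finset.sum_mul, nsmul_eq_mul]
  have : (t.card : ℝ) * (ε / N * M ^ 2) ≤ ε * M ^ 2 := by
    have e : ε * M ^ 2 = N * (ε / N * M ^ 2) := by field_simp
    rw [e]
    refine mul_le_mul_of_nonneg_right (by linarith) (by positivity)
  linarith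

lemma sup_inside (hC : IsCoef a b) {B : Set (Eucl n)} (hB : IsOpen B)
    (hBb : Bornology.IsBounded B) {ν : Eucl n → Eucl n}
    (hν : IsOutwardNormalField B ν) {P r : ℝ} (hP : 0 ≤ P) (hr : 0 ≤ r) :
    ∃ K : Set (Eucl n), IsCompact K ∧ K ⊆ B ∧ ∀ v A M, Adm a B ν P r v A M →
      (∃ x ∈ closure B, |v x| = M) → ∃ y ∈ K, 3 / 4 * M ≤ |v y| := by
  have hcl : IsCompact (closure B) := hBb.isCompact_closure
  have hfr : IsCompact (frontier B) := hcl.of_isClosed_subset isClosed_frontier frontier_subset_closure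
  have hb := fun x (hx : x ∈ frontier B) =>
    barrier_both hC hB hν hP hr hx (ε := 1 / 8) (by norm_num)
  choose! δ hδ hδv using hb
  obtain ⟨t, ht⟩ := hfr.elim_nhds_subcover' (fun x _ => Metric.ball x (δ x))
    (fun x hx => Metric.ball_mem_nhds x (hδ x hx))
  have hy : ∀ x : frontier B, ∃ y ∈ B, y ∈ Metric.ball x.1 (δ x.1) := by
    intro x
    obtain ⟨y, hy, hd⟩ := Metric.mem_closure_iff.1 (frontier_subset_closure x.2) (δ x.1) (hδ x.1 x.2)
    exact ⟨y, hy, by rw [Metric.mem_ball, dist_comm]; exact hd⟩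
  choose y hyB hyd using hy
  refine ⟨(closure B \ ⋃ x ∈ t, Metric.ball x.1 (δ x.1)) ∪ y '' t, ?_, ?_, ?_⟩
  · refine (hcl.diff ?_).union (t.finite_toSet.image y).isCompact
    exact isOpen_biUnion fun x _ => Metric.isOpen_ball
  · rintro z (⟨hz1, hz2⟩ | ⟨x, hx, rfl⟩)
    · rw [closure_eq_self_union_frontier] at hz1
      rcases hz1 with h | h
      · exact h
      · exact absurd (ht h) hz2
    · exact hyB x
  · rintro v A M hA ⟨x, hx, hxM⟩
    have hM := hA.Mpos
    by_cases hxt : x ∈ ⋃ x ∈ t, Metric.ball x.1 (δ x.1)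
    · obtain ⟨q, hq, hxq⟩ := mem_iUnion₂.1 hxt
      refine ⟨y q, Or.inr ⟨q, hq, rfl⟩, ?_⟩
      have h1 := hδv q.1 q.2 v A M hA x hx (by rwa [Metric.mem_ball, dist_eq_norm] at hxq)
      have h2 := hδv q.1 q.2 v A M hA (y q) (subset_closure (hyB q))
        (by have := hyd q; rwa [Metric.mem_ball, dist_eq_norm] at this)
      have h3 := abs_add_le (v x - A q.1) (A q.1 - v (y q))
      have h4 := abs_add_le (v x - v (y q)) (v (y q))
      rw [sub_add_cancel] at h4
      rw [sub_add_sub_cancel, abs_sub_comm (A q.1)] at h3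
      linarith
    · exact ⟨x, Or.inl ⟨hx, hxt⟩, by rw [hxM]; linarith⟩

lemma sup_le_data (hC : IsCoef a b) {B : Set (Eucl n)} (hB : IsOpen B)
    (hBb : Bornology.IsBounded B) {ν : Eucl n → Eucl n}
    (hν : IsOutwardNormalField B ν) {P r : ℝ} (hP : 0 ≤ P) (hr : 0 ≤ r)
    {D : (Eucl n → ℝ) → ℝ} (hD : ∀ v, 0 ≤ D v) (hall : ∀ x ∈ B, Good a B P D x) :
    ∃ C : ℝ, 0 ≤ C ∧ ∀ v A M, Adm a B ν P r v A M →
      (∃ x ∈ closure B, |v x| = M) → M ^ 2 ≤ C * D v := by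
  obtain ⟨K, hK, hKB, hKv⟩ := sup_inside hC hB hBb hν hP hr
  obtain ⟨t0, ht0, htB⟩ := hK.exists_cthickening_subset_open hB hKB
  obtain ⟨ρ, hρ⟩ := hK.isBounded.subset_closedBall (0 : Eucl n)
  obtain ⟨C1, hC1, hmv⟩ := mean_value hC ρ hP
  set t := min t0 (min 1 (1 / (4 * C1))) with ht
  have htp : 0 < t := lt_min ht0 (lt_min one_pos (by positivity))
  have hta : t ≤ t0 := min_le_left _ _
  have htb : t ≤ 1 := (min_le_right _ _).trans (min_le_left _ _)
  have htc : C1 * t ≤ 1 / 4 := by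
    have h1 : t ≤ 1 / (4 * C1) := (min_le_right _ _).trans (min_le_right _ _)
    rw [le_div_iff₀ (by positivity)] at h1
    linarith
  obtain ⟨Ct, hCt, hmv⟩ := hmv t htp htb
  have hK2 : IsCompact (Metric.cthickening t0 K) := hK.cthickening
  obtain ⟨C2, hC2, hgood⟩ := good_compact hB hall hK2 htB (ε := 1 / (4 * (Ct + 1))) (by positivity)
  refine ⟨4 * Ct * C2, by positivity, fun v A M hA hex => ?_⟩
  have hM := hA.Mpos
  obtain ⟨y, hyK, hyM⟩ := hKv v A M hA hex
  have hsub : Metric.closedBall y t ⊆ Metric.cthickening t0 K :=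
    (Metric.closedBall_subset_closedBall hta).trans (Metric.closedBall_subset_cthickening hyK t0)
  obtain ⟨w, hw, hwp⟩ := hA.sol.localise hB (K := Metric.closedBall y t) Metric.isClosed_closedBall
    (hsub.trans htB)
  have h1 := hmv y (hρ hyK) w hw M hM.le (fun x hx => by
    obtain ⟨-, h2, -, h4⟩ := hwp x hx
    exact ⟨h4, by rw [h2]; exact hA.le x (subset_closure (htB (hsub hx)))⟩)
  rw [(hwp y (Metric.mem_closedBall_self htp.le)).2.1] at h1
  have h2 : ∫ x in Metric.closedBall y t, w x ^ 2 ≤ ∫ x in Metric.closedBall y t, En v x := by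
    refine setIntegral_mono_on ?_ (hA.sol.En_integrableOn hB (isCompact_closedBall y t) (hsub.trans htB))
      Metric.isClosed_closedBall.measurableSet ?_
    · exact (hw.continuous.pow 2).continuousOn.integrableOn_compact (isCompact_closedBall y t)
    · intro x hx
      rw [(hwp x hx).2.1]
      unfold En
      have : 0 ≤ ∑ i, pd v i x ^ 2 := Finset.sum_nonneg fun i _ => sq_nonneg _
      linarith
  have h3 : ∫ x in Metric.closedBall y t, En v x ≤ ∫ x in Metric.cthickening t0 K, En v x :=
    setIntegral_mono_set (hA.sol.En_integrableOn hB hK2 htB)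
      (Filter.Eventually.of_forall fun x => En_nonneg v x) hsub.eventuallyLE
  have h4 := hgood v hA.sol M (fun x hx => hA.le x (subset_closure hx))
  have h5 := mul_le_mul_of_nonneg_left (h2.trans (h3.trans h4)) hCt
  have h6 : M * (3 / 4 * M) ≤ M * |v y| := mul_le_mul_of_nonneg_left hyM hM.le
  have h7 : C1 * t * M ^ 2 ≤ 1 / 4 * M ^ 2 := mul_le_mul_of_nonneg_right htc (by positivity)
  have h8 : Ct * (1 / (4 * (Ct + 1)) * M ^ 2) ≤ 1 / 4 * M ^ 2 := by
    rw [← mul_assoc]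
    refine mul_le_mul_of_nonneg_right ?_ (by positivity)
    rw [mul_one_div, div_le_iff₀ (by positivity)]
    linarith
  have h9 := hD v
  have e : M * (3 / 4 * M) = 3 / 4 * M ^ 2 := by ring
  rw [e] at h6
  rw [mul_add] at h5
  linarith
end Part20

section Part21
open MeasureTheory Set
open scoped Topology RealInnerProductSpace Manifold ContDiff ENNReal NNReal
variable {n : ℕ}

lemma det_contDiff {k : WithTop ℕ∞} {g : Eucl n → Matrix (Fin n) (Fin n) ℝ}
    (hg : ∀ i j, ContDiff ℝ k fun x => g x i j) : ContDiff ℝ k fun x => (g x).det := by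
  simp_rw [Matrix.det_apply']
  exact ContDiff.sum fun σ _ => contDiff_const.mul (contDiff_prod fun i _ => hg _ _)

lemma adj_contDiff {k : WithTop ℕ∞} {g : Eucl n → Matrix (Fin n) (Fin n) ℝ}
    (hg : ∀ i j, ContDiff ℝ k fun x => g x i j) (i j : Fin n) :
    ContDiff ℝ k fun x => (g x).adjugate i j := by
  simp_rw [Matrix.adjugate_apply]
  refine det_contDiff fun p q => ?_
  simp_rw [Matrix.updateRow_apply]
  by_cases h : p = j
  · simp only [h, if_true]; exact contDiff_const
  · simp only [h, if_false]; exact hg p q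

lemma metric_posDef {g : Eucl n → Matrix (Fin n) (Fin n) ℝ} (hs : ∀ x, (g x).IsSymm)
    {θ : ℝ} (hθ : 0 < θ) (hgθ : UniformlyElliptic g θ) (x : Eucl n) : (g x).PosDef := by
  refine Matrix.PosDef.of_dotProduct_mulVec_pos ?_ fun ξ hξ => ?_
  · rw [Matrix.IsHermitian, Matrix.conjTranspose_eq_transpose_of_trivial]; exact hs x
  · have h1 := hgθ x ξ
    have h2 : 0 < ∑ i, ξ i ^ 2 := by
      obtain ⟨i, hi⟩ := Function.ne_iff.1 hξ
      refine Finset.sum_pos' (fun i _ => sq_nonneg _) ⟨i, Finset.mem_univ i, ?_⟩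
      have : ξ i ≠ 0 := hi
      positivity
    have h3 : star ξ ⬝ᵥ (g x).mulVec ξ = ∑ i, ∑ j, g x i j * ξ i * ξ j := by
      simp only [dotProduct, Matrix.mulVec, Finset.mul_sum, Pi.star_apply, star_trivial]
      exact Finset.sum_congr rfl fun i _ => Finset.sum_congr rfl fun j _ => by ring
    rw [h3]
    exact lt_of_lt_of_le (by positivity) h1

def coefA (g : Eucl n → Matrix (Fin n) (Fin n) ℝ) (i j : Fin n) (x : Eucl n) : ℝ :=
  Real.sqrt (g x).det * (g x)⁻¹ i j

def coefB (g : Eucl n → Matrix (Fin n) (Fin n) ℝ) (i j : Fin n) (x : Eucl n) : ℝ :=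
  (Real.sqrt (g x).det)⁻¹ * g x i j

lemma isCoef_metric {g : Eucl n → Matrix (Fin n) (Fin n) ℝ} (hg : MetricC3Bounded g)
    {θ : ℝ} (hθ : 0 < θ) (hgθ : UniformlyElliptic g θ) : IsCoef (coefA g) (coefB g) := by
  have hpd := metric_posDef hg.1 hθ hgθ
  have hdet : ∀ x, 0 < (g x).det := fun x => (hpd x).det_pos
  have hsq : ∀ x, 0 < Real.sqrt (g x).det := fun x => Real.sqrt_pos.2 (hdet x)
  have hdc := det_contDiff hg.2.1
  have hsc : ContDiff ℝ 3 fun x => Real.sqrt (g x).det := hdc.sqrt fun x => (hdet x).ne'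
  refine ⟨fun i j => ?_, fun i j x => ?_, fun x ξ hξ => ?_, fun i j => ?_, fun i j x => ?_,
    fun i k x => ?_⟩
  · refine hsc.mul ?_
    simp_rw [Matrix.inv_def, Matrix.smul_apply, Ring.inverse_eq_inv', smul_eq_mul]
    exact (hdc.inv fun x => (hdet x).ne').mul (adj_contDiff hg.2.1 i j)
  · unfold coefA
    have : ((g x)⁻¹).IsSymm := by
      rw [Matrix.IsSymm, Matrix.transpose_nonsing_inv, hg.1 x]
    rw [this.apply]
  · have h1 := (hpd x).inv.dotProduct_mulVec_pos hξ
    have h3 : star ξ ⬝ᵥ ((g x)⁻¹).mulVec ξ = ∑ i, ∑ j, (g x)⁻¹ i j * ξ i * ξ j := by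
      simp only [dotProduct, Matrix.mulVec, Finset.mul_sum, Pi.star_apply, star_trivial]
      exact Finset.sum_congr rfl fun i _ => Finset.sum_congr rfl fun j _ => by ring
    have h4 : ∑ i, ∑ j, coefA g i j x * ξ i * ξ j
        = Real.sqrt (g x).det * ∑ i, ∑ j, (g x)⁻¹ i j * ξ i * ξ j := by
      simp only [Finset.mul_sum, coefA]
      exact Finset.sum_congr rfl fun i _ => Finset.sum_congr rfl fun j _ => by ring
    rw [h4, ← h3]
    exact mul_pos (hsq x) h1
  · exact (hsc.continuous.inv₀ fun x => (hsq x).ne').mul (hg.2.1 i j).continuous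
  · unfold coefB
    rw [(hg.1 x).apply]
  · have h1 : (g x)⁻¹ * g x = 1 := Matrix.nonsing_inv_mul _ (IsUnit.mk0 _ (hdet x).ne')
    have h2 := congrFun (congrFun h1 i) k
    rw [Matrix.mul_apply, Matrix.one_apply] at h2
    rw [← h2]
    refine Finset.sum_congr rfl fun j _ => ?_
    unfold coefA coefB
    have := (hsq x).ne'
    field_simp

lemma LapBel_eq (g : Eucl n → Matrix (Fin n) (Fin n) ℝ) (u : Eucl n → ℝ) (x : Eucl n)
    (hd : 0 < (g x).det) : Lop (coefA g) u x = Real.sqrt (g x).det * LapBel g u x := by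
  have hs : Real.sqrt (g x).det ≠ 0 := (Real.sqrt_pos.2 hd).ne'
  unfold LapBel Lop
  rw [← mul_assoc, mul_inv_cancel₀ hs, one_mul]
  refine Finset.sum_congr rfl fun i _ => ?_
  congr 1
  ext y
  unfold flux coefA
  rw [Finset.mul_sum]
  exact Finset.sum_congr rfl fun j _ => by ring

lemma sol_of_ae {a b : Fin n → Fin n → Eucl n → ℝ} (hC : IsCoef a b) {B : Set (Eucl n)}
    (hB : IsOpen B) {P : ℝ} {v : Eucl n → ℝ} (hv : ContDiffOn ℝ 2 v B)
    (h : ∀ᵐ x ∂(volume : Measure (Eucl n)), x ∈ B → |Lop a v x| ≤ P * |v x|) : Sol a B P v := by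
  refine ⟨hv, fun x hx => ?_⟩
  by_contra hcon
  push Not at hcon
  obtain ⟨w, hw, U, hU, hKU, hUB, hwv⟩ := extend_smooth (k := 2) (K := {x}) hB isClosed_singleton
    (by simpa using hx) hv
  have he : ∀ y ∈ U, w =ᶠ[𝓝 y] v := fun y hy => by
    filter_upwards [hU.mem_nhds hy] with z hz using hwv z hz
  have hxU : x ∈ U := hKU rfl
  have hO : IsOpen (U ∩ {y | P * |w y| < |Lop a w y|}) :=
    hU.inter (isOpen_lt (continuous_const.mul hw.continuous.abs) (Lop_continuous hC hw).abs)
  have hne : (U ∩ {y | P * |w y| < |Lop a w y|}).Nonempty := by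
    refine ⟨x, hxU, ?_⟩
    show P * |w x| < |Lop a w x|
    rw [hwv x hxU, Lop_congr (he x hxU)]
    exact hcon
  obtain ⟨y, ⟨hyU, hy⟩, hyB⟩ := (Measure.dense_of_ae h).inter_open_nonempty _ hO hne
  have hy' : P * |w y| < |Lop a w y| := hy
  rw [hwv y hyU, Lop_congr (he y hyU)] at hy'
  exact absurd (hyB (hUB hyU)) (not_le.2 hy')

lemma frontier_nonempty {m : ℕ} {D : Set (Eucl (m + 1))} (hne : D.Nonempty)
    (hb : Bornology.IsBounded D) : (frontier D).Nonempty := by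
  rw [nonempty_iff_ne_empty]
  intro h
  rcases frontier_eq_empty_iff.1 h with h | h
  · exact hne.ne_empty h
  · rw [h] at hb
    exact NormedSpace.unbounded_univ ℝ (Eucl (m + 1)) hb
end Part21

/-- **Interior Lipschitz stability (Theorem 1.2).** -/
theorem interior_lipschitz_stability
    (n : ℕ) (hn : 2 ≤ n)
    (g : Eucl n → Matrix (Fin n) (Fin n) ℝ) (hg : MetricC3Bounded g)
    (θ : ℝ) (hθ : 0 < θ) (hgθ : UniformlyElliptic g θ)
    (p : Eucl n → ℝ) (hpmeas : Measurable p) (hpbdd : ∃ M : ℝ, ∀ x, |p x| ≤ M)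
    (B Ω : Set (Eucl n))
    (hBop : IsOpen B) (hBconn : IsConnected B) (hBbdd : Bornology.IsBounded B)
    (hBC4 : HasC4Boundary B)
    (hΩop : IsOpen Ω) (hΩconn : IsConnected Ω) (hΩbdd : Bornology.IsBounded Ω)
    (hΩC4 : HasC4Boundary Ω)
    (hΩB : closure Ω ⊆ B)
    (νS νΓ : Eucl n → Eucl n)
    (hνS : IsOutwardNormalField B νS) (hνΓ : IsOutwardNormalField Ω νΓ)
    (r : ℝ) (hr : 0 < r) :
    ∃ C : ℝ, 0 < C ∧
      ∀ (α β : ℝ), 0 < α → 0 < β → β / α ≤ r →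
      ∀ A : Eucl n → ℝ, ContDiff ℝ 1 A →
        (∀ x ∈ frontier B, α ≤ |A x|) →
        (∀ x ∈ frontier B, ‖tangGrad νS A x‖ ≤ β) →
      ∀ v : Eucl n → ℝ, ContDiffOn ℝ 2 v (closure B) →
        (∀ᵐ x ∂(volume.restrict B), -(LapBel g v x) + p x * v x = 0) →
        (∀ x ∈ frontier B, v x = A x) →
        Real.sqrt (∫ x in frontier B,
            ((A x) ^ 2 + ‖tangGrad νS A x‖ ^ 2) ∂μH[(n : ℝ) - 1]) ≤
          C * (Real.sqrt (∫ x in frontier Ω,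
                  ((v x) ^ 2 + ‖tangGrad νΓ v x‖ ^ 2) ∂μH[(n : ℝ) - 1]) +
               Real.sqrt (∫ x in frontier Ω,
                  (normalDeriv νΓ v x) ^ 2 ∂μH[(n : ℝ) - 1])) := by
  obtain ⟨m, rfl⟩ : ∃ m, n = m + 1 := ⟨n - 1, by omega⟩
  have hdim : ((m + 1 : ℕ) : ℝ) - 1 = (m : ℝ) := by push_cast; ring
  simp only [hdim]
  have hC := isCoef_metric hg hθ hgθ
  have hdet : ∀ x, 0 < (g x).det := fun x => (metric_posDef hg.1 hθ hgθ x).det_pos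
  have hcl : IsCompact (closure B) := hBbdd.isCompact_closure
  have hsc : Continuous fun x => Real.sqrt (g x).det :=
    ((det_contDiff hg.2.1).continuous).sqrt
  obtain ⟨S, hS1, hS⟩ := exists_bound1 hcl hsc
  obtain ⟨Mp, hMp⟩ := hpbdd
  set P := S * |Mp| with hPdef
  have hP : 0 ≤ P := by positivity
  have hΓne := frontier_nonempty hΩconn.nonempty hΩbdd
  have hSne := frontier_nonempty hBconn.nonempty hBbdd
  have hΓB : frontier Ω ⊆ B := frontier_subset_closure.trans hΩB
  obtain ⟨x0, hx0B, hx0⟩ := good_start hC hBop hΩbdd hΩC4 hΩB hΓne hP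
  have hD : ∀ v : Eucl (m + 1) → ℝ, 0 ≤ ∫ x in frontier Ω, En v x ∂μH[(m : ℝ)] := fun v =>
    integral_nonneg fun x => En_nonneg v x
  have hall := good_all hC hBop hBconn.isPreconnected hP hD hx0B hx0
  obtain ⟨C, hC0, hCv⟩ := sup_le_data hC hBop hBbdd hνS hP hr.le hD hall
  have hmS := frontier_measure_lt_top hBC4 hBbdd
  set L := (1 + r ^ 2) * (μH[(m : ℝ)] : Measure (Eucl (m + 1))).real (frontier B) with hL
  have hL0 : 0 ≤ L := by positivity
  refine ⟨Real.sqrt (L * C) + 1, by positivity, ?_⟩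
  intro α β hα hβ hβα A hA hAα hAβ v hv heq hvA
  obtain ⟨z, hz, hzmax⟩ := hcl.exists_isMaxOn (hBconn.nonempty.mono subset_closure) hv.continuousOn.abs
  have hle : ∀ x ∈ closure B, |v x| ≤ |v z| := fun x hx => hzmax hx
  have hαM : α ≤ |v z| := by
    obtain ⟨q, hq⟩ := hSne
    have := hle q (frontier_subset_closure hq)
    rw [hvA q hq] at this
    exact (hAα q hq).trans this
  have hβM : β ≤ r * |v z| := by
    rw [div_le_iff₀ hα] at hβα
    exact hβα.trans (mul_le_mul_of_nonneg_left hαM hr.le)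
  have hsol : Sol (coefA g) B P v := by
    refine sol_of_ae hC hBop (hv.mono subset_closure) ?_
    filter_upwards [(ae_restrict_iff' hBop.measurableSet).1 heq] with x hx hxB
    have h1 : LapBel g v x = p x * v x := by linarith [hx hxB]
    rw [LapBel_eq g v x (hdet x), h1, abs_mul, abs_mul, ← mul_assoc]
    refine mul_le_mul_of_nonneg_right ?_ (abs_nonneg _)
    exact mul_le_mul (hS x (subset_closure hxB)) ((hMp x).trans (le_abs_self _)) (abs_nonneg _)
      (by linarith)
  have hAdm : Adm (coefA g) B νS P r v A |v z| :=
    ⟨hsol, hv.continuousOn, hA, lt_of_lt_of_le hα hαM, hle, hvA, fun x hx => (hAβ x hx).trans hβM⟩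
  have hmain := hCv v A |v z| hAdm ⟨z, hz, rfl⟩
  -- left-hand side
  have hleft : ∫ x in frontier B, ((A x) ^ 2 + ‖tangGrad νS A x‖ ^ 2) ∂μH[(m : ℝ)] ≤ L * |v z| ^ 2 := by
    have h1 := norm_setIntegral_le_of_norm_le_const (μ := (μH[(m : ℝ)] : Measure (Eucl (m + 1))))
      (s := frontier B) (f := fun x => (A x) ^ 2 + ‖tangGrad νS A x‖ ^ 2)
      (C := (1 + r ^ 2) * |v z| ^ 2) hmS (fun x hx => by
        rw [Real.norm_of_nonneg (by positivity)]
        have e1 : (A x) ^ 2 ≤ |v z| ^ 2 := by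
          rw [← hvA x hx, ← sq_abs (v x)]
          exact pow_le_pow_left₀ (abs_nonneg _) (hle x (frontier_subset_closure hx)) 2
        have e2 : ‖tangGrad νS A x‖ ^ 2 ≤ (r * |v z|) ^ 2 :=
          pow_le_pow_left₀ (norm_nonneg _) ((hAβ x hx).trans hβM) 2
        rw [mul_pow] at e2
        linarith)
    refine (le_abs_self _).trans (h1.trans (le_of_eq ?_))
    rw [hL]; ring
  -- data
  have hvB : ContDiffOn ℝ 2 v B := hv.mono subset_closure
  have hgrad : ContinuousOn (gradient v) (frontier Ω) := by
    unfold gradient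
    exact (LinearIsometryEquiv.continuous _).comp_continuousOn
      ((hvB.continuousOn_fderiv_of_isOpen hBop (by norm_num)).mono hΓB)
  have hνc := normal_continuousOn hνΓ
  have hnd : ContinuousOn (normalDeriv νΓ v) (frontier Ω) := by
    unfold normalDeriv
    exact hgrad.inner hνc
  have htg : ContinuousOn (tangGrad νΓ v) (frontier Ω) := by
    unfold tangGrad
    exact hgrad.sub (hnd.smul hνc)
  have hi1 : IntegrableOn (fun x => (v x) ^ 2 + ‖tangGrad νΓ v x‖ ^ 2) (frontier Ω) μH[(m : ℝ)] :=
    integrableOn_frontier hΩC4 hΩbdd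
    (((hvB.continuousOn.mono hΓB).pow 2).add (htg.norm.pow 2))
  have hi2 : IntegrableOn (fun x => (normalDeriv νΓ v x) ^ 2) (frontier Ω) μH[(m : ℝ)] :=
    integrableOn_frontier hΩC4 hΩbdd (hnd.pow 2)
  set I1 := ∫ x in frontier Ω, ((v x) ^ 2 + ‖tangGrad νΓ v x‖ ^ 2) ∂μH[(m : ℝ)] with hI1
  set I2 := ∫ x in frontier Ω, (normalDeriv νΓ v x) ^ 2 ∂μH[(m : ℝ)] with hI2
  have hI1p : 0 ≤ I1 := integral_nonneg fun x => by positivity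
  have hI2p : 0 ≤ I2 := integral_nonneg fun x => by positivity
  have hDeq : ∫ x in frontier Ω, En v x ∂μH[(m : ℝ)] = I1 + I2 := by
    rw [hI1, hI2, ← integral_add hi1 hi2]
    exact setIntegral_congr_fun isClosed_frontier.measurableSet fun x hx => En_split hνΓ v hx
  rw [hDeq] at hmain
  have hfin : ∫ x in frontier B, ((A x) ^ 2 + ‖tangGrad νS A x‖ ^ 2) ∂μH[(m : ℝ)]
      ≤ (L * C) * (I1 + I2) := by
    refine hleft.trans ((mul_le_mul_of_nonneg_left hmain hL0).trans (le_of_eq ?_))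
    ring
  have hs : Real.sqrt (I1 + I2) ≤ Real.sqrt I1 + Real.sqrt I2 := by
    rw [Real.sqrt_le_left (by positivity)]
    nlinarith [Real.sq_sqrt hI1p, Real.sq_sqrt hI2p, Real.sqrt_nonneg I1, Real.sqrt_nonneg I2,
      mul_nonneg (Real.sqrt_nonneg I1) (Real.sqrt_nonneg I2)]
  calc Real.sqrt (∫ x in frontier B, ((A x) ^ 2 + ‖tangGrad νS A x‖ ^ 2) ∂μH[(m : ℝ)])
      ≤ Real.sqrt ((L * C) * (I1 + I2)) := Real.sqrt_le_sqrt hfin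
    _ = Real.sqrt (L * C) * Real.sqrt (I1 + I2) := Real.sqrt_mul (by positivity) _
    _ ≤ (Real.sqrt (L * C) + 1) * (Real.sqrt I1 + Real.sqrt I2) :=
        mul_le_mul (by linarith) hs (Real.sqrt_nonneg _) (by positivity)
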